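/- arXiv:2405.17819 — 4 statements merged into one kernel-verified Lean document; each statement's English description precedes it below -/
import Mathlib

section
/- Let G be a (P2+P3, gem)-free graph with ω(G) ≥ 6. If χ(G) = ⌈(5ω(G) − 1)/4⌉, then G belongs to the class 𝒞 (so χ(G) = ⌈(5ω(G) − 1)/4⌉ holds if and only if G is in 𝒞 and attains this chromatic number). -/
open SimpleGraph

/-- The graph `P2 + P3` (disjoint union of a path on 2 and a path on 3 vertices). -/
def graphP2P3 : SimpleGraph (Fin 5) :=
  SimpleGraph.fromRel (fun x y => (x, y) ∈ ([(0,1),(2,3),(3,4)] : List (Fin 5 × Fin 5)))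

/-- The gem: a path `P4` (0-1-2-3) plus a vertex 4 adjacent to all of it. -/
def graphGem : SimpleGraph (Fin 5) :=
  SimpleGraph.fromRel (fun x y =>
    (x, y) ∈ ([(0,1),(1,2),(2,3),(4,0),(4,1),(4,2),(4,3)] : List (Fin 5 × Fin 5)))

/-- The path on three vertices. -/
def graphP3 : SimpleGraph (Fin 3) :=
  SimpleGraph.fromRel (fun x y => (x, y) ∈ ([(0,1),(1,2)] : List (Fin 3 × Fin 3)))

/-- The cycle on five vertices. -/
def graphC5 : SimpleGraph (Fin 5) :=
  SimpleGraph.fromRel (fun x y => y = x + 1)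

/-- `F1`: a 5-cycle `v1 v2 v3 v4 v5` (vertices 0..4) plus a vertex 5 adjacent
exactly to `v5, v1, v2` (i.e. 4, 0, 1). -/
def graphF1 : SimpleGraph (Fin 6) :=
  SimpleGraph.fromRel (fun x y =>
    (x, y) ∈ ([(0,1),(1,2),(2,3),(3,4),(4,0),(5,4),(5,0),(5,1)] : List (Fin 6 × Fin 6)))

/-- `F1'`: a 5-cycle (0..4) plus adjacent vertices 5, 6, where 5 is adjacent to 4,0,1
and 6 is adjacent to 0,1,2. -/
def graphF1' : SimpleGraph (Fin 7) :=
  SimpleGraph.fromRel (fun x y =>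
    (x, y) ∈ ([(0,1),(1,2),(2,3),(3,4),(4,0),(5,4),(5,0),(5,1),(6,0),(6,1),(6,2),(5,6)] :
      List (Fin 7 × Fin 7)))

/-- `F1''`: a 5-cycle (0..4) plus nonadjacent vertices 5, 6, where 5 is adjacent to 4,0,1
and 6 is adjacent to 1,2,3. -/
def graphF1'' : SimpleGraph (Fin 7) :=
  SimpleGraph.fromRel (fun x y =>
    (x, y) ∈ ([(0,1),(1,2),(2,3),(3,4),(4,0),(5,4),(5,0),(5,1),(6,1),(6,2),(6,3)] :
      List (Fin 7 × Fin 7)))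

/-- `F2`: a 5-cycle (0..4) plus adjacent vertices 5, 6, each adjacent to `v1,v3,v4`
(i.e. 0, 2, 3). -/
def graphF2 : SimpleGraph (Fin 7) :=
  SimpleGraph.fromRel (fun x y =>
    (x, y) ∈ ([(0,1),(1,2),(2,3),(3,4),(4,0),(5,6),(5,0),(5,2),(5,3),(6,0),(6,2),(6,3)] :
      List (Fin 7 × Fin 7)))

/-- `F3`: a 5-cycle (0..4) plus adjacent vertices 5 (adjacent to 0,2,3) and
6 (adjacent to 2,3). -/
def graphF3 : SimpleGraph (Fin 7) :=
  SimpleGraph.fromRel (fun x y =>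
    (x, y) ∈ ([(0,1),(1,2),(2,3),(3,4),(4,0),(5,6),(5,0),(5,2),(5,3),(6,2),(6,3)] :
      List (Fin 7 × Fin 7)))

/-- `G` contains no induced copy of `H`. -/
def IsFreeOf {W V : Type*} (G : SimpleGraph V) (H : SimpleGraph W) : Prop :=
  IsEmpty (H ↪g G)

/-- The disjoint union of a clique blowup `C5⟨K_{t 0},…,K_{t 4}⟩` of the 5-cycle and
`ℓ` isolated vertices. -/
def blowupC5 (t : Fin 5 → ℕ) (ℓ : ℕ) :
    SimpleGraph ((Σ i : Fin 5, Fin (t i)) ⊕ Fin ℓ) :=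
  SimpleGraph.fromRel (fun x y => ∃ a b, x = Sum.inl a ∧ y = Sum.inl b ∧
    (a.1 = b.1 ∨ b.1 = a.1 + 1))

/-- Membership in the class `𝒞`: `G` is isomorphic to the disjoint union of a clique
blowup of `C5` and some number of isolated vertices. -/
def InClassC {V : Type*} (G : SimpleGraph V) : Prop :=
  ∃ (t : Fin 5 → ℕ) (ℓ : ℕ), (∀ i, 0 < t i) ∧ Nonempty (G ≃g blowupC5 t ℓ)

/-- The function φ from the paper. -/
noncomputable def phi (x : ℕ) : ℕ :=
  if x = 1 then 1 else if x = 2 then 4 else if x = 3 then 6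
  else ⌈(5 * (x : ℚ) - 1) / 4⌉₊

section Stmt
variable {V : Type*} (G : SimpleGraph V)

/-- `S` is complete to `S'`. -/
def CompleteTo (S S' : Set V) : Prop := ∀ x ∈ S, ∀ y ∈ S', G.Adj x y

/-- `S` is anticomplete to `S'`. -/
def AnticompleteTo (S S' : Set V) : Prop := ∀ x ∈ S, ∀ y ∈ S', ¬ G.Adj x y

/-- `S` is a stable (independent) set. -/
def IsStableSet (S : Set V) : Prop := S.Pairwise (fun x y => ¬ G.Adj x y)

/-- A graph is perfect if every induced subgraph has chromatic number equal to
its clique number. -/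
def IsPerfect : Prop :=
  ∀ S : Set V, (G.induce S).chromaticNumber = ((G.induce S).cliqueNum : ℕ∞)

variable (v : Fin 5 → V)

/-- `v` induces a `C5` in `G`: two cycle vertices are adjacent iff consecutive. -/
def IsInducedC5 : Prop :=
  Function.Injective v ∧ ∀ i j : Fin 5, G.Adj (v i) (v j) ↔ (j = i + 1 ∨ i = j + 1)

def setA (i : Fin 5) : Set V :=
  {u | u ∉ Set.range v ∧ ∀ j, G.Adj u (v j) ↔ j = i}

def setB (i : Fin 5) : Set V :=
  {u | u ∉ Set.range v ∧ ∀ j, G.Adj u (v j) ↔ (j = i ∨ j = i + 1)}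

def setX (i : Fin 5) : Set V :=
  {u | u ∉ Set.range v ∧ ∀ j, G.Adj u (v j) ↔ (j = i - 1 ∨ j = i + 1)}

def setY (i : Fin 5) : Set V :=
  {u | u ∉ Set.range v ∧ ∀ j, G.Adj u (v j) ↔ (j = i - 1 ∨ j = i ∨ j = i + 1)}

def setZ (i : Fin 5) : Set V :=
  {u | u ∉ Set.range v ∧ ∀ j, G.Adj u (v j) ↔ (j = i - 2 ∨ j = i ∨ j = i + 2)}

def setT : Set V :=
  {u | u ∉ Set.range v ∧ ∀ j, ¬ G.Adj u (v j)}

end Stmt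

namespace P2P3Gem

open Finset

/-- The vertices of `X` can be properly coloured, each `x` from the list `L x`. -/
def HasListColoring {V C : Type*} (G : SimpleGraph V) (X : Set V) (L : V → Set C) : Prop :=
  ∃ c : V → C, (∀ x ∈ X, c x ∈ L x) ∧ ∀ x ∈ X, ∀ y ∈ X, G.Adj x y → c x ≠ c y

/-- Adjacency is transitive on `X`, i.e. `X` induces a disjoint union of cliques. -/
def TransOn {V : Type*} (G : SimpleGraph V) (X : Set V) : Prop :=
  ∀ a ∈ X, ∀ b ∈ X, ∀ c ∈ X, G.Adj a b → G.Adj b c → a ≠ c → G.Adj a c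

/-- `X` contains no edge. -/
def Stable {V : Type*} (G : SimpleGraph V) (X : Set V) : Prop :=
  ∀ a ∈ X, ∀ b ∈ X, ¬ G.Adj a b

section Generic

variable {V C : Type*} {G : SimpleGraph V}

theorem TransOn.mono {X Y : Set V} (h : TransOn G Y) (hXY : X ⊆ Y) : TransOn G X :=
  fun a ha b hb c hc => h a (hXY ha) b (hXY hb) c (hXY hc)

theorem HasListColoring.mono {X Y : Set V} {L L' : V → Set C} (h : HasListColoring G Y L)
    (hXY : X ⊆ Y) (hL : ∀ x ∈ X, L x ⊆ L' x) : HasListColoring G X L' := by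
  obtain ⟨c, hc, hp⟩ := h
  exact ⟨c, fun x hx => hL x hx (hc x (hXY hx)), fun x hx y hy => hp x (hXY hx) y (hXY hy)⟩

theorem HasListColoring.iUnion {J : Type*} [Nonempty C] {X : J → Set V} {L : J → V → Set C}
    {L₀ : V → Set C} (h : ∀ j, HasListColoring G (X j) (L j))
    (hL : ∀ j, ∀ x ∈ X j, L j x ⊆ L₀ x)
    (hd : ∀ i j, i ≠ j → ∀ x ∈ X i, ∀ y ∈ X j, G.Adj x y → Disjoint (L i x) (L j y)) :
    HasListColoring G (⋃ j, X j) L₀ := by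
  classical
  choose c hc hp using h
  have hex : ∀ x ∈ ⋃ j, X j, ∃ j, x ∈ X j := fun x hx => Set.mem_iUnion.1 hx
  by_cases hJ : IsEmpty J
  · exact ⟨fun _ => Classical.arbitrary C, by simp, by simp⟩
  rw [not_isEmpty_iff] at hJ
  choose! j hj using hex
  refine ⟨fun x => if x ∈ ⋃ j, X j then c (j x) x else Classical.arbitrary C, ?_, ?_⟩
  · intro x hx
    simp only [hx, if_true]
    exact hL _ x (hj x hx) (hc _ x (hj x hx))
  · intro x hx y hy hxy
    simp only [hx, hy, if_true]
    by_cases hij : j x = j y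
    · rw [← hij]
      exact hp _ x (hj x hx) y (hij ▸ hj y hy) hxy
    · exact fun he => Set.disjoint_left.1 (hd _ _ hij x (hj x hx) y (hj y hy) hxy)
        (hc _ x (hj x hx)) (he ▸ hc _ y (hj y hy))

theorem HasListColoring.union [Nonempty C] {X Y : Set V} {L L' L₀ : V → Set C}
    (h : HasListColoring G X L) (h' : HasListColoring G Y L')
    (hL : ∀ x ∈ X, L x ⊆ L₀ x) (hL' : ∀ x ∈ Y, L' x ⊆ L₀ x)
    (hd : ∀ x ∈ X, ∀ y ∈ Y, G.Adj x y → Disjoint (L x) (L' y)) :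
    HasListColoring G (X ∪ Y) L₀ := by
  have := HasListColoring.iUnion (G := G) (J := Bool) (X := fun b => cond b X Y)
    (L := fun b => cond b L L') (L₀ := L₀) (by rintro (_ | _) <;> assumption)
    (by rintro (_ | _) <;> assumption) ?_
  · rwa [Set.union_eq_iUnion]
  · rintro (_ | _) (_ | _) hne x hx y hy hxy
    · exact absurd rfl hne
    · exact (hd y hy x hx hxy.symm).symm
    · exact hd x hx y hy hxy
    · exact absurd rfl hne

theorem Stable.hasListColoring [Nonempty C] {X : Set V} {L : V → Set C} (h : Stable G X)
    (hL : ∀ x ∈ X, (L x).Nonempty) : HasListColoring G X L := by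
  choose! c hc using hL
  exact ⟨c, hc, fun x hx y hy hxy => absurd hxy (h x hx y hy)⟩

theorem TransOn.hasListColoring [Fintype V] {X : Set V} {L : V → Set C} (hX : TransOn G X)
    (hQ : ∀ Q : Finset V, (Q : Set V) ⊆ X → G.IsClique Q →
      ∃ f : V → C, Set.InjOn f Q ∧ ∀ x ∈ Q, f x ∈ L x) : HasListColoring G X L := by
  classical
  let K : V → Finset V := fun x => univ.filter fun y => y ∈ X ∧ (y = x ∨ G.Adj y x)
  have hK : ∀ x ∈ X, (K x : Set V) ⊆ X ∧ G.IsClique (K x) := by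
    refine fun x hx => ⟨fun y hy => (mem_filter.1 hy).2.1, ?_⟩
    intro y hy z hz hyz
    simp only [K, coe_filter, mem_univ, true_and, Set.mem_ofPred_eq] at hy hz
    obtain ⟨hy, rfl | hy'⟩ := hy
    · exact (hz.2.resolve_left (Ne.symm hyz)).symm
    · obtain ⟨hz, rfl | hz'⟩ := hz
      · exact hy'
      · exact hX y hy x hx z hz hy' hz'.symm hyz
  obtain ⟨d, -⟩ := hQ ∅ (by simp) (by simp)
  have hQ' : ∀ Q : Finset V, ∃ f : V → C, ((Q : Set V) ⊆ X → G.IsClique Q →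
      Set.InjOn f Q ∧ ∀ x ∈ Q, f x ∈ L x) := by
    intro Q
    by_cases h : (Q : Set V) ⊆ X ∧ G.IsClique Q
    · obtain ⟨g, hg⟩ := hQ Q h.1 h.2
      exact ⟨g, fun _ _ => hg⟩
    · exact ⟨d, fun h1 h2 => absurd ⟨h1, h2⟩ h⟩
  choose f hf using hQ'
  have hmem : ∀ x ∈ X, x ∈ K x := fun x hx => by simp [K, hx]
  refine ⟨fun x => f (K x) x, fun x hx => (hf _ (hK x hx).1 (hK x hx).2).2 x (hmem x hx), ?_⟩
  intro x hx y hy hxy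
  have hKe : K x = K y := by
    ext z
    simp only [K, mem_filter, mem_univ, true_and, and_congr_right_iff]
    intro hz
    by_cases hzx : z = x
    · subst hzx; simp [hxy]
    by_cases hzy : z = y
    · subst hzy; simp [hxy.symm]
    simp only [hzx, hzy, false_or]
    exact ⟨fun h => hX z hz x hx y hy h hxy hzy, fun h => hX z hz y hy x hx h hxy.symm hzx⟩
  have hinj := (hf _ (hK x hx).1 (hK x hx).2).1
  change f (K x) x ≠ f (K y) y
  rw [← hKe]
  exact fun he => hxy.ne (hinj (hmem x hx) (hKe ▸ hmem y hy) he)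

theorem exists_injOn_of_card_le [Nonempty C] {Q : Finset V} {A : Finset C}
    (h : Q.card ≤ A.card) : ∃ f : V → C, Set.InjOn f Q ∧ ∀ x ∈ Q, f x ∈ (A : Set C) := by
  obtain ⟨f, hf, hinj⟩ := Set.Finite.exists_injOn_of_encard_le (s := (Q : Set V))
    (t := (A : Set C)) Q.finite_toSet (by simpa using h)
  exact ⟨f, hinj, fun x hx => hf hx⟩

theorem TransOn.hasListColoring_of_card_le [Fintype V] [Nonempty C] {X : Set V} {A : Finset C}
    (hX : TransOn G X) (hQ : ∀ Q : Finset V, (Q : Set V) ⊆ X → G.IsClique Q → Q.card ≤ A.card) :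
    HasListColoring G X (fun _ => (A : Set C)) :=
  hX.hasListColoring fun Q h1 h2 => exists_injOn_of_card_le (hQ Q h1 h2)

theorem HasListColoring.extend_stable [Fintype V] [DecidableEq C] [DecidableRel G.Adj]
    {X Y : Set V} [DecidablePred (· ∈ X)] {L : V → Finset C}
    (h : HasListColoring G X (fun x => (L x : Set C))) (hY : Stable G Y)
    (hd : ∀ y ∈ Y, (univ.filter fun x => x ∈ X ∧ G.Adj y x).card < (L y).card) :
    HasListColoring G (X ∪ Y) (fun x => (L x : Set C)) := by
  classical
  obtain ⟨c, hc, hp⟩ := h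
  have hex : ∀ y ∈ Y, ∃ a ∈ L y, ∀ x ∈ X, G.Adj y x → c x ≠ a := by
    intro y hy
    have : (image c (univ.filter fun x => x ∈ X ∧ G.Adj y x)).card < (L y).card :=
      card_image_le.trans_lt (hd y hy)
    obtain ⟨a, ha, hn⟩ := exists_mem_notMem_of_card_lt_card this
    refine ⟨a, ha, fun x hx hyx he => hn ?_⟩
    exact mem_image.2 ⟨x, by simp [hx, hyx], he⟩
  have hex' : ∀ y, ∃ a, y ∈ Y → a ∈ L y ∧ ∀ x ∈ X, G.Adj y x → c x ≠ a := by
    intro y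
    by_cases hy : y ∈ Y
    · obtain ⟨a, ha⟩ := hex y hy
      exact ⟨a, fun _ => ha⟩
    · exact ⟨c y, fun h => absurd h hy⟩
  choose d hd' using hex'
  refine ⟨fun x => if x ∈ X then c x else d x, ?_, ?_⟩
  · intro x hx
    by_cases hxX : x ∈ X
    · simpa [hxX] using hc x hxX
    · simpa [hxX] using (hd' x (hx.resolve_left hxX)).1
  · intro x hx y hy hxy
    by_cases hxX : x ∈ X <;> by_cases hyX : y ∈ X
    · simpa [hxX, hyX] using hp x hxX y hyX hxy
    · simpa [hxX, hyX] using (hd' y (hy.resolve_left hyX)).2 x hxX hxy.symm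
    · simpa [hxX, hyX] using ((hd' x (hx.resolve_left hxX)).2 y hyX hxy).symm
    · exact absurd hxy (hY x (hx.resolve_left hxX) y (hy.resolve_left hyX))

/-- A system of distinct representatives for the complements of the sets `S x`. -/
theorem exists_injOn_avoiding {ι : Type*} [Fintype ι] [DecidableEq ι] [DecidableEq V]
    (Q : Finset V) (S : V → Finset ι) (hcard : Q.card ≤ Fintype.card ι)
    (hpair : ∀ x ∈ Q, ∀ y ∈ Q, S x = S y ∨ Disjoint (S x) (S y) ∨ S x ∪ S y = univ)
    (hfib : ∀ x ∈ Q, (Q.filter fun y => S y = S x).card + (S x).card ≤ Fintype.card ι) :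
    ∃ f : V → Option ι, Set.InjOn f Q ∧ ∀ x ∈ Q, ∃ i, i ∉ S x ∧ f x = some i := by
  have hall : ∀ s : Finset Q, s.card ≤ (s.biUnion fun x => (S x)ᶜ).card := by
    intro s
    by_cases hdis : ∃ x ∈ s, ∃ y ∈ s, Disjoint (S x) (S y)
    · obtain ⟨x, hx, y, hy, hxy⟩ := hdis
      have : (s.biUnion fun x => (S x)ᶜ) = univ := by
        ext i
        simp only [mem_biUnion, mem_compl, mem_univ, iff_true]
        by_cases hi : i ∈ S x
        · exact ⟨y, hy, Finset.disjoint_left.1 hxy hi⟩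
        · exact ⟨x, hx, hi⟩
      rw [this, card_univ]
      exact (card_le_univ s).trans (by simpa using hcard)
    · push Not at hdis
      have hu : (s.biUnion fun x => (S x)ᶜ) =
          (s.image fun x : Q => S x).biUnion fun A => Aᶜ := by
        ext i; simp
      rw [hu, card_biUnion, card_eq_sum_card_image (fun x : Q => S x) s]
      · refine sum_le_sum fun A hA => ?_
        obtain ⟨x, hx, rfl⟩ := mem_image.1 hA
        have h1 := hfib x x.2
        rw [card_compl]
        have h2 : (s.filter fun y : Q => S y = S x).card ≤ (Q.filter fun y => S y = S x).card := by
          refine card_le_card_of_injOn (fun y : Q => (y : V)) ?_ Subtype.val_injective.injOn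
          intro y hy
          simp only [coe_filter, Set.mem_ofPred_eq] at hy ⊢
          exact ⟨y.2, hy.2⟩
        omega
      · intro A hA B hB hAB
        obtain ⟨x, hx, rfl⟩ := mem_image.1 (mem_coe.1 hA)
        obtain ⟨y, hy, rfl⟩ := mem_image.1 (mem_coe.1 hB)
        have := ((hpair x x.2 y y.2).resolve_left hAB).resolve_left (hdis x hx y hy)
        refine Finset.disjoint_left.2 fun i hi hi' => ?_
        have : i ∈ S x ∪ S y := by rw [this]; exact mem_univ _
        simp only [mem_compl, mem_union] at *
        tauto
  obtain ⟨f, hf, hfS⟩ := (all_card_le_biUnion_card_iff_exists_injective _).1 hall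
  refine ⟨fun x => if h : x ∈ Q then some (f ⟨x, h⟩) else none, ?_, ?_⟩
  · intro x hx y hy he
    have hx' : x ∈ Q := hx
    have hy' : y ∈ Q := hy
    simp only [hx', hy', dif_pos, Option.some.injEq] at he
    simpa using hf he
  · intro x hx
    exact ⟨f ⟨x, hx⟩, by simpa using hfS ⟨x, hx⟩, by simp [hx]⟩

end Generic

/-- A (P2+P3, gem)-free graph together with a maximum clique, indexed by `Fin n`. -/
structure CliqueFrame {V : Type*} (G : SimpleGraph V) (n : ℕ) where
  /-- The vertices of the maximum clique. -/
  k : Fin n → V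
  adj_k : ∀ {i j}, i ≠ j → G.Adj (k i) (k j)
  six_le : 6 ≤ n
  card_le : ∀ Q : Finset V, G.IsClique Q → Q.card ≤ n
  gem : ∀ c a b d e, G.Adj c a → G.Adj c b → G.Adj c d → G.Adj c e → G.Adj a b → G.Adj b d →
    G.Adj d e → ¬ G.Adj a d → ¬ G.Adj a e → ¬ G.Adj b e → False
  p2p3 : ∀ a b x y z, G.Adj a b → G.Adj x y → G.Adj y z → ¬ G.Adj x z → x ≠ z →
    ¬ G.Adj a x → ¬ G.Adj a y → ¬ G.Adj a z → ¬ G.Adj b x → ¬ G.Adj b y → ¬ G.Adj b z → False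

namespace CliqueFrame

variable {V : Type*} {G : SimpleGraph V} {n : ℕ} (F : CliqueFrame G n)

/-- The vertices adjacent to every clique vertex except the `i`-th. -/
def part (i : Fin n) : Set V := {x | ∀ j, G.Adj x (F.k j) ↔ j ≠ i}

/-- The vertices that lie in no part. -/
def outer : Set V := {x | ∀ i, x ∉ F.part i}

open Classical in
/-- The indices of the parts in which `x` has a neighbour. -/
noncomputable def nb (x : V) : Finset (Fin n) := univ.filter fun i => ∃ p ∈ F.part i, G.Adj x p

/-- The colours `some i` such that `x` has no neighbour in the `i`-th part. -/
def inner (x : V) : Set (Option (Fin n)) := {a | ∃ i, i ∉ F.nb x ∧ a = some i}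

/-- The colours allowed at `x` once the `i`-th part has received the colour `some i`. -/
def list (x : V) : Set (Option (Fin n)) := {a | ∀ i, a = some i → i ∉ F.nb x}

/-- No clique of maximum size in `X` has all its attachments in a single part. -/
def NoFull (X : Set V) : Prop :=
  ∀ Q : Finset V, (Q : Set V) ⊆ X → G.IsClique Q → Q.card = n → ∀ i, ∃ x ∈ Q, F.nb x ≠ {i}

variable {F}

theorem inner_subset_list (x : V) : F.inner x ⊆ F.list x := by
  rintro _ ⟨i, hi, rfl⟩ j hj
  rwa [← Option.some.inj hj]

theorem none_mem_list (x : V) : none ∈ F.list x := fun _ h => by cases h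

theorem some_mem_list {x : V} {i : Fin n} : some i ∈ F.list x ↔ i ∉ F.nb x :=
  ⟨fun h => h i rfl, fun h j hj => by rwa [← Option.some.inj hj]⟩

theorem mem_nb {x : V} {i : Fin n} : i ∈ F.nb x ↔ ∃ p ∈ F.part i, G.Adj x p := by
  classical
  simp [nb]

theorem mem_nb_of_adj {x p : V} {i : Fin n} (hp : p ∈ F.part i) (h : G.Adj x p) : i ∈ F.nb x :=
  mem_nb.2 ⟨p, hp, h⟩

theorem not_adj_of_notMem {x p : V} {i : Fin n} (hi : i ∉ F.nb x) (hp : p ∈ F.part i) :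
    ¬ G.Adj x p := fun h => hi (mem_nb_of_adj hp h)

theorem k_mem (i : Fin n) : F.k i ∈ F.part i := by
  intro j
  refine ⟨?_, fun h => F.adj_k h.symm⟩
  rintro h rfl
  exact h.ne rfl

theorem not_adj_k {x : V} {i : Fin n} (hi : i ∉ F.nb x) : ¬ G.Adj x (F.k i) :=
  not_adj_of_notMem hi (k_mem i)

theorem not_adj_k' {x : V} {i : Fin n} (hi : i ∉ F.nb x) : ¬ G.Adj (F.k i) x :=
  fun h => not_adj_k hi h.symm

theorem no_clique (F : CliqueFrame G n) {J : Type*} [Fintype J] (hJ : n < Fintype.card J)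
    (g : J → V) (hg : ∀ a b, a ≠ b → G.Adj (g a) (g b)) : False := by
  classical
  have hinj : Function.Injective g := fun a b h => by
    by_contra hab
    exact (hg a b hab).ne h
  have := F.card_le (univ.image g) ?_
  · rw [card_image_of_injective _ hinj, card_univ] at this
    omega
  · intro x hx y hy hxy
    simp only [coe_image, coe_univ, Set.image_univ, Set.mem_range] at hx hy
    obtain ⟨a, rfl⟩ := hx
    obtain ⟨b, rfl⟩ := hy
    exact hg a b fun h => hxy (by rw [h])

theorem part_stable {i : Fin n} {x y : V} (hx : x ∈ F.part i) (hy : y ∈ F.part i) :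
    ¬ G.Adj x y := by
  intro hxy
  refine F.no_clique (J := Option (Fin n)) (by simp)
    (fun a => a.elim x fun j => if j = i then y else F.k j) ?_
  rintro (_ | a) (_ | b) hab
  · exact absurd rfl hab
  · by_cases hb : b = i
    · simpa [hb] using hxy
    · simpa [hb] using (hx b).2 hb
  · by_cases ha : a = i
    · simpa [ha] using hxy.symm
    · simpa [ha] using ((hx a).2 ha).symm
  · have hab' : a ≠ b := fun h => hab (by rw [h])
    by_cases ha : a = i <;> by_cases hb : b = i
    · exact absurd (ha.trans hb.symm) hab'
    · simpa [ha, hb] using (hy b).2 hb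
    · simpa [ha, hb] using ((hy a).2 ha).symm
    · simpa [ha, hb] using F.adj_k hab'

theorem exists_notMem (F : CliqueFrame G n) (s : Finset (Fin n)) (hs : s.card < 6) :
    ∃ i, i ∉ s := by
  have h6 := F.six_le
  by_contra! h
  have : s = univ := by ext; simp [h]
  rw [this, card_univ, Fintype.card_fin] at hs
  omega

theorem part_adj {i j : Fin n} (hij : i ≠ j) {x y : V} (hx : x ∈ F.part i) (hy : y ∈ F.part j) :
    G.Adj x y := by
  by_contra hxy
  obtain ⟨c, hc⟩ := F.exists_notMem {i, j} (card_le_two.trans_lt (by norm_num))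
  simp only [mem_insert, mem_singleton, not_or] at hc
  exact F.gem (F.k c) x (F.k j) (F.k i) y ((hx c).2 hc.1).symm (F.adj_k hc.2) (F.adj_k hc.1)
    ((hy c).2 hc.2).symm ((hx j).2 hij.symm) (F.adj_k hij.symm) ((hy i).2 hij).symm
    (fun h => (hx i).1 h rfl) hxy (fun h => (hy j).1 h.symm rfl)

theorem part_eq {i j : Fin n} {x : V} (hx : x ∈ F.part i) (hy : x ∈ F.part j) : i = j := by
  by_contra hij
  exact (part_adj hij hx hy).ne rfl

theorem mixed {x p p' : V} {i : Fin n} (hx : x ∈ F.outer) (hp : p ∈ F.part i)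
    (hp' : p' ∈ F.part i) (h : G.Adj x p) (h' : ¬ G.Adj x p') {l : Fin n} (hl : l ≠ i) :
    l ∉ F.nb x := by
  have key : ∀ l, l ≠ i → l ∈ F.nb x → ∀ j, j ≠ i → j ≠ l → ∀ u ∈ F.part j, G.Adj x u := by
    intro l hl hlx j hji hjl u hu
    obtain ⟨q, hq, hxq⟩ := mem_nb.1 hlx
    by_contra hxu
    exact F.gem q x p u p' hxq.symm (part_adj hl hq hp) (part_adj hjl.symm hq hu)
      (part_adj hl hq hp') h (part_adj hji.symm hp hu) (part_adj hji hu hp') hxu h'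
      (part_stable hp hp')
  intro hlx
  obtain ⟨c, hc⟩ := F.exists_notMem {i, l} (card_le_two.trans_lt (by norm_num))
  simp only [mem_insert, mem_singleton, not_or] at hc
  have hcx : c ∈ F.nb x := mem_nb_of_adj (k_mem c) (key l hl hlx c hc.1 hc.2 _ (k_mem c))
  have hall : ∀ j, j ≠ i → G.Adj x (F.k j) := by
    intro j hj
    by_cases hjl : j = l
    · exact key c hc.1 hcx j hj (by rw [hjl]; exact Ne.symm hc.2) _ (k_mem j)
    · exact key l hl hlx j hj hjl _ (k_mem j)
  by_cases hi : G.Adj x (F.k i)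
  · refine F.no_clique (J := Option (Fin n)) (by simp) (fun a => a.elim x F.k) ?_
    have hall' : ∀ j, G.Adj x (F.k j) := fun j => by
      by_cases hj : j = i
      · rwa [hj]
      · exact hall j hj
    rintro (_ | a) (_ | b) hab
    · exact absurd rfl hab
    · exact hall' b
    · exact (hall' a).symm
    · exact F.adj_k fun h => hab (by rw [h])
  · refine hx i fun j => ⟨?_, hall j⟩
    rintro hj rfl
    exact hi hj

theorem adj_of_mem_nb {x p : V} {i : Fin n} (hx : x ∈ F.outer) (h2 : 2 ≤ (F.nb x).card)
    (hi : i ∈ F.nb x) (hp : p ∈ F.part i) : G.Adj x p := by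
  by_contra h
  obtain ⟨q, hq, hxq⟩ := mem_nb.1 hi
  obtain ⟨j, hj, hji⟩ := exists_mem_ne (show 1 < _ from h2) i
  exact mixed hx hq hp hxq h hji hj

theorem card_nb_le {x : V} (hx : x ∈ F.outer) : (F.nb x).card + 2 ≤ n := by
  have h6 := F.six_le
  by_cases h2 : (F.nb x).card < 2
  · omega
  push Not at h2
  have h1 : ∃ i, ¬ G.Adj x (F.k i) := by
    by_contra! hall
    refine F.no_clique (J := Option (Fin n)) (by simp) (fun a => a.elim x F.k) ?_
    rintro (_ | a) (_ | b) hab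
    · exact absurd rfl hab
    · exact hall b
    · exact (hall a).symm
    · exact F.adj_k fun h => hab (by rw [h])
  obtain ⟨i, hi⟩ := h1
  have h3 : ∃ j, j ≠ i ∧ ¬ G.Adj x (F.k j) := by
    by_contra! hall
    refine hx i fun j => ⟨?_, hall j⟩
    rintro hj rfl
    exact hi hj
  obtain ⟨j, hji, hj⟩ := h3
  have h4 : F.nb x ⊆ univ \ {i, j} := by
    intro l hl
    have := adj_of_mem_nb hx h2 hl (k_mem l)
    simp only [mem_sdiff, mem_univ, true_and, mem_insert, mem_singleton, not_or]
    exact ⟨fun h => hi (h ▸ this), fun h => hj (h ▸ this)⟩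
  have h5 := card_le_card h4
  rw [card_sdiff_of_subset (subset_univ _), card_univ, Fintype.card_fin,
    card_pair hji.symm] at h5
  omega

theorem nb_ne_univ {x : V} (hx : x ∈ F.outer) : F.nb x ≠ univ := by
  intro h
  have := card_nb_le hx
  rw [h, card_univ, Fintype.card_fin] at this
  omega

theorem two_le_card {s : Finset (Fin n)} {i j : Fin n} (hi : i ∈ s) (hj : j ∈ s) (hij : i ≠ j) :
    2 ≤ s.card := one_lt_card.2 ⟨i, hi, j, hj, hij⟩

theorem nb_subset_of_adj {x y : V} (hx : x ∈ F.outer) (hxy : G.Adj x y)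
    {i j : Fin n} (hi : i ∈ F.nb x) (hi' : i ∈ F.nb y) (hj : j ∉ F.nb x) (hj' : j ∉ F.nb y) :
    F.nb x ⊆ F.nb y := by
  intro l hl
  by_contra hl'
  have hli : l ≠ i := fun h => hl' (h ▸ hi')
  have hlj : l ≠ j := fun h => hj (h ▸ hl)
  have hij : i ≠ j := fun h => hj (h ▸ hi)
  have h2 := two_le_card hl hi hli
  obtain ⟨p, hp, hyp⟩ := mem_nb.1 hi'
  exact F.gem p y x (F.k l) (F.k j) hyp.symm (adj_of_mem_nb hx h2 hi hp).symm
    (part_adj hli.symm hp (k_mem l)) (part_adj hij hp (k_mem j)) hxy.symm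
    (adj_of_mem_nb hx h2 hl (k_mem l)) (F.adj_k hlj) (not_adj_k hl') (not_adj_k hj')
    (not_adj_k hj)

theorem nb_of_adj {x y : V} (hx : x ∈ F.outer) (hy : y ∈ F.outer) (hxy : G.Adj x y) :
    F.nb x = F.nb y ∨ Disjoint (F.nb x) (F.nb y) ∨ F.nb x ∪ F.nb y = univ := by
  by_contra! h
  obtain ⟨h1, h2, h3⟩ := h
  obtain ⟨i, hi, hi'⟩ := not_disjoint_iff.1 h2
  have : ∃ j, j ∉ F.nb x ∪ F.nb y := by
    by_contra! h
    exact h3 (by ext; simpa using h _)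
  obtain ⟨j, hj⟩ := this
  simp only [mem_union, not_or] at hj
  exact h1 ((nb_subset_of_adj hx hxy hi hi' hj.1 hj.2).antisymm
    (nb_subset_of_adj hy hxy.symm hi' hi hj.2 hj.1))

theorem nb_of_not_adj {x y : V} (hx : x ∈ F.outer) (hy : y ∈ F.outer) (hxy : ¬ G.Adj x y) :
    F.nb x ⊆ F.nb y ∨ F.nb y ⊆ F.nb x ∨ Disjoint (F.nb x) (F.nb y) := by
  by_contra! h
  obtain ⟨h1, h2, h3⟩ := h
  obtain ⟨i, hi, hi'⟩ := not_subset.1 h1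
  obtain ⟨j, hj, hj'⟩ := not_subset.1 h2
  obtain ⟨l, hl, hl'⟩ := not_disjoint_iff.1 h3
  have hli : l ≠ i := fun h => hi' (h ▸ hl')
  have hlj : l ≠ j := fun h => hj' (h ▸ hl)
  have hij : i ≠ j := fun h => hi' (h ▸ hj)
  have hx2 := two_le_card hl hi hli
  have hy2 := two_le_card hl' hj hlj
  exact F.gem (F.k l) x (F.k i) (F.k j) y (adj_of_mem_nb hx hx2 hl (k_mem l)).symm
    (F.adj_k hli) (F.adj_k hlj) (adj_of_mem_nb hy hy2 hl' (k_mem l)).symm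
    (adj_of_mem_nb hx hx2 hi (k_mem i)) (F.adj_k hij)
    (adj_of_mem_nb hy hy2 hj (k_mem j)).symm (not_adj_k hj') hxy (not_adj_k' hi')

theorem transOn_of_missing {X : Set V} {d d' : Fin n} (hd : d ≠ d')
    (h : ∀ x ∈ X, d ∉ F.nb x ∧ d' ∉ F.nb x) : TransOn G X := by
  intro a ha b hb c hc hab hbc hac
  by_contra hn
  exact F.p2p3 (F.k d) (F.k d') a b c (F.adj_k hd) hab hbc hn hac (not_adj_k' (h a ha).1)
    (not_adj_k' (h b hb).1) (not_adj_k' (h c hc).1) (not_adj_k' (h a ha).2)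
    (not_adj_k' (h b hb).2) (not_adj_k' (h c hc).2)

theorem adj_or_adj {x y z : V} {i j : Fin n} (hx : x ∈ F.outer) (hyz : G.Adj y z)
    (hi : i ∈ F.nb x) (hiy : i ∉ F.nb y) (hiz : i ∉ F.nb z) (hj : j ∉ F.nb x)
    (hjy : j ∉ F.nb y) (hjz : j ∉ F.nb z) : G.Adj x y ∨ G.Adj x z := by
  by_contra! h
  have hij : i ≠ j := fun h => hj (h ▸ hi)
  obtain ⟨p, hp, hxp⟩ := mem_nb.1 hi
  refine F.p2p3 y z x p (F.k j) hyz hxp (part_adj hij hp (k_mem j)) (not_adj_k hj) ?_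
    (fun e => h.1 e.symm) (not_adj_of_notMem hiy hp) (not_adj_k hjy) (fun e => h.2 e.symm)
    (not_adj_of_notMem hiz hp) (not_adj_k hjz)
  rintro rfl
  exact hx j (k_mem j)

theorem card_add_card_le {Q : Finset V} {S : Finset (Fin n)} (hQ : (Q : Set V) ⊆ F.outer)
    (hc : G.IsClique Q) (hS : ∀ x ∈ Q, F.nb x = S) (h2 : 2 ≤ S.card) : Q.card + S.card ≤ n := by
  by_contra! hlt
  have hadj : ∀ (q : Q) (s : S), G.Adj q (F.k s) := fun q s =>
    adj_of_mem_nb (hQ q.2) (by rw [hS q q.2]; exact h2) (by rw [hS q q.2]; exact s.2) (k_mem _)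
  refine F.no_clique (J := Q ⊕ S) (by simpa using hlt)
    (Sum.elim (fun q : Q => (q : V)) fun s : S => F.k s) ?_
  rintro (a | a) (b | b) hab
  · exact hc a.2 b.2 fun h => hab (by rw [Subtype.ext h])
  · exact hadj a b
  · exact (hadj b a).symm
  · exact F.adj_k fun h => hab (by rw [Subtype.ext h])

theorem NoFull.mono {X Y : Set V} (h : F.NoFull Y) (hXY : X ⊆ Y) : F.NoFull X :=
  fun Q hQ => h Q (hQ.trans hXY)

theorem hasListColoring_inner [Fintype V] {X : Set V} (hX : X ⊆ F.outer) (ht : TransOn G X)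
    (hf : F.NoFull X) : HasListColoring G X F.inner := by
  classical
  have h6 := F.six_le
  refine ht.hasListColoring fun Q hQ hc => ?_
  refine exists_injOn_avoiding Q F.nb (by simpa using F.card_le Q hc) ?_ ?_
  · intro x hx y hy
    by_cases hxy : x = y
    · exact Or.inl (by rw [hxy])
    · exact nb_of_adj (hX (hQ hx)) (hX (hQ hy)) (hc hx hy hxy)
  · intro x hx
    rw [Fintype.card_fin]
    have hsub : (Q.filter fun y => F.nb y = F.nb x) ⊆ Q := filter_subset _ _
    have hle := card_le_card hsub
    have hQn := F.card_le Q hc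
    by_cases h2 : 2 ≤ (F.nb x).card
    · exact card_add_card_le (((coe_subset.2 hsub).trans hQ).trans hX)
        (hc.subset (coe_subset.2 hsub)) (fun y hy => (mem_filter.1 hy).2) h2
    by_contra! hlt
    have h1 : (F.nb x).card = 1 := by omega
    obtain ⟨i, hi⟩ := card_eq_one.1 h1
    have he := eq_of_subset_of_card_le hsub (by omega)
    obtain ⟨y, hy, hne⟩ := hf Q hQ hc (by omega) i
    rw [← he] at hy
    exact hne ((mem_filter.1 hy).2.trans hi)

theorem colorable (h : HasListColoring G F.outer F.list) : G.Colorable (n + 1) := by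
  classical
  obtain ⟨c, hc, hp⟩ := h
  have hout : ∀ x, (¬ ∃ i, x ∈ F.part i) → x ∈ F.outer := fun x hx i hi => hx ⟨i, hi⟩
  let f : V → Option (Fin n) := fun x => if h : ∃ i, x ∈ F.part i then some h.choose else c x
  have hf1 : ∀ x i, x ∈ F.part i → f x = some i := by
    intro x i hi
    have h : ∃ i, x ∈ F.part i := ⟨i, hi⟩
    simp only [f, h, dif_pos]
    rw [part_eq h.choose_spec hi]
  have hf2 : ∀ x ∈ F.outer, f x = c x := by
    intro x hx
    have h : ¬ ∃ i, x ∈ F.part i := fun ⟨i, hi⟩ => hx i hi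
    simp only [f, h, dif_neg, not_false_iff]
  have hmain : ∀ x y i, x ∈ F.part i → G.Adj x y → f x ≠ f y := by
    intro x y i hi hxy he
    by_cases hy : ∃ j, y ∈ F.part j
    · obtain ⟨j, hj⟩ := hy
      rw [hf1 x i hi, hf1 y j hj] at he
      rw [← Option.some.inj he] at hj
      exact part_stable hi hj hxy
    · rw [hf1 x i hi, hf2 y (hout y hy)] at he
      exact hc y (hout y hy) i he.symm (mem_nb_of_adj hi hxy.symm)
  let C : G.Coloring (Option (Fin n)) := SimpleGraph.Coloring.mk f (by
    intro x y hxy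
    by_cases hx : ∃ i, x ∈ F.part i
    · obtain ⟨i, hi⟩ := hx
      exact hmain x y i hi hxy
    by_cases hy : ∃ i, y ∈ F.part i
    · obtain ⟨i, hi⟩ := hy
      exact (hmain y x i hi hxy.symm).symm
    · rw [hf2 x (hout x hx), hf2 y (hout y hy)]
      exact hp x (hout x hx) y (hout y hy) hxy)
  simpa using C.colorable

end CliqueFrame

theorem inClassC_of_map {V : Type*} [Fintype V] {G : SimpleGraph V} (col : V → Option (Fin 5))
    (hne : ∀ a, ∃ x, col x = some a)
    (h0 : ∀ a x y, col x = some a → col y = some a → x ≠ y → G.Adj x y)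
    (h1 : ∀ a x y, col x = some a → col y = some (a + 1) → G.Adj x y)
    (h2 : ∀ a x y, col x = some a → col y = some (a + 2) → ¬ G.Adj x y)
    (hi : ∀ x y, col x = none → ¬ G.Adj x y) : InClassC G := by
  classical
  let t : Fin 5 → ℕ := fun a => Fintype.card {x // col x = some a}
  let ℓ : ℕ := Fintype.card {x // col x = none}
  let g : ((Σ a : Fin 5, Fin (t a)) ⊕ Fin ℓ) → V :=
    Sum.elim (fun p => ((Fintype.equivFin {x // col x = some p.1}).symm p.2).1)
      fun q => ((Fintype.equivFin {x // col x = none}).symm q).1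
  have hgl : ∀ p, col (g (Sum.inl p)) = some p.1 := fun p =>
    ((Fintype.equivFin {x // col x = some p.1}).symm p.2).2
  have hgr : ∀ q, col (g (Sum.inr q)) = none := fun q =>
    ((Fintype.equivFin {x // col x = none}).symm q).2
  have hinj : Function.Injective g := by
    rintro (⟨a, p⟩ | p) (⟨b, q⟩ | q) h
    · have hab : some a = some b := by rw [← hgl ⟨a, p⟩, ← hgl ⟨b, q⟩, h]
      obtain rfl := Option.some.inj hab
      have := (Fintype.equivFin {x // col x = some a}).symm.injective (Subtype.ext h)
      obtain rfl : p = q := this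
      rfl
    · have := (hgl ⟨a, p⟩).symm.trans ((congrArg col h).trans (hgr q))
      cases this
    · have := (hgr p).symm.trans ((congrArg col h).trans (hgl ⟨b, q⟩))
      cases this
    · have := (Fintype.equivFin {x // col x = none}).symm.injective (Subtype.ext h)
      rw [this]
  have hsurj : Function.Surjective g := by
    intro x
    rcases hx : col x with _ | a
    · exact ⟨Sum.inr (Fintype.equivFin {x // col x = none} ⟨x, hx⟩), by simp [g]⟩
    · exact ⟨Sum.inl ⟨a, Fintype.equivFin {x // col x = some a} ⟨x, hx⟩⟩, by simp [g]⟩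
  have hbij : Function.Bijective g := ⟨hinj, hsurj⟩
  refine ⟨t, ℓ, fun a => ?_, ⟨(RelIso.mk (Equiv.ofBijective g hbij) ?_ :
    blowupC5 t ℓ ≃g G).symm⟩⟩
  · obtain ⟨x, hx⟩ := hne a
    exact Fintype.card_pos_iff.2 ⟨⟨x, hx⟩⟩
  · intro p q
    change G.Adj (g p) (g q) ↔ _
    rw [blowupC5, SimpleGraph.fromRel_adj]
    rcases p with p | p
    · rcases q with q | q
      · have key : ∀ a b : Fin 5, a = b ∨ b = a + 1 ∨ a = b + 1 ∨ b = a + 2 ∨ a = b + 2 := by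
          decide
        have kn : ∀ a : Fin 5, a ≠ a + 2 ∧ a + 2 ≠ a + 1 ∧ a ≠ a + 2 + 1 := by decide
        have hp := hgl p
        have hq := hgl q
        rcases key p.1 q.1 with h | h | h | h | h
        · refine ⟨fun hadj => ⟨fun he => hadj.ne (by rw [he]), Or.inl ⟨p, q, rfl, rfl, .inl h⟩⟩,
            fun hne' => h0 p.1 _ _ hp (by rw [hq, h]) (hinj.ne hne'.1)⟩
        · refine ⟨fun hadj => ⟨fun he => hadj.ne (by rw [he]), Or.inl ⟨p, q, rfl, rfl, .inr h⟩⟩,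
            fun _ => h1 p.1 _ _ hp (by rw [hq, h])⟩
        · refine ⟨fun hadj => ⟨fun he => hadj.ne (by rw [he]), Or.inr ⟨q, p, rfl, rfl, .inr h⟩⟩,
            fun _ => (h1 q.1 _ _ hq (by rw [hp, h])).symm⟩
        · refine iff_of_false (h2 p.1 _ _ hp (by rw [hq, h])) ?_
          rintro ⟨-, ⟨a, b, ha, hb, hab⟩ | ⟨a, b, ha, hb, hab⟩⟩
          · obtain rfl := Sum.inl_injective ha
            obtain rfl := Sum.inl_injective hb
            rw [h] at hab
            exact hab.elim (kn _).1 (kn _).2.1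
          · obtain rfl := Sum.inl_injective ha
            obtain rfl := Sum.inl_injective hb
            rw [h] at hab
            exact hab.elim (kn _).1.symm (kn _).2.2
        · refine iff_of_false (fun e => h2 q.1 _ _ hq (by rw [hp, h]) e.symm) ?_
          rintro ⟨-, ⟨a, b, ha, hb, hab⟩ | ⟨a, b, ha, hb, hab⟩⟩
          · obtain rfl := Sum.inl_injective ha
            obtain rfl := Sum.inl_injective hb
            rw [h] at hab
            exact hab.elim (kn _).1.symm (kn _).2.2
          · obtain rfl := Sum.inl_injective ha
            obtain rfl := Sum.inl_injective hb
            rw [h] at hab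
            exact hab.elim (kn _).1 (kn _).2.1
      · refine iff_of_false (fun e => hi _ _ (hgr q) e.symm) ?_
        rintro ⟨-, ⟨a, b, ha, hb, -⟩ | ⟨a, b, ha, hb, -⟩⟩
        · cases hb
        · cases ha
    · refine iff_of_false (hi _ _ (hgr p)) ?_
      rintro ⟨-, ⟨a, b, ha, hb, -⟩ | ⟨a, b, ha, hb, -⟩⟩
      · cases ha
      · cases hb

namespace CliqueFrame

variable {V : Type*} {G : SimpleGraph V} {n : ℕ} {F : CliqueFrame G n}

variable (F) in
/-- The outer vertices without neighbours in any part. -/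
def free : Set V := {x | x ∈ F.outer ∧ F.nb x = ∅}

theorem not_complete (F : CliqueFrame G n) {Q : Finset V} (hc : G.IsClique Q) (hn : n ≤ Q.card)
    {c : V} (h : ∀ x ∈ Q, G.Adj c x) : False := by
  refine F.no_clique (J := Option Q) (by simpa [Nat.lt_succ_iff] using hn)
    (fun a => a.elim c fun q => q) ?_
  rintro (_ | a) (_ | b) hab
  · exact absurd rfl hab
  · exact h b b.2
  · exact (h a a.2).symm
  · exact hc a.2 b.2 fun h => hab (by rw [Subtype.ext h])

theorem exists_two_notMem {s : Finset (Fin n)} (hs : s.card + 2 ≤ n) :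
    ∃ d d', d ≠ d' ∧ d ∉ s ∧ d' ∉ s := by
  have : 1 < sᶜ.card := by rw [card_compl, Fintype.card_fin]; omega
  obtain ⟨d, hd, d', hd', hne⟩ := one_lt_card.1 this
  exact ⟨d, d', hne, mem_compl.1 hd, mem_compl.1 hd'⟩

theorem transOn_insert_free {x : V} (hx : x ∈ F.outer) : TransOn G (insert x F.free) := by
  obtain ⟨d, d', hne, hd, hd'⟩ := exists_two_notMem (card_nb_le hx)
  refine transOn_of_missing (F := F) hne ?_
  rintro y (rfl | ⟨-, hy⟩)
  · exact ⟨hd, hd'⟩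
  · rw [hy]; exact ⟨notMem_empty _, notMem_empty _⟩

theorem exists_notMem_nb {x : V} (hx : x ∈ F.outer) : ∃ j, j ∉ F.nb x := by
  obtain ⟨d, -, -, hd, -⟩ := exists_two_notMem (card_nb_le hx)
  exact ⟨d, hd⟩

theorem adj_free_or_adj_free {x t t' : V} (hx : x ∈ F.outer) (hne : (F.nb x).Nonempty)
    (ht : t ∈ F.free) (ht' : t' ∈ F.free) (h : G.Adj t t') : G.Adj x t ∧ G.Adj x t' := by
  obtain ⟨i, hi⟩ := hne
  obtain ⟨j, hj⟩ := exists_notMem_nb hx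
  have hxt : ∀ t ∈ F.free, x ≠ t := by
    rintro t ht rfl
    rw [ht.2] at hi
    exact notMem_empty _ hi
  have htr := transOn_insert_free hx
  have := adj_or_adj (F := F) hx h hi (by simp [ht.2]) (by simp [ht'.2]) hj (by simp [ht.2])
    (by simp [ht'.2])
  rcases this with h1 | h1
  · exact ⟨h1, htr x (by simp) t (by simp [ht]) t' (by simp [ht']) h1 h (hxt t' ht')⟩
  · exact ⟨htr x (by simp) t' (by simp [ht']) t (by simp [ht]) h1 h.symm (hxt t ht), h1⟩

theorem k_injective (F : CliqueFrame G n) : Function.Injective F.k := fun i j h => by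
  by_contra hij
  exact (F.adj_k hij).ne h

theorem eq_k_of_free_edge {c c' p : V} {i : Fin n} (hc : c ∈ F.free) (hc' : c' ∈ F.free)
    (h : G.Adj c c') (hp : p ∈ F.part i) : p = F.k i := by
  by_contra hne
  obtain ⟨j, hj⟩ := F.exists_notMem {i} (by simp)
  have hj : j ≠ i := by simpa using hj
  have hn : ∀ t ∈ F.free, ∀ i, ∀ q ∈ F.part i, ¬ G.Adj t q := fun t ht i q hq =>
    not_adj_of_notMem (by simp [ht.2]) hq
  exact F.p2p3 c c' p (F.k j) (F.k i) h (part_adj hj.symm hp (k_mem j)) (F.adj_k hj)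
    (part_stable hp (k_mem i)) hne (hn c hc i p hp) (hn c hc j _ (k_mem j))
    (hn c hc i _ (k_mem i)) (hn c' hc' i p hp) (hn c' hc' j _ (k_mem j))
    (hn c' hc' i _ (k_mem i))

theorem inClassC_or_hasListColoring_of_free_edge [Fintype V] {c c' : V} (hc : c ∈ F.free)
    (hc' : c' ∈ F.free) (hcc : G.Adj c c') :
    InClassC G ∨ HasListColoring G F.outer F.list := by
  classical
  have h6 := F.six_le
  have hfo : F.free ⊆ F.outer := fun _ h => h.1
  have hparts : ∀ {i p}, p ∈ F.part i → p = F.k i := eq_k_of_free_edge hc hc' hcc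
  have hnbk : ∀ {x i}, i ∈ F.nb x → G.Adj x (F.k i) := by
    intro x i hi
    obtain ⟨p, hp, h⟩ := mem_nb.1 hi
    rwa [hparts hp] at h
  have hxc : ∀ {x}, x ∈ F.outer → (F.nb x).Nonempty → G.Adj x c := fun hx hne =>
    (adj_free_or_adj_free hx hne hc hc' hcc).1
  have hcomp : ∀ {x t}, x ∈ F.outer → (F.nb x).Nonempty → t ∈ F.free → (t = c ∨ G.Adj t c) →
      G.Adj x t := by
    rintro x t hx hne ht (rfl | htc)
    · exact hxc hx hne
    · exact (adj_free_or_adj_free hx hne ht hc htc).1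
  have hiso : ∀ {x t}, x ∈ F.outer → (F.nb x).Nonempty → t ∈ F.free → G.Adj x t →
      t = c ∨ G.Adj t c := by
    intro x t hx hne ht hxt
    by_contra! hn
    exact hn.2 (transOn_insert_free hx t (by simp [ht]) x (by simp) c (by simp [hc]) hxt.symm
      (hxc hx hne) hn.1)
  have hfull : F.NoFull F.outer := by
    intro Q hQ hQc hQn i
    by_contra! h
    exact F.not_complete hQc hQn.ge (c := c) fun x hx =>
      (hxc (hQ hx) (by simp [h x hx])).symm
  by_cases hcl : ∀ x ∈ F.outer, ∀ y ∈ F.outer, (F.nb x).Nonempty → (F.nb y).Nonempty → x ≠ y →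
      G.Adj x y
  · right
    have ht : TransOn G F.outer := by
      intro a ha b hb d hd hab hbd had
      by_cases hae : (F.nb a).Nonempty
      · by_cases hde : (F.nb d).Nonempty
        · exact hcl a ha d hd hae hde had
        have hdf : d ∈ F.free := ⟨hd, not_nonempty_iff_eq_empty.1 hde⟩
        by_cases hbe : (F.nb b).Nonempty
        · exact hcomp ha hae hdf (hiso hb hbe hdf hbd)
        · exact transOn_insert_free ha a (by simp) b
            (.inr ⟨hb, not_nonempty_iff_eq_empty.1 hbe⟩) d (.inr hdf) hab hbd had
      have haf : a ∈ F.free := ⟨ha, not_nonempty_iff_eq_empty.1 hae⟩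
      by_cases hde : (F.nb d).Nonempty
      · by_cases hbe : (F.nb b).Nonempty
        · exact (hcomp hd hde haf (hiso hb hbe haf hab.symm)).symm
        · exact transOn_insert_free hd a (.inr haf) b
            (.inr ⟨hb, not_nonempty_iff_eq_empty.1 hbe⟩) d (by simp) hab hbd had
      have hdf : d ∈ F.free := ⟨hd, not_nonempty_iff_eq_empty.1 hde⟩
      exact transOn_insert_free hb a (.inr haf) b (by simp) d (.inr hdf) hab hbd had
    exact (hasListColoring_inner subset_rfl ht hfull).mono subset_rfl
      fun x _ => inner_subset_list x
  push Not at hcl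
  obtain ⟨x, hx, x', hx', hxe, hxe', hne, hxx⟩ := hcl
  have hnadj : ∀ {y y'}, y ∈ F.outer → y' ∈ F.outer → (F.nb y).Nonempty → (F.nb y').Nonempty →
      y ≠ y' → ¬ G.Adj y y' →
      Disjoint (F.nb y) (F.nb y') ∧ n ≤ (F.nb y ∪ F.nb y').card + 1 := by
    intro y y' hy hy' hye hye' hyy hn
    have hcard : n ≤ (F.nb y ∪ F.nb y').card + 1 := by
      by_contra! hlt
      obtain ⟨d, d', hdd, hd, hd'⟩ := exists_two_notMem (s := F.nb y ∪ F.nb y') (by omega)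
      simp only [mem_union, not_or] at hd hd'
      have := transOn_of_missing (F := F) (X := {y, c, y'}) hdd (by
        rintro z (rfl | rfl | rfl)
        · exact ⟨hd.1, hd'.1⟩
        · simp [hc.2]
        · exact ⟨hd.2, hd'.2⟩)
      exact hn (this y (by simp) c (by simp) y' (by simp) (hxc hy hye) (hxc hy' hye').symm hyy)
    refine ⟨?_, hcard⟩
    rcases nb_of_not_adj hy hy' hn with h | h | h
    · rw [union_eq_right.2 h] at hcard
      have := card_nb_le hy'
      omega
    · rw [union_eq_left.2 h] at hcard
      have := card_nb_le hy
      omega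
    · exact h
  obtain ⟨hdis, hcard⟩ := hnadj hx hx' hxe hxe' hne hxx
  have hsame : ∀ {y y'}, y ∈ F.outer → y' ∈ F.outer → (F.nb y).Nonempty → F.nb y = F.nb y' →
      y ≠ y' → G.Adj y y' := by
    intro y y' hy hy' hye he hyy
    by_contra hn
    have := (hnadj hy hy' hye (he ▸ hye) hyy hn).1
    rw [← he, disjoint_self] at this
    exact hye.ne_empty this
  have hclass : ∀ {y}, y ∈ F.outer → (F.nb y).Nonempty → F.nb y = F.nb x ∨ F.nb y = F.nb x' ∨
      (Disjoint (F.nb y) (F.nb x) ∧ Disjoint (F.nb y) (F.nb x')) := by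
    intro y hy hye
    by_contra! hcon
    obtain ⟨h1, h2, h3⟩ := hcon
    have hyu := nb_ne_univ hy
    have e1 : Disjoint (F.nb y) (F.nb x) ∨ F.nb y ∪ F.nb x = univ := by
      by_cases hadj : G.Adj y x
      · exact (nb_of_adj hy hx hadj).resolve_left h1
      · exact .inl (hnadj hy hx hye hxe (fun h => h1 (by rw [h])) hadj).1
    have e2 : Disjoint (F.nb y) (F.nb x') ∨ F.nb y ∪ F.nb x' = univ := by
      by_cases hadj : G.Adj y x'
      · exact (nb_of_adj hy hx' hadj).resolve_left h2
      · exact .inl (hnadj hy hx' hye hxe' (fun h => h2 (by rw [h])) hadj).1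
    have cov : ∀ {A B : Finset (Fin n)}, F.nb y ∪ A = univ → Disjoint A B → B ⊆ F.nb y := by
      intro A B hA hAB i hi
      have : i ∈ F.nb y ∪ A := hA ▸ mem_univ i
      exact (mem_union.1 this).resolve_right (Finset.disjoint_right.1 hAB hi)
    have ncov : ∀ {A : Finset (Fin n)}, A.Nonempty → A ⊆ F.nb y → ¬ Disjoint (F.nb y) A := by
      rintro A ⟨i, hi⟩ hA hd
      exact Finset.disjoint_left.1 hd (hA hi) hi
    rcases e1 with e1 | e1
    · rcases e2 with e2 | e2
      · exact h3 e1 e2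
      · exact ncov hxe (cov e2 hdis.symm) e1
    · rcases e2 with e2 | e2
      · exact ncov hxe' (cov e1 hdis) e2
      · have hs := cov e2 hdis.symm
        rw [union_eq_left.2 hs] at e1
        exact hyu e1
  have hallnone : ∀ {y z w}, y ∈ F.outer → z ∈ F.outer → w ∈ F.outer → (F.nb y).Nonempty →
      (F.nb z).Nonempty → F.nb z = F.nb w → Disjoint (F.nb y) (F.nb z) → G.Adj y z →
      G.Adj y w := by
    intro y z w hy hz hw hye hze hzw hd hyz
    by_contra hyw
    obtain ⟨s, hs⟩ := hze
    exact F.gem z (F.k s) w c y (hnbk hs) (hsame hz hw ⟨s, hs⟩ hzw (fun h => hyw (h ▸ hyz)))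
      (hxc hz ⟨s, hs⟩) hyz.symm (hnbk (hzw ▸ hs)).symm (hxc hw (hzw ▸ ⟨s, hs⟩))
      (hxc hy hye).symm (not_adj_k' (by simp [hc.2]))
      (not_adj_k' (Finset.disjoint_right.1 hd hs)) (fun h => hyw h.symm)
  have hanti : ∀ {y y'}, y ∈ F.outer → y' ∈ F.outer → F.nb y = F.nb x → F.nb y' = F.nb x' →
      ¬ G.Adj y y' := by
    intro y y' hy hy' he he' hadj
    have h1 := hallnone hy hy' hx' (he ▸ hxe) (he' ▸ hxe') he' (by rwa [he, he']) hadj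
    exact hxx (hallnone hx' hy hx hxe' (he ▸ hxe) he (by rw [he]; exact hdis.symm) h1.symm).symm
  by_cases hu : F.nb x ∪ F.nb x' = univ
  · left
    have hne' : F.nb x ≠ F.nb x' := fun h => by
      rw [← h, disjoint_self] at hdis
      exact hxe.ne_empty hdis
    have hclass' : ∀ {y}, y ∈ F.outer → (F.nb y).Nonempty →
        F.nb y = F.nb x ∨ F.nb y = F.nb x' := by
      intro y hy hye
      rcases hclass hy hye with h | h | ⟨h1, h2⟩
      · exact .inl h
      · exact .inr h
      · have := disjoint_union_right.2 ⟨h1, h2⟩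
        rw [hu] at this
        obtain ⟨i, hi⟩ := hye
        exact absurd (mem_univ i) (Finset.disjoint_left.1 this hi)
    have hkout : ∀ i, F.k i ∉ F.outer := fun i h => h i (k_mem i)
    have hkne : ∀ i, F.nb (F.k i) ≠ ∅ := by
      intro i h
      obtain ⟨j, hj⟩ := F.exists_notMem {i} (by simp)
      have := mem_nb_of_adj (F := F) (k_mem j) (F.adj_k (Ne.symm (by simpa using hj) : i ≠ j))
      simp [h] at this
    let col : V → Option (Fin 5) := fun v =>
      if v ∈ F.outer then
        if F.nb v = F.nb x' then some 2
        else if F.nb v = F.nb x then some 4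
        else if v = c ∨ G.Adj v c then some 3 else none
      else if ∃ i ∈ F.nb x, v = F.k i then some 0 else some 1
    have hcol : ∀ v, (col v = some 0 ∧ ∃ i ∈ F.nb x, v = F.k i) ∨
        (col v = some 1 ∧ ∃ i ∈ F.nb x', v = F.k i) ∨
        (col v = some 2 ∧ v ∈ F.outer ∧ F.nb v = F.nb x') ∨
        (col v = some 3 ∧ v ∈ F.free ∧ (v = c ∨ G.Adj v c)) ∨
        (col v = some 4 ∧ v ∈ F.outer ∧ F.nb v = F.nb x) ∨
        (col v = none ∧ v ∈ F.free ∧ ¬ (v = c ∨ G.Adj v c)) := by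
      intro v
      by_cases hv : v ∈ F.outer
      · by_cases h1 : F.nb v = F.nb x'
        · simp [col, hv, h1]
        by_cases h2 : F.nb v = F.nb x
        · simp [col, hv, h2, hne']
        have hvf : v ∈ F.free := by
          refine ⟨hv, ?_⟩
          by_contra h
          exact (hclass' hv (nonempty_iff_ne_empty.2 h)).elim h2 h1
        by_cases h3 : v = c ∨ G.Adj v c
        · have : col v = some 3 := by simp only [col, hv, h1, h2, h3, if_true, if_false]
          exact .inr (.inr (.inr (.inl ⟨this, hvf, h3⟩)))
        · have : col v = none := by simp only [col, hv, h1, h2, h3, if_true, if_false]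
          exact .inr (.inr (.inr (.inr (.inr ⟨this, hvf, h3⟩))))
      · by_cases h1 : ∃ i ∈ F.nb x, v = F.k i
        · left
          exact ⟨by simp only [col, hv, h1, if_true, if_false], h1⟩
        · right; left
          refine ⟨by simp only [col, hv, h1, if_false], ?_⟩
          simp only [outer, Set.mem_ofPred_eq, not_forall, not_not] at hv
          obtain ⟨i, hi⟩ := hv
          have hvk := hparts hi
          have : i ∈ F.nb x ∪ F.nb x' := hu ▸ mem_univ i
          exact ⟨i, (mem_union.1 this).resolve_left fun h => h1 ⟨i, h, hvk⟩, hvk⟩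
    have c0 : ∀ {v}, col v = some 0 → ∃ i ∈ F.nb x, v = F.k i := by
      intro v hv
      rcases hcol v with h | h | h | h | h | h <;> first | exact h.2 | simp [hv] at h
    have c1 : ∀ {v}, col v = some 1 → ∃ i ∈ F.nb x', v = F.k i := by
      intro v hv
      rcases hcol v with h | h | h | h | h | h <;> first | exact h.2 | simp [hv] at h
    have c2 : ∀ {v}, col v = some 2 → v ∈ F.outer ∧ F.nb v = F.nb x' := by
      intro v hv
      rcases hcol v with h | h | h | h | h | h <;> first | exact h.2 | simp [hv] at h
    have c3 : ∀ {v}, col v = some 3 → v ∈ F.free ∧ (v = c ∨ G.Adj v c) := by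
      intro v hv
      rcases hcol v with h | h | h | h | h | h <;> first | exact h.2 | simp [hv] at h
    have c4 : ∀ {v}, col v = some 4 → v ∈ F.outer ∧ F.nb v = F.nb x := by
      intro v hv
      rcases hcol v with h | h | h | h | h | h <;> first | exact h.2 | simp [hv] at h
    have c5 : ∀ {v}, col v = none → v ∈ F.free ∧ ¬ (v = c ∨ G.Adj v c) := by
      intro v hv
      rcases hcol v with h | h | h | h | h | h <;> first | exact h.2 | simp [hv] at h
    have hdl : ∀ {i}, i ∈ F.nb x → i ∉ F.nb x' := fun h => Finset.disjoint_left.1 hdis h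
    refine inClassC_of_map col ?_ ?_ ?_ ?_ ?_
    · intro a
      obtain ⟨i, hi⟩ := hxe
      obtain ⟨j, hj⟩ := hxe'
      have hcne : ∅ ≠ F.nb x' := fun h => by simp [← h] at hj
      have hcne' : ∅ ≠ F.nb x := fun h => by simp [← h] at hi
      fin_cases a
      · refine ⟨F.k i, ?_⟩
        have : ∃ l ∈ F.nb x, F.k i = F.k l := ⟨i, hi, rfl⟩
        simp only [col, hkout, this, if_true, if_false]
        rfl
      · refine ⟨F.k j, ?_⟩
        have : ¬ ∃ l ∈ F.nb x, F.k j = F.k l := by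
          rintro ⟨l, hl, h⟩
          rw [← F.k_injective h] at hl
          exact hdl hl hj
        simp only [col, hkout, this, if_false]
        rfl
      · exact ⟨x', by simp [col, hx']⟩
      · exact ⟨c, by simp [col, hc.1, hc.2, hcne, hcne']⟩
      · exact ⟨x, by simp [col, hx, hne']⟩
    · intro a v w hv hw hvw
      fin_cases a
      · obtain ⟨i, -, rfl⟩ := c0 hv
        obtain ⟨j, -, rfl⟩ := c0 hw
        exact F.adj_k fun h => hvw (by rw [h])
      · obtain ⟨i, -, rfl⟩ := c1 hv
        obtain ⟨j, -, rfl⟩ := c1 hw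
        exact F.adj_k fun h => hvw (by rw [h])
      · have hv := c2 hv
        have hw := c2 hw
        exact hsame hv.1 hw.1 (hv.2 ▸ hxe') (hv.2.trans hw.2.symm) hvw
      · have hv := c3 hv
        have hw := c3 hw
        rcases hv.2 with h | h
        · rw [h] at hvw ⊢
          exact (hw.2.resolve_left hvw.symm).symm
        rcases hw.2 with h' | h'
        · rwa [h']
        · exact transOn_insert_free hc.1 v (.inr hv.1) c (by simp) w (.inr hw.1) h h'.symm hvw
      · have hv := c4 hv
        have hw := c4 hw
        exact hsame hv.1 hw.1 (hv.2 ▸ hxe) (hv.2.trans hw.2.symm) hvw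
    · intro a v w hv hw
      fin_cases a
      · obtain ⟨i, hi, rfl⟩ := c0 hv
        obtain ⟨j, hj, rfl⟩ := c1 hw
        exact F.adj_k fun h => hdl hi (h ▸ hj)
      · obtain ⟨i, hi, rfl⟩ := c1 hv
        have hw := c2 hw
        exact (hnbk (hw.2 ▸ hi)).symm
      · have hv := c2 hv
        have hw := c3 hw
        exact hcomp hv.1 (hv.2 ▸ hxe') hw.1 hw.2
      · have hv := c3 hv
        have hw := c4 hw
        exact (hcomp hw.1 (hw.2 ▸ hxe) hv.1 hv.2).symm
      · have hv := c4 hv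
        obtain ⟨i, hi, rfl⟩ := c0 hw
        exact hnbk (hv.2 ▸ hi)
    · intro a v w hv hw
      fin_cases a
      · obtain ⟨i, hi, rfl⟩ := c0 hv
        have hw := c2 hw
        exact not_adj_k' (by rw [hw.2]; exact hdl hi)
      · obtain ⟨i, hi, rfl⟩ := c1 hv
        have hw := c3 hw
        exact not_adj_k' (by simp [hw.1.2])
      · have hv := c2 hv
        have hw := c4 hw
        exact fun h => hanti hw.1 hv.1 hw.2 hv.2 h.symm
      · have hv := c3 hv
        obtain ⟨i, hi, rfl⟩ := c0 hw
        exact not_adj_k (by simp [hv.1.2])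
      · have hv := c4 hv
        obtain ⟨i, hi, rfl⟩ := c1 hw
        exact not_adj_k (by rw [hv.2]; exact fun h => hdl h hi)
    · intro v w hv hvw
      obtain ⟨hv, hn⟩ := c5 hv
      by_cases hw : w ∈ F.outer
      · by_cases hwe : (F.nb w).Nonempty
        · exact hn (hiso hw hwe hv hvw.symm)
        · exact hn (hiso hx hxe hv (adj_free_or_adj_free hx hxe hv
            ⟨hw, not_nonempty_iff_eq_empty.1 hwe⟩ hvw).1)
      · simp only [outer, Set.mem_ofPred_eq, not_forall, not_not] at hw
        obtain ⟨i, hi⟩ := hw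
        exact not_adj_of_notMem (by simp [hv.2]) hi hvw
  · right
    have : ∃ m, m ∉ F.nb x ∪ F.nb x' := by
      by_contra! h
      exact hu (by ext; simpa using h _)
    obtain ⟨m, hm⟩ := this
    simp only [mem_union, not_or] at hm
    obtain ⟨s, hs⟩ := hxe
    obtain ⟨s', hs'⟩ := hxe'
    have single : ∀ {u v w : V} {i : Fin n}, u ∈ F.outer → v ∈ F.outer → w ∈ F.outer →
        F.nb v = F.nb w → i ∈ F.nb u → i ∉ F.nb w → m ∉ F.nb u → m ∉ F.nb w → ¬ G.Adj u v →
        ¬ G.Adj u w → (F.nb w).Nonempty → v = w := by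
      intro u v w i huo hvo hwo hvw hiu hiw hmu hmw huv huw hwe
      by_contra hne
      have hadj := hsame hvo hwo (hvw ▸ hwe) hvw hne
      rcases adj_or_adj huo hadj hiu (hvw ▸ hiw) hiw hmu (hvw ▸ hmw) hmw with h | h
      · exact huv h
      · exact huw h
    have hW : ∀ {y}, y ∈ F.outer → F.nb y = F.nb x → y = x := fun hy he =>
      single hx' hy hx he hs' (Finset.disjoint_right.1 hdis hs') hm.2 hm.1
        (fun h => hanti hy hx' he rfl h.symm) (fun h => hxx h.symm) ⟨s, hs⟩
    have hW' : ∀ {y}, y ∈ F.outer → F.nb y = F.nb x' → y = x' := fun hy he =>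
      single hx hy hx' he hs (Finset.disjoint_left.1 hdis hs) hm.1 hm.2
        (hanti hx hy rfl he) hxx ⟨s', hs'⟩
    let R : Set V := {y | y ∈ F.outer ∧ s ∉ F.nb y ∧ s' ∉ F.nb y}
    have hR : HasListColoring G R F.inner := by
      refine hasListColoring_inner (fun _ h => h.1) (transOn_of_missing (d := s) (d' := s') ?_
        fun y hy => hy.2) (hfull.mono fun _ h => h.1)
      rintro rfl
      exact Finset.disjoint_left.1 hdis hs hs'
    have hst : HasListColoring G {x, x'} (fun _ => {(none : Option (Fin n))}) := by
      refine Stable.hasListColoring ?_ (by simp)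
      rintro a (rfl | rfl) b (rfl | rfl) h
      · exact h.ne rfl
      · exact hxx h
      · exact hxx h.symm
      · exact h.ne rfl
    refine (hst.union hR (L₀ := F.list) ?_ (fun y _ => inner_subset_list y) ?_).mono ?_
      fun _ _ => subset_rfl
    · rintro y - _ rfl
      exact none_mem_list y
    · rintro y - z - -
      refine Set.disjoint_left.2 ?_
      rintro _ rfl ⟨i, -, h⟩
      cases h
    · intro y hy
      by_cases hye : (F.nb y).Nonempty
      · rcases hclass hy hye with h | h | ⟨h1, h2⟩
        · exact .inl (.inl (hW hy h))
        · exact .inl (.inr (hW' hy h))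
        · exact .inr ⟨hy, Finset.disjoint_right.1 h1 hs, Finset.disjoint_right.1 h2 hs'⟩
      · rw [not_nonempty_iff_eq_empty] at hye
        exact .inr ⟨hy, by simp [hye], by simp [hye]⟩

variable (F) in
/-- `S` is a nonempty inclusion-maximal set of the form `F.nb w`. -/
def IsTop (S : Finset (Fin n)) : Prop :=
  S.Nonempty ∧ (∃ w ∈ F.outer, F.nb w = S) ∧ ∀ x ∈ F.outer, S ⊆ F.nb x → F.nb x = S

variable (F) in
/-- The outer vertices attached only to parts with index in `S`, and to at least one of them. -/
def under (S : Finset (Fin n)) : Set V := {x | x ∈ F.outer ∧ (F.nb x).Nonempty ∧ F.nb x ⊆ S}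

variable (F) in
/-- Any two distinct maximal attachment sets are disjoint and do not cover all indices. -/
def Separated : Prop :=
  ∀ S S', F.IsTop S → F.IsTop S' → S ≠ S' → Disjoint S S' ∧ S ∪ S' ≠ univ

theorem under_subset_outer {S : Finset (Fin n)} : F.under S ⊆ F.outer := fun _ h => h.1

theorem IsTop.card_le {S : Finset (Fin n)} (hS : F.IsTop S) : S.card + 2 ≤ n := by
  obtain ⟨-, ⟨w, hw, rfl⟩, -⟩ := hS
  exact card_nb_le hw

theorem IsTop.ne_univ {S : Finset (Fin n)} (hS : F.IsTop S) : S ≠ univ := by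
  obtain ⟨-, ⟨w, hw, rfl⟩, -⟩ := hS
  exact nb_ne_univ hw

theorem transOn_of_subset {X : Set V} {S : Finset (Fin n)} (hS : S.card + 2 ≤ n)
    (h : ∀ x ∈ X, F.nb x ⊆ S) : TransOn G X := by
  obtain ⟨d, d', hne, hd, hd'⟩ := exists_two_notMem hS
  exact transOn_of_missing (F := F) hne fun x hx =>
    ⟨fun h' => hd (h x hx h'), fun h' => hd' (h x hx h')⟩

theorem IsTop.transOn_union {S : Finset (Fin n)} (hS : F.IsTop S) :
    TransOn G (F.under S ∪ F.free) := by
  refine transOn_of_subset (F := F) hS.card_le ?_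
  rintro x (hx | hx)
  · exact hx.2.2
  · simp [hx.2]

theorem IsTop.transOn {S : Finset (Fin n)} (hS : F.IsTop S) : TransOn G (F.under S) :=
  hS.transOn_union.mono Set.subset_union_left

theorem exists_isTop {x : V} (hx : x ∈ F.outer) (hne : (F.nb x).Nonempty) :
    ∃ S, F.IsTop S ∧ x ∈ F.under S := by
  obtain ⟨S, hle, hS⟩ := (Set.toFinite {S | ∃ w ∈ F.outer, F.nb w = S}).exists_le_maximal
    (a := F.nb x) ⟨x, hx, rfl⟩
  refine ⟨S, ⟨hne.mono hle, hS.1, fun y hy h => ?_⟩, hx, hne, hle⟩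
  exact (hS.2 (y := F.nb y) ⟨y, hy, rfl⟩ h).antisymm h

theorem disjoint_or_cover {S S' : Finset (Fin n)} (hS : F.IsTop S) (hS' : F.IsTop S')
    (hne : S ≠ S') : Disjoint S S' ∨ S ∪ S' = univ := by
  obtain ⟨-, ⟨w, hw, rfl⟩, hm⟩ := hS
  obtain ⟨-, ⟨w', hw', rfl⟩, hm'⟩ := hS'
  by_cases h : G.Adj w w'
  · exact (nb_of_adj hw hw' h).resolve_left hne
  · rcases nb_of_not_adj hw hw' h with h | h | h
    · exact absurd (hm w' hw' h).symm hne
    · exact absurd (hm' w hw h) hne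
    · exact .inl h

theorem cover_or_separated :
    (∀ S S', F.IsTop S → F.IsTop S' → S ≠ S' → S ∪ S' = univ) ∨ F.Separated := by
  by_cases hc : ∀ S S', F.IsTop S → F.IsTop S' → S ≠ S' → S ∪ S' = univ
  · exact .inl hc
  right
  push Not at hc
  obtain ⟨S, S', hS, hS', hne, hn⟩ := hc
  have hd := (disjoint_or_cover hS hS' hne).resolve_right hn
  have key : ∀ {R T T'}, F.IsTop R → F.IsTop T → F.IsTop T' → T ∪ T' = univ → R ≠ T →
      R ∪ T = univ := by
    intro R T T' hR hT hT' hu hRT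
    rcases disjoint_or_cover hR hT hRT with h | h
    · have hsub : R ⊆ T' := fun i hi =>
        (mem_union.1 (hu ▸ mem_univ i : i ∈ T ∪ T')).resolve_left (Finset.disjoint_left.1 h hi)
      obtain ⟨-, ⟨w, hw, rfl⟩, -⟩ := hT'
      rw [← hR.2.2 w hw hsub, union_comm]
      exact hu
    · exact h
  intro T T' hT hT' hTT
  have hcov : T ∪ T' ≠ univ := by
    intro hu
    by_cases h1 : S = T
    · subst h1
      exact hn (by rw [union_comm]; exact key hS' hT hT' hu hne.symm)
    by_cases h2 : S' = T
    · subst h2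
      exact hn (key hS hT hT' hu hne)
    have e1 := key hS hT hT' hu h1
    have e2 := key hS' hT hT' hu h2
    refine hT.ne_univ (eq_univ_of_forall fun i => ?_)
    by_cases hi : i ∈ S
    · exact (mem_union.1 (e2 ▸ mem_univ i : i ∈ S' ∪ T)).resolve_left
        (Finset.disjoint_left.1 hd hi)
    · exact (mem_union.1 (e1 ▸ mem_univ i : i ∈ S ∪ T)).resolve_left hi
  exact ⟨(disjoint_or_cover hT hT' hTT).resolve_right hcov, hcov⟩

theorem IsTop.nb_of_adj_under {S : Finset (Fin n)} (hS : F.IsTop S) {y z : V}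
    (hy : y ∈ F.under S) (hz : z ∈ F.under S) (h : G.Adj y z) :
    F.nb y = F.nb z ∨ Disjoint (F.nb y) (F.nb z) := by
  rcases nb_of_adj hy.1 hz.1 h with h | h | h
  · exact .inl h
  · exact .inr h
  · exact absurd (eq_univ_iff_forall.2 fun i => union_subset hy.2.2 hz.2.2
      (h ▸ mem_univ i)) hS.ne_univ

theorem IsTop.not_adj_under {S : Finset (Fin n)} (hS : F.IsTop S) {w y : V} (hw : w ∈ F.outer)
    (hwS : F.nb w = S) (hy : y ∈ F.under S) (hyS : F.nb y ≠ S) : ¬ G.Adj w y := by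
  intro h
  have hwu : w ∈ F.under S := ⟨hw, hwS ▸ hS.1, hwS.le⟩
  rcases hS.nb_of_adj_under hwu hy h with h | h
  · exact hyS (h.symm.trans hwS)
  · obtain ⟨i, hi⟩ := hy.2.1
    exact Finset.disjoint_left.1 h (hwS ▸ hy.2.2 hi) hi

theorem IsTop.nb_of_edge {S : Finset (Fin n)} (hS : F.IsTop S) {y z : V}
    (hy : y ∈ F.under S) (hz : z ∈ F.under S) (h : G.Adj y z) (hyS : F.nb y ≠ S) :
    F.nb z ≠ S ∧ Disjoint (F.nb y) (F.nb z) ∧ F.nb y ∪ F.nb z = S := by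
  obtain ⟨w, hw, hwS⟩ := hS.2.1
  have hzS : F.nb z ≠ S := fun hzS => hS.not_adj_under hz.1 hzS hy hyS h.symm
  have hu : F.nb y ∪ F.nb z = S := by
    refine (union_subset hy.2.2 hz.2.2).antisymm fun i hi => ?_
    by_contra hn
    simp only [mem_union, not_or] at hn
    obtain ⟨j, hj⟩ := exists_notMem_nb hw
    have hjS : j ∉ S := hwS ▸ hj
    rcases adj_or_adj hw h (hwS ▸ hi) hn.1 hn.2 hj (fun e => hjS (hy.2.2 e))
      fun e => hjS (hz.2.2 e) with e | e
    · exact hS.not_adj_under hw hwS hy hyS e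
    · exact hS.not_adj_under hw hwS hz hzS e
  refine ⟨hzS, (hS.nb_of_adj_under hy hz h).resolve_left fun e => hyS ?_, hu⟩
  rw [← hu, ← e, union_self]

theorem IsTop.clique_under {S : Finset (Fin n)} (hS : F.IsTop S) {Q : Finset V}
    (hQ : (Q : Set V) ⊆ F.under S) (hc : G.IsClique Q) :
    (∀ x ∈ Q, F.nb x = S) ∨ Q.card ≤ 2 := by
  by_contra! h
  obtain ⟨⟨y, hy, hyS⟩, h2⟩ := h
  obtain ⟨z, hz, w, hw, hzw, hzy, hwy⟩ : ∃ z ∈ Q, ∃ w ∈ Q, z ≠ w ∧ z ≠ y ∧ w ≠ y := by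
    classical
    have : 1 < (Q.erase y).card := by rw [card_erase_of_mem hy]; omega
    obtain ⟨z, hz, w, hw, hne⟩ := one_lt_card.1 this
    exact ⟨z, mem_of_mem_erase hz, w, mem_of_mem_erase hw, hne, ne_of_mem_erase hz,
      ne_of_mem_erase hw⟩
  obtain ⟨hzS, d1, u1⟩ := hS.nb_of_edge (hQ hy) (hQ hz) (hc hy hz hzy.symm) hyS
  obtain ⟨-, d2, u2⟩ := hS.nb_of_edge (hQ hy) (hQ hw) (hc hy hw hwy.symm) hyS
  obtain ⟨-, d3, -⟩ := hS.nb_of_edge (hQ hz) (hQ hw) (hc hz hw hzw) hzS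
  obtain ⟨i, hi⟩ := (hQ hz).2.1
  have : i ∈ F.nb y ∪ F.nb w := u2 ▸ (hQ hz).2.2 hi
  exact (mem_union.1 this).elim (Finset.disjoint_right.1 d1 hi) (Finset.disjoint_left.1 d3 hi)

theorem IsTop.card_clique_le {S : Finset (Fin n)} (hS : F.IsTop S) (h2 : 2 ≤ S.card)
    {Q : Finset V} (hQ : (Q : Set V) ⊆ F.under S) (hc : G.IsClique Q) :
    Q.card + S.card ≤ n := by
  rcases hS.clique_under hQ hc with h | h
  · exact card_add_card_le (hQ.trans under_subset_outer) hc h h2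
  · have := hS.card_le
    omega

theorem IsTop.card_clique_le_succ {S : Finset (Fin n)} (hS : F.IsTop S) (hf : Stable G F.free)
    {Q : Finset V} (hQ : (Q : Set V) ⊆ F.under S ∪ F.free) (hc : G.IsClique Q) :
    Q.card + S.card ≤ n + 1 := by
  classical
  by_cases h2 : 2 ≤ S.card
  · have h1 : (Q.filter (· ∈ F.free)).card ≤ 1 := by
      refine card_le_one.2 fun a ha b hb => ?_
      rw [mem_filter] at ha hb
      by_contra hab
      exact hf a ha.2 b hb.2 (hc ha.1 hb.1 hab)
    have h3 : (Q.filter (¬ · ∈ F.free)).card + S.card ≤ n := by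
      refine hS.card_clique_le h2 ?_ (hc.subset (coe_subset.2 (filter_subset _ _)))
      intro x hx
      rw [mem_coe, mem_filter] at hx
      exact (hQ hx.1).resolve_right hx.2
    have := card_filter_add_card_filter_not (s := Q) (· ∈ F.free)
    omega
  · have := F.card_le Q hc
    omega

theorem Separated.adj_or_adj (hs : F.Separated) {S S' : Finset (Fin n)} (hS : F.IsTop S)
    (hS' : F.IsTop S') (hne : S ≠ S') {x y z : V} (hy : y ∈ F.under S) (hz : z ∈ F.under S)
    (hyz : G.Adj y z) (hx : x ∈ F.under S') : G.Adj x y ∨ G.Adj x z := by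
  obtain ⟨hd, hu⟩ := hs S S' hS hS' hne
  obtain ⟨i, hi⟩ := hx.2.1
  have hiS : i ∉ S := Finset.disjoint_right.1 hd (hx.2.2 hi)
  obtain ⟨j, hj⟩ : ∃ j, j ∉ S ∪ S' := by
    by_contra! h
    exact hu (eq_univ_of_forall h)
  simp only [mem_union, not_or] at hj
  exact CliqueFrame.adj_or_adj hx.1 hyz hi (fun e => hiS (hy.2.2 e)) (fun e => hiS (hz.2.2 e))
    (fun e => hj.2 (hx.2.2 e)) (fun e => hj.1 (hy.2.2 e)) fun e => hj.1 (hz.2.2 e)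

theorem Separated.eq_of_not_adj (hs : F.Separated) {S S' : Finset (Fin n)} (hS : F.IsTop S)
    (hS' : F.IsTop S') (hne : S ≠ S') {Q : Finset V} (hQ : (Q : Set V) ⊆ F.under S)
    (hc : G.IsClique Q) {x y z : V} (hx : x ∈ F.under S') (hy : y ∈ Q) (hz : z ∈ Q)
    (hxy : ¬ G.Adj x y) (hxz : ¬ G.Adj x z) : y = z := by
  by_contra hyz
  exact (hs.adj_or_adj hS hS' hne (hQ hy) (hQ hz) (hc hy hz hyz) hx).elim hxy hxz

theorem map_some_subset_list {x : V} {S A : Finset (Fin n)} (h : F.nb x ⊆ S)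
    (hA : Disjoint A S) : ((A.map Function.Embedding.some : Finset _) : Set _) ⊆ F.list x := by
  intro a ha
  simp only [coe_map, Set.mem_image, mem_coe, Function.Embedding.some_apply] at ha
  obtain ⟨i, hi, rfl⟩ := ha
  exact some_mem_list.2 fun e => Finset.disjoint_left.1 hA hi (h e)

theorem insertNone_subset_list {x : V} {S A : Finset (Fin n)} (h : F.nb x ⊆ S)
    (hA : Disjoint A S) : ((insertNone A : Finset _) : Set _) ⊆ F.list x := by
  rintro (_ | i) ha
  · exact none_mem_list x
  · rw [mem_coe, some_mem_insertNone] at ha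
    exact some_mem_list.2 fun e => Finset.disjoint_left.1 hA ha (h e)

theorem disjoint_map_some {A B : Finset (Fin n)} (h : Disjoint A B) :
    Disjoint ((A.map Function.Embedding.some : Finset _) : Set (Option (Fin n)))
      ((B.map Function.Embedding.some : Finset _) : Set (Option (Fin n))) := by
  rw [disjoint_coe]
  exact (disjoint_map _).2 h

theorem disjoint_map_insertNone {A B : Finset (Fin n)} (h : Disjoint A B) :
    Disjoint ((A.map Function.Embedding.some : Finset _) : Set (Option (Fin n)))
      ((insertNone B : Finset _) : Set (Option (Fin n))) := by
  rw [disjoint_coe, Finset.disjoint_left]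
  rintro (_ | i) ha hb
  · simp at ha
  · simp only [mem_map, Function.Embedding.some_apply, Option.some.injEq, exists_eq_right] at ha
    exact Finset.disjoint_left.1 h ha (some_mem_insertNone.1 hb)

theorem disjoint_map_none {A : Finset (Fin n)} :
    Disjoint ((A.map Function.Embedding.some : Finset _) : Set (Option (Fin n))) {none} := by
  simp

theorem free_hasListColoring (hf : Stable G F.free) :
    HasListColoring G F.free (fun _ => {(none : Option (Fin n))}) :=
  hf.hasListColoring (by simp)

theorem mem_free_or_exists_isTop {x : V} (hx : x ∈ F.outer) :
    x ∈ F.free ∨ ∃ S, F.IsTop S ∧ x ∈ F.under S := by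
  by_cases h : (F.nb x).Nonempty
  · exact .inr (exists_isTop hx h)
  · exact .inl ⟨hx, not_nonempty_iff_eq_empty.1 h⟩

theorem hasListColoring_of_tops (hf : Stable G F.free) (A : Finset (Fin n) → Finset (Fin n))
    (h : ∀ S, F.IsTop S → HasListColoring G (F.under S)
      fun _ => (((A S).map Function.Embedding.some : Finset _) : Set (Option (Fin n))))
    (hA : ∀ S, F.IsTop S → Disjoint (A S) S)
    (hd : ∀ S S', F.IsTop S → F.IsTop S' → S ≠ S' → Disjoint (A S) (A S')) :
    HasListColoring G F.outer F.list := by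
  have h1 := HasListColoring.iUnion (G := G) (J := {S // F.IsTop S}) (X := fun S => F.under S)
    (L := fun S _ => (((A S).map Function.Embedding.some : Finset _) : Set (Option (Fin n))))
    (L₀ := fun x => F.list x ∩ {none}ᶜ) (fun S => h S S.2) (by
      rintro ⟨S, hS⟩ x hx
      exact Set.subset_inter (map_some_subset_list hx.2.2 (hA S hS))
        (Set.subset_compl_iff_disjoint_right.2 disjoint_map_none)) (by
      rintro ⟨S, hS⟩ ⟨S', hS'⟩ hne x - y - -
      exact disjoint_map_some (hd S S' hS hS' fun e => hne (Subtype.ext e)))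
  refine (h1.union (free_hasListColoring hf) (L₀ := F.list) (fun x _ => Set.inter_subset_left)
    (fun x _ => Set.singleton_subset_iff.2 (none_mem_list x)) fun x _ y _ _ =>
    Set.disjoint_left.2 fun a ha ha' => ha.2 ha').mono ?_ fun _ _ => subset_rfl
  intro x hx
  rcases mem_free_or_exists_isTop hx with h | ⟨S, hS, hxS⟩
  · exact .inr h
  · exact .inl (Set.mem_iUnion.2 ⟨⟨S, hS⟩, hxS⟩)

theorem hasListColoring_of_cover [Fintype V] (hf : Stable G F.free)
    (hc : ∀ S S', F.IsTop S → F.IsTop S' → S ≠ S' → S ∪ S' = univ) :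
    HasListColoring G F.outer F.list := by
  classical
  by_cases h1 : ∃ S, F.IsTop S ∧ ∀ S', F.IsTop S' → S' = S
  · obtain ⟨S, hS, huniq⟩ := h1
    have := hS.transOn_union.hasListColoring_of_card_le (A := insertNone Sᶜ) fun Q hQ hQc => by
      have := hS.card_clique_le_succ hf hQ hQc
      rw [card_insertNone, card_compl, Fintype.card_fin]
      omega
    refine this.mono ?_ ?_
    · intro x hx
      rcases mem_free_or_exists_isTop hx with h | ⟨S', hS', hxS⟩
      · exact .inr h
      · exact .inl (huniq S' hS' ▸ hxS)
    · intro x hx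
      refine insertNone_subset_list (S := S) ?_ disjoint_compl_left
      rcases mem_free_or_exists_isTop hx with h | ⟨S', hS', hxS⟩
      · simp [h.2]
      · exact huniq S' hS' ▸ hxS.2.2
  · push Not at h1
    refine hasListColoring_of_tops hf (fun S => Sᶜ) ?_ (fun S _ => disjoint_compl_left) ?_
    · intro S hS
      obtain ⟨S', hS', hne⟩ := h1 S hS
      refine hS.transOn.hasListColoring_of_card_le fun Q hQ hQc => ?_
      have e1 := congrArg card (hc S S' hS hS' hne.symm)
      have e2 := card_union_le S S'
      have e3 := hS'.card_le
      rw [card_univ, Fintype.card_fin] at e1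
      have := hS.card_clique_le (by omega) hQ hQc
      rw [card_map, card_compl, Fintype.card_fin]
      omega
    · intro S S' hS hS' hne
      rw [Finset.disjoint_left]
      intro i hi hi'
      rw [mem_compl] at hi hi'
      exact (mem_union.1 (hc S S' hS hS' hne ▸ mem_univ i : i ∈ S ∪ S')).elim hi hi'

theorem Separated.hasListColoring_of_stable (hs : F.Separated) (hf : Stable G F.free)
    (h : ∀ S, F.IsTop S → Stable G (F.under S)) : HasListColoring G F.outer F.list := by
  classical
  let T : Finset (Finset (Fin n)) := univ.filter fun S => F.IsTop S
  have hT : ∀ {S}, S ∈ T ↔ F.IsTop S := by simp [T]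
  have hcard : T.card ≤ Fintype.card (Fin n) := by
    have h1 : (T.biUnion id).card = ∑ S ∈ T, (id S).card :=
      card_biUnion fun S hS S' hS' hne => (hs S S' (hT.1 hS) (hT.1 hS') hne).1
    have h2 : ∑ S ∈ T, 1 ≤ ∑ S ∈ T, (id S).card :=
      sum_le_sum fun S hS => card_pos.2 (hT.1 hS).1
    have h3 := card_le_univ (T.biUnion id)
    rw [sum_const, smul_eq_mul, mul_one] at h2
    omega
  obtain ⟨f, hinj, hfS⟩ := exists_injOn_avoiding T id hcard
    (fun S hS S' hS' => by
      by_cases hne : S = S'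
      · exact .inl hne
      · exact .inr (.inl (hs S S' (hT.1 hS) (hT.1 hS') hne).1))
    (fun S hS => by
      have h1 : (T.filter fun S' => id S' = id S) = {S} := by
        ext S'
        simp only [id, mem_filter, mem_singleton, and_iff_right_iff_imp]
        rintro rfl
        exact hS
      have := (hT.1 hS).card_le
      rw [h1, card_singleton, Fintype.card_fin, id]
      omega)
  have : Nonempty (Fin n) := ⟨⟨0, by have := F.six_le; omega⟩⟩
  choose! g hg hfg using hfS
  refine hasListColoring_of_tops hf (fun S => {g S}) ?_ ?_ ?_
  · intro S hS
    exact (h S hS).hasListColoring fun _ _ => by simp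
  · intro S hS
    exact disjoint_singleton_left.2 (hg S (hT.2 hS))
  · intro S S' hS hS' hne
    rw [disjoint_singleton]
    intro e
    exact hne (hinj (hT.2 hS) (hT.2 hS') (by rw [hfg S (hT.2 hS), hfg S' (hT.2 hS'), e]))

theorem IsTop.eq_of_mem_under (hs : F.Separated) {S S' : Finset (Fin n)} (hS : F.IsTop S)
    (hS' : F.IsTop S') {x : V} {i : Fin n} (hx : x ∈ F.under S) (hi : i ∈ F.nb x)
    (hi' : i ∈ S') : S = S' := by
  by_contra hne
  exact Finset.disjoint_left.1 (hs S S' hS hS' hne).1 (hx.2.2 hi) hi'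

theorem hasListColoring_of_far_edge [Fintype V] (hs : F.Separated) (hf : Stable G F.free)
    {I : Finset (Fin n)} (hI : F.IsTop I) {b b' : V} (hb : b ∈ F.under I) (hb' : b' ∈ F.under I)
    (hbb : G.Adj b b') (hfar : ∀ J, F.IsTop J → J ≠ I → (I ∪ J).card + 2 ≤ n)
    (hex : ∃ J, F.IsTop J ∧ J ≠ I ∧ (F.under J).Nonempty) :
    HasListColoring G F.outer F.list := by
  classical
  have hIJ : ∀ {J}, F.IsTop J → J ≠ I → TransOn G (F.under I ∪ F.under J) := by
    intro J hJ hne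
    refine transOn_of_subset (F := F) (hfar J hJ hne) ?_
    rintro x (hx | hx)
    · exact hx.2.2.trans subset_union_left
    · exact hx.2.2.trans subset_union_right
  have hend : ∀ {J x y y'}, F.IsTop J → J ≠ I → x ∈ F.under J → y ∈ F.under I → y' ∈ F.under I →
      G.Adj y y' → G.Adj x y := by
    intro J x y y' hJ hne hx hy hy' h
    rcases hs.adj_or_adj hI hJ hne.symm hy hy' h hx with h1 | h1
    · exact h1
    · refine hIJ hJ hne x (.inr hx) y' (.inl hy') y (.inl hy) h1 h.symm ?_
      rintro rfl
      obtain ⟨i, hi⟩ := hx.2.1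
      exact hne (hJ.eq_of_mem_under hs hI hx hi (hy.2.2 hi))
  have hxb : ∀ {J x}, F.IsTop J → J ≠ I → x ∈ F.under J → G.Adj x b := fun hJ hne hx =>
    hend hJ hne hx hb hb' hbb
  have hcl : ∀ {J x y}, F.IsTop J → J ≠ I → x ∈ F.under J → y ∈ F.under J → x ≠ y →
      G.Adj x y := fun {J x y} hJ hne hx hy hxy =>
    hIJ hJ hne x (.inr hx) b (.inl hb) y (.inr hy) (hxb hJ hne hx) (hxb hJ hne hy).symm hxy
  have h6 := F.six_le
  have hfull : F.NoFull F.outer := by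
    intro Q hQ hQc hQn i
    by_contra! h
    obtain ⟨q, hq, q', hq', hqq⟩ := one_lt_card.1 (show 1 < Q.card by omega)
    obtain ⟨T, hT, hqT⟩ := exists_isTop (hQ hq) (by rw [h q hq]; simp)
    have hQT : (Q : Set V) ⊆ F.under T := fun y hy =>
      ⟨hQ hy, by rw [h y hy]; simp, by rw [h y hy, ← h q hq]; exact hqT.2.2⟩
    by_cases hTI : T = I
    · subst hTI
      obtain ⟨J, hJ, hne, x, hx⟩ := hex
      refine F.not_complete hQc hQn.ge (c := x) fun y hy => ?_
      obtain ⟨z, hz, hzy⟩ := exists_mem_ne (show 1 < Q.card by omega) y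
      exact hend hJ hne hx (hQT hy) (hQT hz) (hQc hy hz hzy.symm)
    · exact F.not_complete hQc hQn.ge (c := b) fun y hy => (hxb hT hTI (hQT hy)).symm
  by_cases hall : ∀ J K, F.IsTop J → F.IsTop K → J ≠ I → K ≠ I → J ≠ K → ∀ x ∈ F.under J,
      ∀ y ∈ F.under K, G.Adj x y
  · have hcore : ∀ {x y}, x ∈ F.outer → (F.nb x).Nonempty → y ∈ F.outer → (F.nb y).Nonempty →
        (x = b ∨ G.Adj x b) → (y = b ∨ G.Adj y b) → x ≠ y → G.Adj x y := by
      rintro x y hx hxe hy hye (rfl | hx1) (rfl | hy1) hxy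
      · exact absurd rfl hxy
      · exact hy1.symm
      · exact hx1
      obtain ⟨J, hJ, hxJ⟩ := exists_isTop hx hxe
      obtain ⟨K, hK, hyK⟩ := exists_isTop hy hye
      by_cases hJI : J = I
      · subst hJI
        by_cases hKI : K = J
        · subst hKI
          exact hI.transOn x hxJ b hb y hyK hx1 hy1.symm hxy
        · exact hIJ hK hKI x (.inl hxJ) b (.inl hb) y (.inr hyK) hx1 hy1.symm hxy
      · by_cases hKI : K = I
        · subst hKI
          exact hIJ hJ hJI x (.inr hxJ) b (.inl hb) y (.inl hyK) hx1 hy1.symm hxy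
        by_cases hJK : J = K
        · subst hJK
          exact hcl hJ hJI hxJ hyK hxy
        · exact hall J K hJ hK hJI hKI hJK x hxJ y hyK
    have hclosed : ∀ {x y}, x ∈ F.outer → (F.nb x).Nonempty → y ∈ F.outer →
        (F.nb y).Nonempty → (y = b ∨ G.Adj y b) → G.Adj x y → (x = b ∨ G.Adj x b) := by
      rintro x y hx hxe hy hye (rfl | hy1) hxy
      · exact .inr hxy
      obtain ⟨J, hJ, hxJ⟩ := exists_isTop hx hxe
      obtain ⟨K, hK, hyK⟩ := exists_isTop hy hye
      by_cases hJI : J = I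
      · subst hJI
        by_contra! hn
        by_cases hKI : K = J
        · subst hKI
          exact hn.2 (hI.transOn x hxJ y hyK b hb hxy hy1 hn.1)
        · exact hn.2 (hIJ hK hKI x (.inl hxJ) y (.inr hyK) b (.inl hb) hxy hy1 hn.1)
      · exact .inr (hxb hJ hJI hxJ)
    have hin : ∀ {x}, x ∈ F.outer → (F.nb x).Nonempty → ¬ (x = b ∨ G.Adj x b) →
        x ∈ F.under I := by
      intro x hx hxe hn
      obtain ⟨J, hJ, hxJ⟩ := exists_isTop hx hxe
      by_cases hJI : J = I
      · exact hJI ▸ hxJ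
      · exact absurd (.inr (hxb hJ hJI hxJ)) hn
    have htr : TransOn G {x | x ∈ F.outer ∧ (F.nb x).Nonempty} := by
      rintro x ⟨hx, hxe⟩ y ⟨hy, hye⟩ z ⟨hz, hze⟩ hxy hyz hxz
      by_cases hyb : y = b ∨ G.Adj y b
      · exact hcore hx hxe hz hze (hclosed hx hxe hy hye hyb hxy)
          (hclosed hz hze hy hye hyb hyz.symm) hxz
      · exact hI.transOn x (hin hx hxe fun h => hyb (hclosed hy hye hx hxe h hxy.symm)) y
          (hin hy hye hyb) z (hin hz hze fun h => hyb (hclosed hy hye hz hze h hyz)) hxy hyz hxz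
    have h1 := hasListColoring_inner (F := F) (fun x hx => hx.1) htr
      (hfull.mono fun x hx => hx.1)
    refine (h1.union (free_hasListColoring hf) (L₀ := F.list)
      (fun x _ => inner_subset_list x)
      (fun x _ => Set.singleton_subset_iff.2 (none_mem_list x)) ?_).mono ?_
      fun _ _ => subset_rfl
    · rintro x - y - -
      refine Set.disjoint_left.2 ?_
      rintro _ ⟨i, -, rfl⟩ h
      cases h
    · intro x hx
      by_cases h : (F.nb x).Nonempty
      · exact .inl ⟨hx, h⟩
      · exact .inr ⟨hx, not_nonempty_iff_eq_empty.1 h⟩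
  · push Not at hall
    have single : ∀ {J K x y z}, F.IsTop J → F.IsTop K → J ≠ I → K ≠ I → J ≠ K →
        x ∈ F.under J → y ∈ F.under K → ¬ G.Adj x y → z ∈ F.under J → z = x := by
      intro J K x y z hJ hK hJI hKI hJK hx hy hxy hz
      by_contra hzx
      have hadj := hcl hJ hJI hz hx hzx
      have hyz : G.Adj y z := (hs.adj_or_adj hJ hK hJK hz hx hadj hy).resolve_right
        fun h => hxy h.symm
      by_cases hc : (J ∪ K).card + 2 ≤ n
      · have ht : TransOn G (F.under J ∪ F.under K) := by
          refine transOn_of_subset (F := F) hc ?_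
          rintro x (hx | hx)
          · exact hx.2.2.trans subset_union_left
          · exact hx.2.2.trans subset_union_right
        refine hxy (ht y (.inr hy) z (.inl hz) x (.inl hx) hyz hadj ?_).symm
        rintro rfl
        obtain ⟨i, hi⟩ := hx.2.1
        exact hJK (hJ.eq_of_mem_under hs hK hx hi (hy.2.2 hi))
      · have e1 := hs J K hJ hK hJK
        have e2 := hs I J hI hJ hJI.symm
        have e3 := hs I K hI hK hKI.symm
        have c1 := card_union_of_disjoint e1.1
        have c3 := card_union_of_disjoint e3.1
        have c4 := card_le_univ (I ∪ (J ∪ K))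
        rw [card_union_of_disjoint (disjoint_union_right.2 ⟨e2.1, e3.1⟩),
          Fintype.card_fin] at c4
        have c5 := hfar K hK hKI
        have c6 := card_pos.2 hI.1
        have hJ2 : 2 ≤ J.card := by omega
        obtain ⟨w, hw, hwJ⟩ := hJ.2.1
        have hwu : w ∈ F.under J := ⟨hw, hwJ ▸ hJ.1, hwJ.le⟩
        have hnbJ : ∀ {v}, v ∈ F.under J → F.nb v = J := by
          intro v hv
          by_contra hne
          refine hJ.not_adj_under hw hwJ hv hne (hcl hJ hJI hwu hv ?_)
          rintro rfl
          exact hne hwJ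
        obtain ⟨s, hsJ⟩ := hJ.1
        exact F.gem z (F.k s) x b y
          (adj_of_mem_nb hz.1 (by rwa [hnbJ hz]) (by rwa [hnbJ hz]) (k_mem s)) hadj
          (hxb hJ hJI hz) hyz.symm
          (adj_of_mem_nb hx.1 (by rwa [hnbJ hx]) (by rwa [hnbJ hx]) (k_mem s)).symm
          (hxb hJ hJI hx) (hxb hK hKI hy).symm
          (not_adj_k' fun h => Finset.disjoint_left.1 e2.1 (hb.2.2 h) hsJ)
          (not_adj_k' fun h => Finset.disjoint_right.1 e1.1 (hy.2.2 h) hsJ) hxy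
    obtain ⟨J, K, hJ, hK, hJI, hKI, hJK, x, hx, y, hy, hxy⟩ := hall
    obtain ⟨d, hd⟩ := hJ.1
    obtain ⟨d', hd'⟩ := hK.1
    let R : Set V := {v | v ∈ F.outer ∧ d ∉ F.nb v ∧ d' ∉ F.nb v}
    have hR : HasListColoring G R F.inner := by
      refine hasListColoring_inner (fun _ h => h.1) (transOn_of_missing (d := d) (d' := d') ?_
        fun y hy => hy.2) (hfull.mono fun _ h => h.1)
      rintro rfl
      exact Finset.disjoint_left.1 (hs J K hJ hK hJK).1 hd hd'
    have hst : HasListColoring G {x, y} (fun _ => {(none : Option (Fin n))}) := by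
      refine Stable.hasListColoring ?_ (by simp)
      rintro a (rfl | rfl) c (rfl | rfl) h
      · exact h.ne rfl
      · exact hxy h
      · exact hxy h.symm
      · exact h.ne rfl
    refine (hst.union hR (L₀ := F.list) ?_ (fun y _ => inner_subset_list y) ?_).mono ?_
      fun _ _ => subset_rfl
    · rintro y - _ rfl
      exact none_mem_list y
    · rintro y - z - -
      refine Set.disjoint_left.2 ?_
      rintro _ rfl ⟨i, -, h⟩
      cases h
    · intro v hv
      rcases mem_free_or_exists_isTop hv with h | ⟨T, hT, hvT⟩
      · exact .inr ⟨hv, by simp [h.2], by simp [h.2]⟩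
      by_cases hTJ : T = J
      · subst hTJ
        exact .inl (.inl (single hT hK hJI hKI hJK hx hy hxy hvT))
      by_cases hTK : T = K
      · subst hTK
        exact .inl (.inr (single hT hJ hKI hJI hJK.symm hy hx (fun h => hxy h.symm) hvT))
      exact .inr ⟨hv, fun h => hTJ (hT.eq_of_mem_under hs hJ hvT h hd),
        fun h => hTK (hT.eq_of_mem_under hs hK hvT h hd')⟩

theorem Separated.hasListColoring_of_stable_others [Fintype V] (hs : F.Separated)
    (hf : Stable G F.free) {A : Finset (Fin n)} (hA : F.IsTop A)
    (hst : ∀ S, F.IsTop S → S ≠ A → Stable G (F.under S)) (g : Finset (Fin n) → Fin n)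
    (hg : ∀ S, F.IsTop S → S ≠ A → g S ∈ A)
    (hinj : ∀ S S', F.IsTop S → F.IsTop S' → S ≠ A → S' ≠ A → S ≠ S' → g S ≠ g S') :
    HasListColoring G F.outer F.list := by
  classical
  have h1 := hA.transOn_union.hasListColoring_of_card_le (A := insertNone Aᶜ) fun Q hQ hQc => by
    have := hA.card_clique_le_succ hf hQ hQc
    rw [card_insertNone, card_compl, Fintype.card_fin]
    omega
  have h2 := HasListColoring.iUnion (G := G) (J := {S // F.IsTop S ∧ S ≠ A})
    (X := fun S => F.under S) (L := fun S _ => {some (g S)})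
    (L₀ := fun x => F.list x ∩ ((A.map Function.Embedding.some : Finset _) : Set (Option (Fin n))))
    (fun S => (hst S S.2.1 S.2.2).hasListColoring fun _ _ => by simp) (by
      rintro ⟨S, hS, hne⟩ x hx _ rfl
      refine ⟨some_mem_list.2 fun h => hne (hS.eq_of_mem_under hs hA hx h (hg S hS hne)), ?_⟩
      simpa using hg S hS hne) (by
      rintro ⟨S, hS, hSA⟩ ⟨S', hS', hSA'⟩ hne x - y - -
      rw [Set.disjoint_singleton]
      exact fun e => hinj S S' hS hS' hSA hSA' (fun e => hne (Subtype.ext e))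
        (Option.some.inj e))
  refine (h2.union h1 (L₀ := F.list) (fun x _ => Set.inter_subset_left) ?_ ?_).mono ?_
    fun _ _ => subset_rfl
  · rintro x hx
    refine insertNone_subset_list (S := A) ?_ disjoint_compl_left
    rcases hx with h | h
    · exact h.2.2
    · simp [h.2]
  · rintro x - y - -
    exact (disjoint_map_insertNone disjoint_compl_right).mono_left Set.inter_subset_right
  · intro x hx
    rcases mem_free_or_exists_isTop hx with h | ⟨S, hS, hxS⟩
    · exact .inr (.inr h)
    · by_cases hSA : S = A
      · exact .inr (.inl (hSA ▸ hxS))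
      · exact .inl (Set.mem_iUnion.2 ⟨⟨S, hS, hSA⟩, hxS⟩)

theorem Separated.disjoint_under (hs : F.Separated) {A B : Finset (Fin n)} (hA : F.IsTop A)
    (hB : F.IsTop B) (hne : A ≠ B) {Q R : Finset V} (hQ : (Q : Set V) ⊆ F.under A)
    (hR : (R : Set V) ⊆ F.under B) : Disjoint Q R := by
  refine Finset.disjoint_left.2 fun x hx hx' => ?_
  obtain ⟨i, hi⟩ := (hQ hx).2.1
  exact hne (hA.eq_of_mem_under hs hB (hQ hx) hi ((hR hx').2.2 hi))

theorem Separated.card_le_two_of_not_adj (hs : F.Separated) {A B : Finset (Fin n)}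
    (hA : F.IsTop A) (hB : F.IsTop B) (hne : A ≠ B) (hB2 : 2 ≤ B.card) {u x y : V}
    (huB : Disjoint (F.nb u) B) {Q : Finset V} (hQ : (Q : Set V) ⊆ F.under B)
    (hc : G.IsClique Q) (hu : ∀ z ∈ Q, G.Adj u z) (hx : x ∈ F.under A) (hux : G.Adj u x)
    (hy : y ∈ Q) (hxy : ¬ G.Adj x y) : Q.card ≤ 2 := by
  by_contra! h3
  have hnb := (hB.clique_under hQ hc).resolve_right h3.not_ge
  obtain ⟨z, hz, hzy⟩ := exists_mem_ne (show 1 < Q.card by omega) y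
  have hyz := hc hy hz hzy.symm
  have hxz := (hs.adj_or_adj hB hA hne.symm (hQ hy) (hQ hz) hyz hx).resolve_left hxy
  obtain ⟨s, hsB⟩ := hB.1
  have hk : ∀ w ∈ Q, G.Adj w (F.k s) := fun w hw =>
    adj_of_mem_nb (hQ hw).1 (by rwa [hnb w hw]) (by rwa [hnb w hw]) (k_mem s)
  exact F.gem z (F.k s) y u x (hk z hz) hyz.symm (hu z hz).symm hxz.symm (hk y hy).symm
    (hu y hy).symm hux (not_adj_k' fun h => Finset.disjoint_left.1 huB h hsB)
    (not_adj_k' fun h => Finset.disjoint_left.1 (hs A B hA hB hne).1 (hx.2.2 h) hsB)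
    fun h => hxy h.symm

theorem isClique_of_adj {u : V} {X : Set V} (ht : TransOn G (insert u X)) {Q : Finset V}
    (hQ : (Q : Set V) ⊆ X) (hu : ∀ z ∈ Q, G.Adj u z) : G.IsClique Q := fun _ hx _ hy hxy =>
  ht _ (.inr (hQ hx)) u (.inl rfl) _ (.inr (hQ hy)) (hu _ hx).symm (hu _ hy) hxy

theorem transOn_insert_under {u : V} {k : Fin n} (huk : F.nb u ⊆ {k})
    {A : Finset (Fin n)} (hA : A.card + 3 ≤ n) : TransOn G (insert u (F.under A)) := by
  classical
  refine transOn_of_subset (F := F) (S := insert k A) ?_ ?_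
  · have := card_insert_le k A
    omega
  · rintro x (rfl | hx)
    · exact huk.trans (by simp)
    · exact hx.2.2.trans (subset_insert _ _)

theorem Separated.card_add_card_lt (hs : F.Separated) {A B : Finset (Fin n)} (hA : F.IsTop A)
    (hB : F.IsTop B) (hne : A ≠ B) (hA2 : 2 ≤ A.card) (hB2 : 2 ≤ B.card)
    (hAB : A.card + B.card + 1 = n) {k : Fin n} (hkA : k ∉ A) (hkB : k ∉ B) {u : V}
    (huk : F.nb u ⊆ {k}) {Q R : Finset V} (hQ : (Q : Set V) ⊆ F.under A)
    (hR : (R : Set V) ⊆ F.under B) (huQ : ∀ x ∈ Q, G.Adj u x) (huR : ∀ x ∈ R, G.Adj u x) :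
    Q.card + R.card + 1 ≤ n := by
  classical
  have h6 := F.six_le
  have hQc := isClique_of_adj (transOn_insert_under huk (by omega)) hQ huQ
  have hRc := isClique_of_adj (transOn_insert_under huk (by omega)) hR huR
  have hdA : Disjoint (F.nb u) A := (disjoint_singleton_left.2 hkA).mono_left huk
  have hdB : Disjoint (F.nb u) B := (disjoint_singleton_left.2 hkB).mono_left huk
  by_cases hall : ∀ x ∈ Q, ∀ y ∈ R, G.Adj x y
  · by_contra! hlt
    refine F.not_complete (Q := Q ∪ R) (c := u) ?_ ?_ ?_
    · intro x hx y hy hxy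
      simp only [coe_union, Set.mem_union, mem_coe] at hx hy
      rcases hx with hx | hx <;> rcases hy with hy | hy
      · exact hQc hx hy hxy
      · exact hall x hx y hy
      · exact (hall y hy x hx).symm
      · exact hRc hx hy hxy
    · rw [card_union_of_disjoint (hs.disjoint_under hA hB hne hQ hR)]
      omega
    · intro x hx
      rcases mem_union.1 hx with h | h
      · exact huQ x h
      · exact huR x h
  · push Not at hall
    obtain ⟨x, hx, y, hy, hxy⟩ := hall
    have h1 := hs.card_le_two_of_not_adj hA hB hne hB2 hdB hR hRc huR (hQ hx) (huQ x hx) hy hxy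
    have h2 := hs.card_le_two_of_not_adj hB hA hne.symm hA2 hdA hQ hQc huQ (hR hy) (huR y hy) hx
      fun h => hxy h.symm
    omega

theorem hasListColoring_of_two [Fintype V] (hs : F.Separated) (hf : Stable G F.free)
    {A B : Finset (Fin n)} (hA : F.IsTop A) (hB : F.IsTop B) (hne : A ≠ B)
    (hAB : A.card + B.card + 1 = n) {k : Fin n}
    (htop : ∀ S, F.IsTop S → S = A ∨ S = B ∨ S = {k})
    (hQA : ∀ Q : Finset V, (Q : Set V) ⊆ F.under A → G.IsClique Q → Q.card + A.card ≤ n)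
    (hQB : ∀ Q : Finset V, (Q : Set V) ⊆ F.under B → G.IsClique Q → Q.card + B.card ≤ n)
    (hC : Stable G (F.under {k}))
    (hdeg : ∀ u, F.nb u ⊆ {k} → u ∈ F.outer → ∀ Q R : Finset V, (Q : Set V) ⊆ F.under A →
      (R : Set V) ⊆ F.under B → (∀ x ∈ Q, G.Adj u x) → (∀ x ∈ R, G.Adj u x) →
      Q.card + R.card + 1 ≤ n ∨ (F.under {k} = ∅ ∧ Q.card + R.card ≤ n)) :
    HasListColoring G F.outer F.list := by
  classical
  have h6 := F.six_le
  let L : V → Finset (Option (Fin n)) := fun x => univ.filter (· ∈ F.list x)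
  have hL : ∀ x, (L x : Set (Option (Fin n))) = F.list x := fun x => by ext; simp [L]
  have hLk : ∀ u, F.nb u ⊆ {k} → n ≤ (L u).card := by
    intro u hu
    have : univ.erase (some k) ⊆ L u := by
      intro a ha
      refine mem_filter.2 ⟨mem_univ _, ?_⟩
      rintro i rfl hi
      rw [mem_singleton.1 (hu hi)] at ha
      simp at ha
    simpa using card_le_card this
  have h1 := hA.transOn.hasListColoring_of_card_le (A := (Aᶜ).map Function.Embedding.some)
    fun Q hQ hQc => by
      have := hQA Q hQ hQc
      rw [card_map, card_compl, Fintype.card_fin]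
      omega
  have h2 := hB.transOn.hasListColoring_of_card_le (A := insertNone A) fun Q hQ hQc => by
    have := hQB Q hQ hQc
    rw [card_insertNone]
    omega
  have hdAB := (hs A B hA hB hne).1
  have h3 : HasListColoring G (F.under A ∪ F.under B) 
      (fun x => (L x : Set (Option (Fin n)))) := by
    refine h1.union h2 (fun x hx => ?_) (fun x hx => ?_) fun x _ y _ _ =>
      disjoint_map_insertNone disjoint_compl_left
    · rw [hL]; exact map_some_subset_list hx.2.2 disjoint_compl_left
    · rw [hL]; exact insertNone_subset_list hx.2.2 hdAB
  have hsplit : ∀ u, (univ.filter fun x => x ∈ F.under A ∪ F.under B ∧ G.Adj u x) =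
      (univ.filter fun x => x ∈ F.under A ∧ G.Adj u x) ∪
      (univ.filter fun x => x ∈ F.under B ∧ G.Adj u x) := fun u => by
    ext x
    simp only [mem_filter, mem_univ, true_and, mem_union, Set.mem_union]
    tauto
  have hdeg' : ∀ u, F.nb u ⊆ {k} → u ∈ F.outer →
      (univ.filter fun x => x ∈ F.under A ∪ F.under B ∧ G.Adj u x).card + 1 ≤ n ∨
      F.under {k} = ∅ ∧
        (univ.filter fun x => x ∈ F.under A ∪ F.under B ∧ G.Adj u x).card ≤ n := by
    intro u hu huo
    rw [hsplit]
    have h := card_union_le (univ.filter fun x => x ∈ F.under A ∧ G.Adj u x)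
      (univ.filter fun x => x ∈ F.under B ∧ G.Adj u x)
    rcases hdeg u hu huo (univ.filter fun x => x ∈ F.under A ∧ G.Adj u x)
      (univ.filter fun x => x ∈ F.under B ∧ G.Adj u x) (by intro x; simp; tauto)
      (by intro x; simp; tauto) (by simp) (by simp) with h' | ⟨h', h''⟩
    · left; omega
    · exact .inr ⟨h', by omega⟩
  have h4 := h3.extend_stable hC fun u hu => by
    have := hLk u hu.2.2
    rcases hdeg' u hu.2.2 hu.1 with h | ⟨h, -⟩
    · omega
    · rw [h] at hu
      exact hu.elim
  have h5 := h4.extend_stable hf fun u hu => by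
    have hLu : (L u).card = n + 1 := by
      have : L u = univ := by
        ext a
        simp only [L, mem_filter, mem_univ, true_and, iff_true]
        intro i _
        rw [hu.2]
        simp
      simp [this]
    have ht : TransOn G (F.under {k} ∪ F.free) := by
      refine transOn_of_subset (F := F) (S := {k}) (by simp; omega) ?_
      rintro x (hx | hx)
      · exact hx.2.2
      · simp [hx.2]
    have hR : (univ.filter fun x => x ∈ F.under {k} ∧ G.Adj u x).card ≤ 1 := by
      refine card_le_one.2 fun x hx y hy => ?_
      simp only [mem_filter, mem_univ, true_and] at hx hy
      by_contra hxy
      exact hC x hx.1 y hy.1 (ht x (.inl hx.1) u (.inr hu) y (.inl hy.1) hx.2.symm hy.2 hxy)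
    have hsub : (univ.filter fun x => x ∈ F.under A ∪ F.under B ∪ F.under {k} ∧ G.Adj u x) ⊆
        (univ.filter fun x => x ∈ F.under A ∪ F.under B ∧ G.Adj u x) ∪
        (univ.filter fun x => x ∈ F.under {k} ∧ G.Adj u x) := by
      intro x
      simp only [mem_filter, mem_univ, true_and, mem_union, Set.mem_union]
      tauto
    have hle := (card_le_card hsub).trans (card_union_le _ _)
    rw [hLu]
    rcases hdeg' u (by simp [hu.2]) hu.1 with h | ⟨h, h'⟩
    · omega
    · have : (univ.filter fun x => x ∈ F.under {k} ∧ G.Adj u x) = ∅ := by simp [h]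
      rw [this, card_empty] at hle
      omega
  refine h5.mono ?_ fun x _ => (hL x).le
  intro x hx
  rcases mem_free_or_exists_isTop hx with h | ⟨S, hS, hxS⟩
  · exact .inr h
  · rcases htop S hS with rfl | rfl | rfl
    · exact .inl (.inl (.inl hxS))
    · exact .inl (.inl (.inr hxS))
    · exact .inl (.inr hxS)

theorem not_adj_of_near_complete {i : Fin n} {Q : Finset V} (hc : G.IsClique Q) {x y p z : V}
    (hy : y ∈ Q) (hxy : ¬ G.Adj x y) (hx : ∀ z ∈ Q, z ≠ y → G.Adj x z) (hix : i ∉ F.nb x)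
    (hp : p ∈ F.part i) (hm : ∃ w ∈ Q, ¬ G.Adj p w) (hpy : G.Adj p y) (hz : z ∈ Q)
    (hzy : z ≠ y) : ¬ G.Adj p z := by
  intro hpz
  obtain ⟨w, hw, hpw⟩ := hm
  have hwy : w ≠ y := by rintro rfl; exact hpw hpy
  have hwz : w ≠ z := by rintro rfl; exact hpw hpz
  exact F.gem z x w y p (hx z hz hzy).symm (hc hz hw hwz.symm) (hc hz hy hzy) hpz.symm
    (hx w hw hwy) (hc hw hy hwy) hpy.symm hxy (not_adj_of_notMem hix hp) fun h => hpw h.symm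

theorem false_of_near_complete {i : Fin n} {Q : Finset V} (hc : G.IsClique Q)
    (hnb : ∀ z ∈ Q, F.nb z = {i}) (h4 : 4 ≤ Q.card) {x x' y y' : V} (hy : y ∈ Q) (hy' : y' ∈ Q)
    (hyy : y ≠ y') (hxy : ¬ G.Adj x y) (hxy' : ¬ G.Adj x' y')
    (hx : ∀ z ∈ Q, z ≠ y → G.Adj x z) (hx' : ∀ z ∈ Q, z ≠ y' → G.Adj x' z)
    (hix : i ∉ F.nb x) (hix' : i ∉ F.nb x') (hm : ∀ p ∈ F.part i, ∃ w ∈ Q, ¬ G.Adj p w) :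
    False := by
  classical
  obtain ⟨p, hp, hpy⟩ := mem_nb.1 (show i ∈ F.nb y by simp [hnb y hy])
  obtain ⟨p', hp', hpy'⟩ := mem_nb.1 (show i ∈ F.nb y' by simp [hnb y' hy'])
  have h1 : ∀ z ∈ Q, z ≠ y → ¬ G.Adj p z := fun z hz hzy =>
    not_adj_of_near_complete hc hy hxy hx hix hp (hm p hp) hpy.symm hz hzy
  have h2 : ∀ z ∈ Q, z ≠ y' → ¬ G.Adj p' z := fun z hz hzy =>
    not_adj_of_near_complete hc hy' hxy' hx' hix' hp' (hm p' hp') hpy'.symm hz hzy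
  have hcard : 1 < ((Q.erase y).erase y').card := by
    have := pred_card_le_card_erase (s := Q) (a := y)
    have := pred_card_le_card_erase (s := Q.erase y) (a := y')
    omega
  obtain ⟨z, hz, z', hz', hzz⟩ := one_lt_card.1 hcard
  simp only [mem_erase] at hz hz'
  obtain ⟨j, hj⟩ := F.exists_notMem {i} (by simp)
  have hji : j ≠ i := by simpa using hj
  have hk : ∀ v ∈ Q, ¬ G.Adj v (F.k j) := fun v hv => not_adj_k (by rwa [hnb v hv])
  refine F.p2p3 z z' p (F.k j) p' (hc hz.2.2 hz'.2.2 hzz) (part_adj hji.symm hp (k_mem j))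
    (part_adj hji (k_mem j) hp') (part_stable hp hp') ?_ (fun h => h1 z hz.2.2 hz.2.1 h.symm)
    (hk z hz.2.2) (fun h => h2 z hz.2.2 hz.1 h.symm) (fun h => h1 z' hz'.2.2 hz'.2.1 h.symm)
    (hk z' hz'.2.2) (fun h => h2 z' hz'.2.2 hz'.1 h.symm)
  rintro rfl
  exact h2 y hy hyy hpy.symm

theorem nb_of_mem_under_singleton {i : Fin n} {x : V} (hx : x ∈ F.under {i}) : F.nb x = {i} :=
  (subset_singleton_iff.1 hx.2.2).resolve_left hx.2.1.ne_empty

theorem Separated.false_of_edge_of_near_complete (hs : F.Separated) {A : Finset (Fin n)}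
    {i : Fin n} (hA : F.IsTop A) (hB : F.IsTop {i}) (hne : A ≠ {i}) {Q : Finset V}
    (hQ : (Q : Set V) ⊆ F.under {i}) (hc : G.IsClique Q) (h4 : 4 ≤ Q.card) {x x' : V}
    (hx : x ∈ F.under A) (hx' : x' ∈ F.under A) (hxx : G.Adj x x')
    (h : ∃ y ∈ Q, ¬ G.Adj x y) (h' : ∃ y ∈ Q, ¬ G.Adj x' y)
    (hm : ∀ y ∈ Q, ¬ G.Adj x y → (∀ z ∈ Q, z ≠ y → G.Adj x z) →
      ∀ p ∈ F.part i, ∃ w ∈ Q, ¬ G.Adj p w) : False := by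
  obtain ⟨y, hy, hxy⟩ := h
  obtain ⟨y', hy', hxy'⟩ := h'
  have hi : ∀ {v}, v ∈ F.under A → i ∉ F.nb v := fun hv hi =>
    Finset.disjoint_left.1 (hs A _ hA hB hne).1 (hv.2.2 hi) (mem_singleton_self i)
  have hunique : ∀ {v w}, v ∈ F.under A → w ∈ Q → ¬ G.Adj v w → ∀ z ∈ Q, z ≠ w → G.Adj v z := by
    intro v w hv hw hvw z hz hzw
    by_contra hvz
    exact hzw (hs.eq_of_not_adj hB hA hne.symm hQ hc hv hz hw hvz hvw)
  refine false_of_near_complete hc (fun z hz => nb_of_mem_under_singleton (hQ hz)) h4 hy hy' ?_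
    hxy hxy' (hunique hx hy hxy) (hunique hx' hy' hxy') (hi hx) (hi hx')
    (hm y hy hxy (hunique hx hy hxy))
  rintro rfl
  rcases hs.adj_or_adj hA hB hne hx hx' hxx (hQ hy) with h | h
  · exact hxy h.symm
  · exact hxy' h.symm

theorem hasListColoring_of_singleton [Fintype V] (hs : F.Separated) (hf : Stable G F.free)
    {A : Finset (Fin n)} {i : Fin n} (hA : F.IsTop A) (hB : F.IsTop {i}) (hne : A ≠ {i})
    (hAn : A.card + 2 = n) (htop : ∀ S, F.IsTop S → S = A ∨ S = {i}) {x x' : V}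
    (hx : x ∈ F.under A) (hx' : x' ∈ F.under A) (hxx : G.Adj x x') :
    HasListColoring G F.outer F.list := by
  classical
  have h6 := F.six_le
  have hdis := (hs A _ hA hB hne).1
  obtain ⟨k, hk⟩ : ∃ k, k ∉ A ∪ {i} := by
    by_contra! h
    exact (hs A _ hA hB hne).2 (by ext; simpa using h _)
  simp only [mem_union, not_or] at hk
  have hC : F.under {k} = ∅ := by
    ext u
    simp only [Set.mem_empty_iff_false, iff_false]
    intro hu
    obtain ⟨S, hS, huS⟩ := exists_isTop hu.1 hu.2.1
    have hkS : k ∈ S := huS.2.2 (by simp [nb_of_mem_under_singleton hu])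
    rcases htop S hS with rfl | rfl
    · exact hk.1 hkS
    · exact hk.2 hkS
  have hQB : ∀ Q : Finset V, (Q : Set V) ⊆ F.under {i} → G.IsClique Q →
      Q.card + ({i} : Finset (Fin n)).card ≤ n := by
    intro Q hQ hc
    by_contra! hlt
    rw [card_singleton] at hlt
    have key : ∀ v, ∃ y ∈ Q, ¬ G.Adj v y := fun v => by
      by_contra! h
      exact F.not_complete hc (by omega) h
    exact hs.false_of_edge_of_near_complete hA hB hne hQ hc (by omega) hx hx' hxx (key x) (key x')
      fun _ _ _ _ p _ => key p
  refine hasListColoring_of_two hs hf hA hB hne (by rw [card_singleton]; omega) (k := k)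
    (fun S hS => by rcases htop S hS with h | h <;> simp [h])
    (fun Q hQ hc => hA.card_clique_le (by omega) hQ hc) hQB (by rw [hC]; exact fun _ h => h.elim)
    fun t htk ht Q R hQ hR htQ htR => .inr ⟨hC, ?_⟩
  have htf : t ∈ F.free := by
    refine ⟨ht, ?_⟩
    by_contra h
    have : t ∈ F.under {k} := ⟨ht, nonempty_iff_ne_empty.2 h, htk⟩
    rw [hC] at this
    exact this
  have hcl : ∀ {S}, F.IsTop S → TransOn G (insert t (F.under S)) := fun {S} hS =>
    hS.transOn_union.mono (Set.insert_subset (.inr htf) Set.subset_union_left)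
  have hQc := isClique_of_adj (hcl hA) hQ htQ
  have hRc := isClique_of_adj (hcl hB) hR htR
  by_contra! hlt
  have h1 := hA.card_clique_le (by omega) hQ hQc
  have h2 := hQB R hR hRc
  rw [card_singleton] at h2
  obtain ⟨v, hv, v', hv', hvv⟩ := one_lt_card.1 (show 1 < Q.card by omega)
  have htR' : t ∉ R := fun h => (htR t h).ne rfl
  have key : ∀ v ∈ Q, ∃ y ∈ R, ¬ G.Adj v y := by
    intro v hv
    by_contra! h
    refine F.not_complete (Q := insert t R) (c := v) ?_ ?_ ?_
    · rw [coe_insert]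
      exact hRc.insert fun z hz _ => htR z hz
    · rw [card_insert_of_notMem htR']
      omega
    · intro z hz
      rcases mem_insert.1 hz with rfl | hz
      · exact (htQ v hv).symm
      · exact h z hz
  refine hs.false_of_edge_of_near_complete hA hB hne hR hRc (by omega) (hQ hv) (hQ hv')
    (hQc hv hv' hvv) (key v hv) (key v' hv') fun y hy hvy hun p hp => ?_
  by_contra! h
  obtain ⟨z, hz, hzy⟩ := exists_mem_ne (show 1 < R.card by omega) y
  have hiv : i ∉ F.nb v := fun h =>
    Finset.disjoint_left.1 hdis ((hQ hv).2.2 h) (mem_singleton_self i)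
  exact F.gem z p y t v (h z hz).symm (hRc hz hy hzy) (htR z hz).symm (hun z hz hzy).symm
    (h y hy) (htR y hy).symm (htQ v hv)
    (fun e => not_adj_of_notMem (by simp [htf.2]) hp e.symm)
    (fun e => not_adj_of_notMem hiv hp e.symm) fun e => hvy e.symm

theorem Separated.false_of_singletons_of_full (hs : F.Separated) {X : Set V} (hX : X ⊆ F.outer)
    (ht : TransOn G X) {i j : Fin n} (hi : F.IsTop {i}) (hj : F.IsTop {j}) (hij : i ≠ j)
    (hjX : F.under {j} ⊆ X) {Q : Finset V} (hQ : (Q : Set V) ⊆ X) (hc : G.IsClique Q)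
    (hn : Q.card = n) (hnb : ∀ x ∈ Q, F.nb x = {i}) : False := by
  have h6 := F.six_le
  obtain ⟨w, hw, hwj⟩ := hj.2.1
  have hwu : w ∈ F.under {j} := ⟨hw, by simp [hwj], hwj.le⟩
  have hQi : ∀ y ∈ Q, y ∈ F.under {i} := fun y hy =>
    ⟨hX (hQ hy), by simp [hnb y hy], (hnb y hy).le⟩
  refine F.not_complete hc hn.ge (c := w) fun y hy => ?_
  obtain ⟨z, hz, hzy⟩ := exists_mem_ne (show 1 < Q.card by omega) y
  rcases hs.adj_or_adj hi hj (by simpa using hij) (hQi y hy) (hQi z hz) (hc hy hz hzy.symm) hwu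
    with h | h
  · exact h
  · refine ht w (hjX hwu) z (hQ hz) y (hQ hy) h (hc hz hy hzy) ?_
    rintro rfl
    rw [hnb w hy, singleton_inj] at hwj
    exact hij hwj

theorem IsTop.false_of_edge {A : Finset (Fin n)}
    (hA : F.IsTop A) (hA2 : 2 ≤ A.card) {x x' y z w : V} (hx : x ∈ F.under A)
    (hx' : x' ∈ F.under A) (hxx : G.Adj x x') (hy : Disjoint (F.nb y) A)
    (hz : Disjoint (F.nb z) A) (hzy : G.Adj z y) (hzx : G.Adj z x) (hzx' : G.Adj z x')
    (hyx : G.Adj y x) (hyx' : ¬ G.Adj y x') (hwo : w ∈ F.outer) (hw : F.nb w = A)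
    (hwyz : F.nb x ≠ A → G.Adj w y ∧ G.Adj w z) : False := by
  by_cases hxA : F.nb x = A
  · have hxA' : F.nb x' = A := by
      by_contra h
      exact hA.not_adj_under hx.1 hxA hx' h hxx
    obtain ⟨s, hsA⟩ := hA.1
    exact F.gem x (F.k s) x' z y
      (adj_of_mem_nb hx.1 (by rwa [hxA]) (by rwa [hxA]) (k_mem s)) hxx hzx.symm hyx.symm
      (adj_of_mem_nb hx'.1 (by rwa [hxA']) (by rwa [hxA']) (k_mem s)).symm hzx'.symm hzy
      (not_adj_k' fun h => Finset.disjoint_left.1 hz h hsA)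
      (not_adj_k' fun h => Finset.disjoint_left.1 hy h hsA) fun h => hyx' h.symm
  · obtain ⟨hwy, hwz⟩ := hwyz hxA
    have hxA' := (hA.nb_of_edge hx hx' hxx hxA).1
    exact F.gem z w y x x' hwz.symm hzy hzx hzx' hwy hyx hxx
      (hA.not_adj_under hwo hw hx hxA) (hA.not_adj_under hwo hw hx' hxA') hyx'

theorem Separated.card_clique_union_lt (hs : F.Separated) {A : Finset (Fin n)} {i k : Fin n}
    (hA : F.IsTop A) (hi : F.IsTop {i}) (hk : F.IsTop {k}) (hiA : i ∉ A) (hkA : k ∉ A)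
    (hik : i ≠ k) (hAn : A.card + 2 = n) {x x' : V}
    (hx : x ∈ F.under A) (hx' : x' ∈ F.under A) (hxx : G.Adj x x') {Q R : Finset V}
    (hQ : (Q : Set V) ⊆ F.under {i} ∪ F.under {k}) (hc : G.IsClique Q) (hRQ : R ⊆ Q)
    (hR : (R : Set V) ⊆ F.under {i}) (h3 : 3 ≤ R.card) : Q.card + 1 < n := by
  classical
  have h6 := F.six_le
  have hiA' : ({i} : Finset (Fin n)) ≠ A := by rintro rfl; simp at hiA
  have hkA' : ({k} : Finset (Fin n)) ≠ A := by rintro rfl; simp at hkA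
  have hQA : ∀ y ∈ Q, Disjoint (F.nb y) A := by
    intro y hy
    rcases hQ hy with h | h
    · exact (hs _ _ hi hA hiA').1.mono_left h.2.2
    · exact (hs _ _ hk hA hkA').1.mono_left h.2.2
  have hedge : ∀ y ∈ Q, G.Adj y x ∨ G.Adj y x' := by
    intro y hy
    rcases hQ hy with h | h
    · exact hs.adj_or_adj hA hi hiA'.symm hx hx' hxx h
    · exact hs.adj_or_adj hA hk hkA'.symm hx hx' hxx h
  obtain ⟨z, hz, hzx, hzx'⟩ : ∃ z ∈ R, G.Adj z x ∧ G.Adj z x' := by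
    by_contra! h
    have hmiss : ∀ v ∈ F.under A, (R.filter fun z => ¬ G.Adj z v).card ≤ 1 := by
      intro v hv
      refine card_le_one.2 fun a ha b hb => ?_
      simp only [mem_filter] at ha hb
      exact hs.eq_of_not_adj hi hA hiA' hR (hc.subset (coe_subset.2 hRQ)) hv ha.1 hb.1
        (fun h => ha.2 h.symm) fun h => hb.2 h.symm
    have hcov : R ⊆ (R.filter fun z => ¬ G.Adj z x) ∪ R.filter fun z => ¬ G.Adj z x' := by
      intro z hz
      simp only [mem_union, mem_filter, hz, true_and]
      by_cases hzx : G.Adj z x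
      · exact .inr (h z hz hzx)
      · exact .inl hzx
    have := (card_le_card hcov).trans (card_union_le _ _)
    have := hmiss x hx
    have := hmiss x' hx'
    omega
  obtain ⟨w, hwo, hw⟩ := hA.2.1
  have hwv : ∀ v ∈ F.under A, F.nb v ≠ A → ∀ y ∈ Q, G.Adj y v → G.Adj w y := by
    intro v hv hvA y hy hyv
    obtain ⟨a, ha, hav⟩ := not_subset.1 fun h => hvA (subset_antisymm hv.2.2 h)
    have hay : a ∉ F.nb y := fun h => Finset.disjoint_left.1 (hQA y hy) h ha
    obtain ⟨b, hbA, hby⟩ : ∃ b, b ∉ A ∧ b ∉ F.nb y := by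
      rcases hQ hy with h | h
      · exact ⟨k, hkA, by simpa [nb_of_mem_under_singleton h] using hik.symm⟩
      · exact ⟨i, hiA, by simpa [nb_of_mem_under_singleton h] using hik⟩
    exact (F.adj_or_adj hwo hyv.symm (by rwa [hw]) hav hay (by rwa [hw])
      (fun h => hbA (hv.2.2 h)) hby).resolve_left (hA.not_adj_under hwo hw hv hvA)
  have hwQ : F.nb x ≠ A → ∀ y ∈ Q, G.Adj w y := by
    intro hxA y hy
    rcases hedge y hy with h | h
    · exact hwv x hx hxA y hy h
    · exact hwv x' hx' (hA.nb_of_edge hx hx' hxx hxA).1 y hy h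
  have hwQ' : F.nb x' ≠ A → ∀ y ∈ Q, G.Adj w y := fun hxA =>
    hwQ (hA.nb_of_edge hx' hx hxx.symm hxA).1
  have hzQ := hRQ hz
  have hadj : ∀ y ∈ Q, G.Adj y x ∧ G.Adj y x' := by
    intro y hy
    by_contra h
    have hzy : G.Adj z y := hc hzQ hy fun e => h (e ▸ ⟨hzx, hzx'⟩)
    by_cases hyx : G.Adj y x
    · exact hA.false_of_edge (by omega) hx hx' hxx (hQA y hy) (hQA z hzQ) hzy
        hzx hzx' hyx (fun h' => h ⟨hyx, h'⟩) hwo hw fun hne => ⟨hwQ hne y hy, hwQ hne z hzQ⟩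
    · exact hA.false_of_edge (by omega) hx' hx hxx.symm (hQA y hy) (hQA z hzQ)
        hzy hzx' hzx ((hedge y hy).resolve_left hyx) hyx hwo hw
        fun hne => ⟨hwQ' hne y hy, hwQ' hne z hzQ⟩
  by_contra! hlt
  have hxQ : x ∉ Q := fun h => (hadj x h).1.ne rfl
  refine F.not_complete (Q := insert x Q) (c := x') ?_ ?_ ?_
  · rw [coe_insert]
    exact hc.insert fun y hy _ => (hadj y hy).1.symm
  · rw [card_insert_of_notMem hxQ]
    omega
  · intro y hy
    rcases mem_insert.1 hy with rfl | hy
    · exact hxx.symm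
    · exact (hadj y hy).2.symm

theorem hasListColoring_of_two_singletons [Fintype V] (hs : F.Separated) (hf : Stable G F.free)
    {A : Finset (Fin n)} {i k : Fin n} (hA : F.IsTop A) (hi : F.IsTop {i}) (hk : F.IsTop {k})
    (hiA : i ∉ A) (hkA : k ∉ A) (hik : i ≠ k) (hAn : A.card + 2 = n)
    (htop : ∀ S, F.IsTop S → S = A ∨ S = {i} ∨ S = {k}) :
    HasListColoring G F.outer F.list := by
  classical
  have h6 := F.six_le
  have hsub : ∀ {x}, x ∈ F.under {i} ∪ F.under {k} → F.nb x ⊆ {i, k} := by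
    rintro x (h | h)
    · exact h.2.2.trans (by simp)
    · exact h.2.2.trans (by simp)
  have hpair : ({i, k} : Finset (Fin n)).card = 2 := card_pair hik
  have hX : F.under {i} ∪ F.under {k} ∪ F.free ⊆ F.outer := by
    rintro x ((h | h) | h) <;> exact h.1
  have ht : TransOn G (F.under {i} ∪ F.under {k} ∪ F.free) := by
    refine transOn_of_subset (F := F) (S := {i, k}) (by omega) ?_
    rintro x (h | h)
    · exact hsub h
    · simp [h.2]
  have hcov : ∀ x ∈ F.outer, x ∈ F.under A ∪ (F.under {i} ∪ F.under {k} ∪ F.free) := by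
    intro x hx
    rcases mem_free_or_exists_isTop hx with h | ⟨S, hS, hxS⟩
    · exact .inr (.inr h)
    · rcases htop S hS with rfl | rfl | rfl
      · exact .inl hxS
      · exact .inr (.inl (.inl hxS))
      · exact .inr (.inl (.inr hxS))
  by_cases hst : Stable G (F.under A)
  · have hfull : F.NoFull (F.under {i} ∪ F.under {k} ∪ F.free) := by
      intro Q hQ hc hn j
      by_contra! hnb
      obtain ⟨q, hq⟩ := card_pos.1 (show 0 < Q.card by omega)
      rcases hQ hq with (h | h) | h
      · refine hs.false_of_singletons_of_full hX ht hi hk hik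
          (fun x hx => .inl (.inr hx)) hQ hc hn fun x hx => ?_
        rw [hnb x hx, ← hnb q hq, nb_of_mem_under_singleton h]
      · refine hs.false_of_singletons_of_full hX ht hk hi hik.symm
          (fun x hx => .inl (.inl hx)) hQ hc hn fun x hx => ?_
        rw [hnb x hx, ← hnb q hq, nb_of_mem_under_singleton h]
      · have := hnb q hq
        rw [h.2] at this
        exact singleton_ne_empty _ this.symm
    have h1 := hasListColoring_inner hX ht hfull
    have h2 : HasListColoring G (F.under A) (fun _ => {(none : Option (Fin n))}) :=
      hst.hasListColoring (by simp)
    refine (h2.union h1 (L₀ := F.list) (fun x _ => Set.singleton_subset_iff.2 (none_mem_list x))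
      (fun x _ => inner_subset_list x) ?_).mono hcov fun _ _ => subset_rfl
    rintro x - y - -
    refine Set.disjoint_left.2 ?_
    rintro _ rfl ⟨i, -, h⟩
    cases h
  · have hst : ∃ x ∈ F.under A, ∃ x' ∈ F.under A, G.Adj x x' := by
      by_contra! h
      exact hst h
    obtain ⟨x, hx, x', hx', hxx⟩ := hst
    have hdis : Disjoint A {i, k} := by simp [hiA, hkA]
    have h1 := hA.transOn.hasListColoring_of_card_le
      (A := ({i, k} : Finset (Fin n)).map Function.Embedding.some) fun Q hQ hc => by
        have := hA.card_clique_le (by omega) hQ hc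
        rw [card_map, hpair]
        omega
    have h2 := (ht.mono Set.subset_union_left).hasListColoring_of_card_le
      (A := A.map Function.Embedding.some) fun Q hQ hc => by
        rw [card_map]
        by_contra! hlt
        have hsplit : Q = (Q.filter (· ∈ F.under {i})) ∪ Q.filter (· ∈ F.under {k}) := by
          ext v
          simp only [mem_union, mem_filter]
          exact ⟨fun h => (hQ h).imp (⟨h, ·⟩) (⟨h, ·⟩), fun h => h.elim (·.1) (·.1)⟩
        have hle := card_union_le (Q.filter (· ∈ F.under {i})) (Q.filter (· ∈ F.under {k}))
        rw [← hsplit] at hle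
        rcases le_or_gt 3 (Q.filter (· ∈ F.under {i})).card with h | h
        · have := hs.card_clique_union_lt hA hi hk hiA hkA hik hAn hx hx' hxx hQ hc
            (filter_subset _ _) (by intro v; simp) h
          omega
        · have := hs.card_clique_union_lt hA hk hi hkA hiA hik.symm hAn hx hx' hxx
            (by rwa [Set.union_comm]) hc (filter_subset (· ∈ F.under {k}) Q) (by intro v; simp)
            (by omega)
          omega
    have h3 := h2.union (free_hasListColoring hf) (L₀ := fun x => F.list x ∩
        ((insertNone A : Finset _) : Set (Option (Fin n))))
      (fun x hx => Set.subset_inter (map_some_subset_list (hsub hx) hdis) (by intro a; simp; aesop))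
      (fun x _ => Set.singleton_subset_iff.2 ⟨none_mem_list x, by simp⟩)
      fun _ _ _ _ _ => disjoint_map_none
    exact (h1.union h3 (L₀ := F.list) (fun x hx => map_some_subset_list hx.2.2 hdis.symm)
      (fun _ _ => Set.inter_subset_left) fun _ _ _ _ _ =>
        (disjoint_map_insertNone hdis.symm).mono_right Set.inter_subset_right).mono hcov
      fun _ _ => subset_rfl

theorem Separated.exists_near_top [Fintype V] (hs : F.Separated) (hf : Stable G F.free)
    (hno : ¬ HasListColoring G F.outer F.list) {A : Finset (Fin n)} (hA : F.IsTop A)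
    (hst : ¬ Stable G (F.under A)) :
    ∃ B, F.IsTop B ∧ B ≠ A ∧ A.card + B.card + 1 = n ∧ ∃ k, k ∉ A ∧ k ∉ B ∧
      ∀ S, F.IsTop S → S = A ∨ S = B ∨ S = {k} := by
  classical
  obtain ⟨x, hx, x', hx', hxx⟩ : ∃ x ∈ F.under A, ∃ x' ∈ F.under A, G.Adj x x' := by
    by_contra! h
    exact hst h
  have hex : ∃ J, F.IsTop J ∧ J ≠ A := by
    by_contra! h
    exact hno (hasListColoring_of_cover hf fun S S' hS hS' hne =>
      absurd ((h S hS).trans (h S' hS').symm) hne)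
  obtain ⟨B, hB, hBA, hlt⟩ : ∃ B, F.IsTop B ∧ B ≠ A ∧ n < (A ∪ B).card + 2 := by
    by_contra! h
    obtain ⟨J, hJ, hJA⟩ := hex
    obtain ⟨w, hw, hwJ⟩ := hJ.2.1
    exact hno (hasListColoring_of_far_edge hs hf hA hx hx' hxx h
      ⟨J, hJ, hJA, w, hw, hwJ ▸ hJ.1, hwJ.le⟩)
  obtain ⟨hdis, hne⟩ := hs A B hA hB hBA.symm
  have hlt' : (A ∪ B).card < n := by
    simpa using card_lt_univ_of_notMem (s := A ∪ B) (x := _)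
      (not_forall.1 fun h => hne (eq_univ_iff_forall.2 h)).choose_spec
  have hcompl : (A ∪ B)ᶜ.card = 1 := by
    rw [card_compl, Fintype.card_fin]
    omega
  obtain ⟨k, hk⟩ := card_eq_one.1 hcompl
  have hkm : k ∉ A ∪ B := mem_compl.1 (hk ▸ mem_singleton_self k)
  rw [mem_union, not_or] at hkm
  rw [card_union_of_disjoint hdis] at hlt hlt'
  refine ⟨B, hB, hBA, by omega, k, hkm.1, hkm.2, fun S hS => ?_⟩
  by_contra! h
  have h1 := (hs S A hS hA h.1).1
  have h2 := (hs S B hS hB h.2.1).1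
  have : S ⊆ {k} := by
    rw [← hk]
    exact subset_compl_iff_disjoint_right.2 (disjoint_union_right.2 ⟨h1, h2⟩)
  exact h.2.2 ((subset_singleton_iff.1 this).resolve_left hS.1.ne_empty)

theorem Separated.hasListColoring [Fintype V] (hs : F.Separated) (hf : Stable G F.free) :
    HasListColoring G F.outer F.list := by
  classical
  have h6 := F.six_le
  by_contra hno
  obtain ⟨A, hA, hAst⟩ : ∃ A, F.IsTop A ∧ ¬ Stable G (F.under A) := by
    by_contra! h
    exact hno (hs.hasListColoring_of_stable hf h)
  obtain ⟨B, hB, hBA, hAB, k, hkA, hkB, htop⟩ := hs.exists_near_top hf hno hA hAst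
  have hdis := (hs A B hA hB hBA.symm).1
  have hAst' : ∃ x ∈ F.under A, ∃ x' ∈ F.under A, G.Adj x x' := by
    by_contra! h
    exact hAst h
  have hApos := hA.1.card_pos
  have hBpos := hB.1.card_pos
  have hbig : ∀ hA2 : 2 ≤ A.card, ∀ hB2 : 2 ≤ B.card, Stable G (F.under {k}) → False :=
    fun hA2 hB2 hC => hno (hasListColoring_of_two hs hf hA hB hBA.symm hAB htop
      (fun Q hQ hc => hA.card_clique_le hA2 hQ hc) (fun Q hQ hc => hB.card_clique_le hB2 hQ hc) hC
      fun u hu _ Q R hQ hR huQ huR => .inl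
        (hs.card_add_card_lt hA hB hBA.symm hA2 hB2 hAB hkA hkB hu hQ hR huQ huR))
  by_cases hk : F.IsTop {k}
  · by_cases hA1 : A.card = 1
    · obtain ⟨i, rfl⟩ := card_eq_one.1 hA1
      refine hno (hasListColoring_of_two_singletons hs hf hB hA hk
        (Finset.disjoint_singleton_left.1 hdis) hkB ?_ (by omega) fun S hS => ?_)
      · rintro rfl; simp at hkA
      · rcases htop S hS with h | h | h <;> simp [h]
    by_cases hB1 : B.card = 1
    · obtain ⟨i, rfl⟩ := card_eq_one.1 hB1
      refine hno (hasListColoring_of_two_singletons hs hf hA hB hk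
        (Finset.disjoint_singleton_right.1 hdis) hkA ?_ (by omega) htop)
      rintro rfl; simp at hkB
    have hC : Stable G (F.under {k}) := by
      by_contra hC
      obtain ⟨J, hJ, hJk, hcard, -⟩ := hs.exists_near_top hf hno hk hC
      rw [card_singleton] at hcard
      rcases htop J hJ with rfl | rfl | rfl
      · omega
      · omega
      · exact hJk rfl
    by_cases hBst : Stable G (F.under B)
    · obtain ⟨a, ha, a', ha', haa⟩ := one_lt_card.1 (show 1 < A.card by omega)
      refine hno (hs.hasListColoring_of_stable_others hf hA ?_ (fun S => if S = B then a else a')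
        ?_ ?_)
      · intro S hS hSA
        rcases htop S hS with rfl | rfl | rfl
        · exact absurd rfl hSA
        · exact hBst
        · exact hC
      · intro S _ _
        split_ifs
        · exact ha
        · exact ha'
      · intro S S' hS hS' hSA hSA' hne
        rcases htop S hS with rfl | rfl | rfl <;> rcases htop S' hS' with rfl | rfl | rfl <;>
          simp_all [eq_comm]
    · exact hbig (by omega) (by omega) hC
  · have htop' : ∀ S, F.IsTop S → S = A ∨ S = B := by
      intro S hS
      rcases htop S hS with h | h | rfl
      · exact .inl h
      · exact .inr h
      · exact absurd hS hk
    by_cases hBst : Stable G (F.under B)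
    · obtain ⟨a, ha⟩ := hA.1
      refine hno (hs.hasListColoring_of_stable_others hf hA ?_ (fun _ => a) (fun _ _ _ => ha) ?_)
      · intro S hS hSA
        exact (htop' S hS).resolve_left hSA ▸ hBst
      · intro S S' hS hS' hSA hSA' hne
        exact absurd (((htop' S hS).resolve_left hSA).trans
          ((htop' S' hS').resolve_left hSA').symm) hne
    have hBst' : ∃ x ∈ F.under B, ∃ x' ∈ F.under B, G.Adj x x' := by
      by_contra! h
      exact hBst h
    by_cases hA1 : A.card = 1
    · obtain ⟨i, rfl⟩ := card_eq_one.1 hA1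
      obtain ⟨x, hx, x', hx', hxx⟩ := hBst'
      exact hno (hasListColoring_of_singleton hs hf hB hA hBA (by omega)
        (fun S hS => (htop' S hS).symm) hx hx' hxx)
    by_cases hB1 : B.card = 1
    · obtain ⟨i, rfl⟩ := card_eq_one.1 hB1
      obtain ⟨x, hx, x', hx', hxx⟩ := hAst'
      exact hno (hasListColoring_of_singleton hs hf hA hB hBA.symm (by omega) htop' hx hx' hxx)
    refine hbig (by omega) (by omega) fun u hu _ _ _ => ?_
    obtain ⟨S, hS, huS⟩ := exists_isTop hu.1 hu.2.1
    have hkS : k ∈ S := huS.2.2 (by simp [nb_of_mem_under_singleton hu])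
    rcases htop' S hS with rfl | rfl
    · exact hkA hkS
    · exact hkB hkS

theorem inClassC_or_colorable [Fintype V] (F : CliqueFrame G n) :
    InClassC G ∨ G.Colorable (n + 1) := by
  by_cases hf : Stable G F.free
  · right
    refine colorable (F := F) ?_
    rcases F.cover_or_separated with h | h
    · exact hasListColoring_of_cover hf h
    · exact h.hasListColoring hf
  · have : ∃ c ∈ F.free, ∃ c' ∈ F.free, G.Adj c c' := by
      by_contra! h
      exact hf h
    obtain ⟨c, hc, c', hc', hcc⟩ := this
    exact (inClassC_or_hasListColoring_of_free_edge hc hc' hcc).imp_right colorable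

end CliqueFrame

section Frame

variable {V : Type*} {G : SimpleGraph V}

theorem false_of_gem (h : IsFreeOf G graphGem) (c a b d e : V) (hca : G.Adj c a)
    (hcb : G.Adj c b) (hcd : G.Adj c d) (hce : G.Adj c e) (hab : G.Adj a b) (hbd : G.Adj b d)
    (hde : G.Adj d e) (had : ¬ G.Adj a d) (hae : ¬ G.Adj a e) (hbe : ¬ G.Adj b e) : False := by
  have hda : ¬ G.Adj d a := fun h => had h.symm
  have hea : ¬ G.Adj e a := fun h => hae h.symm
  have heb : ¬ G.Adj e b := fun h => hbe h.symm
  have hadj : ∀ i j, G.Adj (![a, b, d, e, c] i) (![a, b, d, e, c] j) ↔ graphGem.Adj i j := by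
    intro i j
    fin_cases i <;> fin_cases j <;>
      simp [graphGem, hca, hcb, hcd, hce, hab, hbd, hde, had, hae, hbe, hda, hea, heb, hca.symm,
        hcb.symm, hcd.symm, hce.symm, hab.symm, hbd.symm, hde.symm]
  have hinj : Function.Injective ![a, b, d, e, c] := by
    have n1 : a ≠ d := by rintro rfl; exact hae hde
    have n2 : a ≠ e := by rintro rfl; exact had hde.symm
    have n3 : b ≠ e := by rintro rfl; exact hae hab
    intro i j hij
    fin_cases i <;> fin_cases j <;>
      simp_all [hca.ne, hcb.ne, hcd.ne, hce.ne, hab.ne, hbd.ne, hde.ne, hca.ne', hcb.ne',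
        hcd.ne', hce.ne', hab.ne', hbd.ne', hde.ne']
  exact h.false ⟨⟨_, hinj⟩, hadj _ _⟩

theorem false_of_p2p3 (h : IsFreeOf G graphP2P3) (a b x y z : V) (hab : G.Adj a b)
    (hxy : G.Adj x y) (hyz : G.Adj y z) (hxz : ¬ G.Adj x z) (hne : x ≠ z) (hax : ¬ G.Adj a x)
    (hay : ¬ G.Adj a y) (haz : ¬ G.Adj a z) (hbx : ¬ G.Adj b x) (hby : ¬ G.Adj b y)
    (hbz : ¬ G.Adj b z) : False := by
  have hzx : ¬ G.Adj z x := fun h => hxz h.symm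
  have hxa : ¬ G.Adj x a := fun h => hax h.symm
  have hya : ¬ G.Adj y a := fun h => hay h.symm
  have hza : ¬ G.Adj z a := fun h => haz h.symm
  have hxb : ¬ G.Adj x b := fun h => hbx h.symm
  have hyb : ¬ G.Adj y b := fun h => hby h.symm
  have hzb : ¬ G.Adj z b := fun h => hbz h.symm
  have hadj : ∀ i j, G.Adj (![a, b, x, y, z] i) (![a, b, x, y, z] j) ↔ graphP2P3.Adj i j := by
    intro i j
    fin_cases i <;> fin_cases j <;>
      simp [graphP2P3, hab, hxy, hyz, hxz, hax, hay, haz, hbx, hby, hbz, hzx, hxa, hya, hza, hxb,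
        hyb, hzb, hab.symm, hxy.symm, hyz.symm]
  have hinj : Function.Injective ![a, b, x, y, z] := by
    have n1 : a ≠ x := by rintro rfl; exact hay hxy
    have n2 : a ≠ y := by rintro rfl; exact haz hyz
    have n3 : a ≠ z := by rintro rfl; exact hay hyz.symm
    have n4 : b ≠ x := by rintro rfl; exact hby hxy
    have n5 : b ≠ y := by rintro rfl; exact hbz hyz
    have n6 : b ≠ z := by rintro rfl; exact hby hyz.symm
    intro i j hij
    fin_cases i <;> fin_cases j <;>
      simp_all [hab.ne, hxy.ne, hyz.ne, hab.ne', hxy.ne', hyz.ne', Ne.symm]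
  exact h.false ⟨⟨_, hinj⟩, hadj _ _⟩

theorem nonempty_cliqueFrame [Fintype V] (h1 : IsFreeOf G graphP2P3) (h2 : IsFreeOf G graphGem)
    (hw : 6 ≤ G.cliqueNum) : Nonempty (CliqueFrame G G.cliqueNum) := by
  obtain ⟨s, hs⟩ := G.exists_isNClique_cliqueNum
  let e := s.equivFinOfCardEq hs.card_eq
  exact ⟨{
    k := fun i => e.symm i
    adj_k := fun hij => hs.isClique (e.symm _).2 (e.symm _).2 fun h =>
      hij (e.symm.injective (Subtype.ext h))
    six_le := hw
    card_le := fun Q hQ => hQ.card_le_cliqueNum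
    gem := false_of_gem h2
    p2p3 := false_of_p2p3 h1 }⟩

end Frame

end P2P3Gem

/-- A (P2+P3, gem)-free graph `G` with `ω(G) ≥ 6` and `χ(G) = ⌈(5ω(G) − 1)/4⌉`
belongs to the class `𝒞`. -/
theorem inClassC_of_chi_eq_ceil {V : Type*} [Fintype V] (G : SimpleGraph V)
    (h1 : IsFreeOf G graphP2P3) (h2 : IsFreeOf G graphGem)
    (hw : 6 ≤ G.cliqueNum)
    (hchi : G.chromaticNumber = ((⌈(5 * (G.cliqueNum : ℚ) - 1) / 4⌉₊ : ℕ) : ℕ∞)) :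
    InClassC G := by
  obtain ⟨F⟩ := P2P3Gem.nonempty_cliqueFrame h1 h2 hw
  refine F.inClassC_or_colorable.resolve_right fun h => ?_
  have hle := h.chromaticNumber_le
  rw [hchi, Nat.cast_le, Nat.ceil_le, div_le_iff₀ (by norm_num)] at hle
  have hw' : (6 : ℚ) ≤ G.cliqueNum := by exact_mod_cast hw
  push_cast at hle
  linarith
end

section
/- For each k ∈ {4, 5} there exists a (P2+P3, gem)-free graph H with ω(H) = k, χ(H) = ⌈(5k − 1)/4⌉ = k + 1, and H not belonging to the class 𝒞. -/
open SimpleGraph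

/-- Two copies of the complete graph on `Option (Fin n)`, joined by an edge between the two
vertices `none`, together with two nonadjacent vertices adjacent to all vertices `some i`.
Equivalently, the clique blowup of `C5` with bags of sizes `1, n, 1, 1, n`, in which the first
vertex is replaced by a pair of false twins. -/
def twinBlowup (n : ℕ) : SimpleGraph (Bool ⊕ Bool × Option (Fin n)) where
  Adj
    | .inl _, .inl _ => False
    | .inl _, .inr (_, y) => y ≠ none
    | .inr (_, x), .inl _ => x ≠ none
    | .inr (s, x), .inr (t, y) => (s = t ∧ x ≠ y) ∨ (s ≠ t ∧ x = none ∧ y = none)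
  symm := ⟨by rintro (_ | ⟨s, x⟩) (_ | ⟨t, y⟩) h <;> grind⟩
  loopless := ⟨by rintro (_ | ⟨s, x⟩) h <;> simp_all⟩

namespace twinBlowup

variable {n : ℕ}

@[simp] lemma not_adj_inl_inl (a b : Bool) : ¬ (twinBlowup n).Adj (.inl a) (.inl b) := id

@[simp] lemma adj_inl_inr (a t : Bool) (y : Option (Fin n)) :
    (twinBlowup n).Adj (.inl a) (.inr (t, y)) ↔ y ≠ none := Iff.rfl

@[simp] lemma adj_inr_inl (s b : Bool) (x : Option (Fin n)) :
    (twinBlowup n).Adj (.inr (s, x)) (.inl b) ↔ x ≠ none := Iff.rfl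

@[simp] lemma adj_inr_inr (s t : Bool) (x y : Option (Fin n)) :
    (twinBlowup n).Adj (.inr (s, x)) (.inr (t, y)) ↔
      (s = t ∧ x ≠ y) ∨ (s ≠ t ∧ x = none ∧ y = none) := Iff.rfl

lemma isFreeOf_graphP2P3 : IsFreeOf (twinBlowup n) graphP2P3 := by
  refine ⟨fun f ↦ ?_⟩
  have adj : ∀ i j, (twinBlowup n).Adj (f i) (f j) ↔ graphP2P3.Adj i j := fun i j ↦ f.map_adj_iff
  have h01 := adj 0 1
  have h02 := adj 0 2
  have h03 := adj 0 3
  have h04 := adj 0 4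
  have h12 := adj 1 2
  have h13 := adj 1 3
  have h14 := adj 1 4
  have h23 := adj 2 3
  have h24 := adj 2 4
  have h34 := adj 3 4
  have i24 : f 2 = f 4 → (2 : Fin 5) = 4 := fun h ↦ f.injective h
  simp [graphP2P3] at h01 h02 h03 h04 h12 h13 h14 h23 h24 h34 i24
  generalize f 0 = a at *
  generalize f 1 = b at *
  generalize f 2 = c at *
  generalize f 3 = d at *
  generalize f 4 = e at *
  clear adj f
  rcases a with a | ⟨_ | _, a⟩ <;> rcases b with b | ⟨_ | _, b⟩ <;> simp at h01 <;>
    rcases c with c | ⟨_ | _, c⟩ <;> rcases d with d | ⟨_ | _, d⟩ <;> simp at h23 <;>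
    rcases e with e | ⟨_ | _, e⟩ <;> simp at * <;> grind

lemma isFreeOf_graphGem : IsFreeOf (twinBlowup n) graphGem := by
  refine ⟨fun f ↦ ?_⟩
  have adj : ∀ i j, (twinBlowup n).Adj (f i) (f j) ↔ graphGem.Adj i j := fun i j ↦ f.map_adj_iff
  have h01 := adj 0 1
  have h02 := adj 0 2
  have h03 := adj 0 3
  have h04 := adj 0 4
  have h12 := adj 1 2
  have h13 := adj 1 3
  have h14 := adj 1 4
  have h23 := adj 2 3
  have h24 := adj 2 4
  have h34 := adj 3 4
  simp [graphGem] at h01 h02 h03 h04 h12 h13 h14 h23 h24 h34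
  generalize f 0 = a at *
  generalize f 1 = b at *
  generalize f 2 = c at *
  generalize f 3 = d at *
  generalize f 4 = e at *
  clear adj f
  rcases a with a | ⟨_ | _, a⟩ <;> rcases b with b | ⟨_ | _, b⟩ <;> simp at h01 <;>
    rcases c with c | ⟨_ | _, c⟩ <;> rcases d with d | ⟨_ | _, d⟩ <;> simp at h23 <;>
    rcases e with e | ⟨_ | _, e⟩ <;> simp at * <;> grind

/-- The vertices `some i` of side `s`, together with the twin `false`. -/
def sideClique (s : Bool) : Option (Fin n) ↪ Bool ⊕ Bool × Option (Fin n) where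
  toFun x := x.elim (.inl false) fun i ↦ .inr (s, some i)
  inj' := by rintro (_ | _) (_ | _) h <;> simp_all

@[simp] lemma sideClique_none (s : Bool) : sideClique s (none : Option (Fin n)) = .inl false := rfl

@[simp] lemma sideClique_some (s : Bool) (i : Fin n) : sideClique s (some i) = .inr (s, some i) :=
  rfl

lemma adj_sideClique (s : Bool) {x y : Option (Fin n)} (h : x ≠ y) :
    (twinBlowup n).Adj (sideClique s x) (sideClique s y) := by
  rcases x with _ | x <;> rcases y with _ | y <;> simp_all

/-- The colouring of `twinBlowup n` by `Option (Fin n)` whose only monochromatic edge joins the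
two vertices `none`. -/
def label : Bool ⊕ Bool × Option (Fin n) → Option (Fin n) := Sum.elim (fun _ ↦ none) Prod.snd

lemma label_ne {v w : Bool ⊕ Bool × Option (Fin n)} (h : (twinBlowup n).Adj v w)
    (hv : v ≠ .inr (true, none) ∨ w ≠ .inr (false, none))
    (hw : v ≠ .inr (false, none) ∨ w ≠ .inr (true, none)) : label v ≠ label w := by
  rcases v with _ | ⟨s, x⟩ <;> rcases w with _ | ⟨t, y⟩ <;> simp [label] at * <;> grind

lemma cliqueNum_eq (hn : 1 ≤ n) : (twinBlowup n).cliqueNum = n + 1 := by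
  apply le_antisymm
  · obtain ⟨S, hS⟩ := (twinBlowup n).exists_isNClique_cliqueNum
    rw [← hS.card_eq]
    by_cases hcd : .inr (true, none) ∈ S ∧ .inr (false, none) ∈ S
    · have hsub : S ⊆ {.inr (true, none), .inr (false, none)} := by
        intro v hv
        by_contra hne
        simp only [Finset.mem_insert, Finset.mem_singleton, not_or] at hne
        have h1 := hS.isClique hv hcd.1 hne.1
        have h2 := hS.isClique hv hcd.2 hne.2
        rcases v with _ | ⟨s, x⟩
        · simp at h1
        · simp at h1 h2 hne
          grind
      exact (Finset.card_le_card hsub).trans (Finset.card_le_two.trans (by omega))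
    · have h : S.card ≤ (Finset.univ : Finset (Option (Fin n))).card := by
        refine Finset.card_le_card_of_injOn label (by simp) fun v hv w hw hvw ↦ ?_
        by_contra hne
        exact label_ne (hS.isClique hv hw hne) (by grind) (by grind) hvw
      simpa using h
  · have h : (twinBlowup n).IsNClique (n + 1) (Finset.univ.map (sideClique true)) := by
      rw [isNClique_iff]
      refine ⟨?_, by simp⟩
      rintro _ hv _ hw hne
      simp only [Finset.coe_map, Finset.coe_univ, Set.image_univ, Set.mem_range] at hv hw
      obtain ⟨x, rfl⟩ := hv
      obtain ⟨y, rfl⟩ := hw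
      exact adj_sideClique true fun h ↦ hne (h ▸ rfl)
    simpa [h.card_eq] using h.isClique.card_le_cliqueNum

lemma not_colorable : ¬ (twinBlowup n).Colorable (n + 1) := by
  intro h
  let C : (twinBlowup n).Coloring (Option (Fin n)) := h.toColoring (by simp)
  have port (s : Bool) : C (.inr (s, none)) = C (.inl false) := by
    have hinj : Function.Injective (C ∘ sideClique s) := fun x y hxy ↦ by
      by_contra hne
      exact C.valid (adj_sideClique s hne) hxy
    obtain ⟨_ | i, hx⟩ := Finite.injective_iff_surjective.mp hinj (C (.inr (s, none)))
    · exact hx.symm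
    · exact absurd hx (C.valid (by simp))
  exact C.valid (v := .inr (true, none)) (w := .inr (false, none)) (by simp)
    ((port true).trans (port false).symm)

lemma colorable : (twinBlowup n).Colorable (n + 2) := by
  let C : (twinBlowup n).Coloring (Option (Option (Fin n))) :=
    .mk (fun v ↦ if v = .inr (true, none) then none else some (label v)) fun {v w} h ↦ by
      have := h.ne
      have := label_ne h
      grind
  simpa using C.colorable

lemma chromaticNumber_eq : (twinBlowup n).chromaticNumber = ((n + 2 : ℕ) : ℕ∞) := by
  apply le_antisymm colorable.chromaticNumber_le
  by_contra! h
  obtain ⟨m, hm⟩ := ENat.ne_top_iff_exists.mp h.ne_top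
  rw [← hm, Nat.cast_lt] at h
  exact not_colorable ((chromaticNumber_le_iff_colorable.mp hm.ge).mono (by omega))

end twinBlowup

/-- In a clique blowup of `C5` with isolated vertices added, there are no false twins of positive
degree. -/
lemma blowupC5_eq_of_forall_adj_iff {t : Fin 5 → ℕ} {l : ℕ} (ht : ∀ i, 0 < t i)
    {x y z : (Σ i : Fin 5, Fin (t i)) ⊕ Fin l} (hxz : (blowupC5 t l).Adj x z)
    (hxy : ∀ w, (blowupC5 t l).Adj x w ↔ (blowupC5 t l).Adj y w) : x = y := by
  have hyz := (hxy z).mp hxz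
  have hnadj : ¬ (blowupC5 t l).Adj x y := fun h ↦ (blowupC5 t l).irrefl ((hxy y).mp h)
  rcases x with ⟨i, a⟩ | x
  swap
  · simp [blowupC5] at hxz
  rcases y with ⟨j, b⟩ | y
  swap
  · simp [blowupC5] at hyz
  have key (m : Fin 5) (hi : m ≠ i) (hj : m ≠ j) :
      (m = i + 1 ∨ i = m + 1) ↔ (m = j + 1 ∨ j = m + 1) := by
    have := hxy (.inl ⟨m, 0, ht m⟩)
    simp [blowupC5, hi, hj, hi.symm, hj.symm] at this
    grind
  by_contra hne
  have hnadj' : ¬ (i = j ∨ j = i + 1 ∨ i = j + 1) := by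
    simp [blowupC5, hne] at hnadj
    simp at hne
    grind
  clear hxy hnadj hne hyz hxz a b
  revert i j
  decide

lemma not_inClassC_twinBlowup {n : ℕ} (hn : 1 ≤ n) : ¬ InClassC (twinBlowup n) := by
  rintro ⟨t, l, ht, ⟨e⟩⟩
  have h : e (.inl true) = e (.inl false) := by
    refine blowupC5_eq_of_forall_adj_iff ht (z := e (.inr (true, some ⟨0, hn⟩)))
      (e.map_adj_iff.mpr (by simp)) fun w ↦ ?_
    obtain ⟨v, rfl⟩ := e.surjective w
    rw [e.map_adj_iff, e.map_adj_iff]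
    rcases v with _ | ⟨s, x⟩ <;> simp
  simpa using e.injective h

/-- For each `k ∈ {4, 5}` there is a (P2+P3, gem)-free graph `H` with `ω(H) = k`,
`χ(H) = ⌈(5k − 1)/4⌉ = k + 1`, and `H ∉ 𝒞`. -/
theorem exists_extremal_graph_not_inClassC :
    ∀ k : ℕ, k = 4 ∨ k = 5 →
      ∃ (V : Type) (_ : Fintype V) (H : SimpleGraph V),
        IsFreeOf H graphP2P3 ∧ IsFreeOf H graphGem ∧
        H.cliqueNum = k ∧
        H.chromaticNumber = ((k + 1 : ℕ) : ℕ∞) ∧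
        (⌈(5 * (k : ℚ) - 1) / 4⌉₊ : ℕ) = k + 1 ∧
        ¬ InClassC H := by
  intro k hk
  obtain ⟨n, rfl⟩ : ∃ n, k = n + 1 := ⟨k - 1, by omega⟩
  refine ⟨_, inferInstance, twinBlowup n, twinBlowup.isFreeOf_graphP2P3,
    twinBlowup.isFreeOf_graphGem, twinBlowup.cliqueNum_eq (by omega),
    twinBlowup.chromaticNumber_eq, ?_, not_inClassC_twinBlowup (by omega)⟩
  rw [Nat.ceil_eq_iff (by omega)]
  rcases hk with hk | hk <;> obtain rfl : n = _ := Nat.succ_injective hk <;> norm_num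
end

section
/- Let G be a (P2+P3, gem)-free graph containing an induced 5-cycle with vertex set C = {v1,…,v5} as in the setup, with the sets A_i, B_i, X_i, Y_i, Z_i, T, A, B, X, Y, Z defined accordingly. Then for each i ∈ {1,…,5} (indices mod 5): (O1) A_{i+1} ∪ A_{i−1} ∪ X_i is anticomplete to A_i ∪ B_i ∪ B_{i−1} ∪ Y_i; (O2) A_{i+2} ∪ A_{i−2} is complete to A_i ∪ B_{i−1} ∪ B_i ∪ Y_i; (O3) A_i ∪ A_{i+1} ∪ B_i ∪ T is a stable set; (O4) at least one of B_i and (A \ A_{i−2}) ∪ B_{i+1} ∪ B_{i−1} is empty. -/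
open SimpleGraph

/-- Five vertices of a `P2 + P3`-free graph do not induce an edge `ab` and a path `cde`. -/
theorem IsFreeOf.not_p2p3 {V : Type*} {G : SimpleGraph V} (h : IsFreeOf G graphP2P3)
    {a b c d e : V} (hce : c ≠ e) (ab : G.Adj a b) (cd : G.Adj c d) (de : G.Adj d e)
    (ac : ¬ G.Adj a c) (ad : ¬ G.Adj a d) (ae : ¬ G.Adj a e)
    (bc : ¬ G.Adj b c) (bd : ¬ G.Adj b d) (be : ¬ G.Adj b e) (ce : ¬ G.Adj c e) : False := by
  refine h.false ⟨⟨![a, b, c, d, e], fun x y hxy => ?_⟩, fun {x y} => ?_⟩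
  · fin_cases x <;> fin_cases y <;> simp at hxy ⊢ <;> grind [G.adj_comm, G.ne_of_adj]
  · change G.Adj (![a, b, c, d, e] x) (![a, b, c, d, e] y) ↔ _
    fin_cases x <;> fin_cases y <;> simp [graphP2P3] <;> grind [G.adj_comm]

/-- A gem-free graph has no induced path `abcd` with all its vertices adjacent to `e`. -/
theorem IsFreeOf.not_gem {V : Type*} {G : SimpleGraph V} (h : IsFreeOf G graphGem)
    {a b c d e : V} (ab : G.Adj a b) (bc : G.Adj b c) (cd : G.Adj c d)
    (ea : G.Adj e a) (eb : G.Adj e b) (ec : G.Adj e c) (ed : G.Adj e d)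
    (ac : ¬ G.Adj a c) (ad : ¬ G.Adj a d) (bd : ¬ G.Adj b d) : False := by
  refine h.false ⟨⟨![a, b, c, d, e], fun x y hxy => ?_⟩, fun {x y} => ?_⟩
  · fin_cases x <;> fin_cases y <;> simp at hxy ⊢ <;> grind [G.adj_comm, G.ne_of_adj]
  · change G.Adj (![a, b, c, d, e] x) (![a, b, c, d, e] y) ↔ _
    fin_cases x <;> fin_cases y <;> simp [graphGem] <;> grind [G.adj_comm]

section InducedC5

variable {V : Type*} {G : SimpleGraph V} {v : Fin 5 → V}

/-- A vertex `y` that sees `v i` but neither of the two vertices opposite to `v i` has no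
neighbor off the cycle missing all three of them. -/
theorem IsInducedC5.not_adj_of_adj_of_not_adj (hC : IsInducedC5 G v)
    (h1 : IsFreeOf G graphP2P3) {x y : V} (i : Fin 5) (hx : x ∉ Set.range v)
    (x0 : ¬ G.Adj x (v i)) (x2 : ¬ G.Adj x (v (i + 2))) (x3 : ¬ G.Adj x (v (i + 3)))
    (y0 : G.Adj y (v i)) (y2 : ¬ G.Adj y (v (i + 2))) (y3 : ¬ G.Adj y (v (i + 3))) :
    ¬ G.Adj x y := fun hxy =>
  h1.not_p2p3 (a := v (i + 2)) (b := v (i + 3)) (c := v i) (d := y) (e := x)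
    (fun h => hx ⟨i, h⟩) ((hC.2 _ _).2 (by grind)) y0.symm hxy.symm
    (mt (hC.2 _ _).1 (by grind)) (mt G.adj_symm y2) (mt G.adj_symm x2)
    (mt (hC.2 _ _).1 (by grind)) (mt G.adj_symm y3) (mt G.adj_symm x3) (mt G.adj_symm x0)

/-- Two vertices missing three consecutive vertices of the cycle are nonadjacent. -/
theorem IsInducedC5.not_adj_of_not_adj (hC : IsInducedC5 G v)
    (h1 : IsFreeOf G graphP2P3) {x y : V} (i : Fin 5)
    (x2 : ¬ G.Adj x (v (i + 2))) (x3 : ¬ G.Adj x (v (i + 3))) (x4 : ¬ G.Adj x (v (i + 4)))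
    (y2 : ¬ G.Adj y (v (i + 2))) (y3 : ¬ G.Adj y (v (i + 3))) (y4 : ¬ G.Adj y (v (i + 4))) :
    ¬ G.Adj x y := fun hxy =>
  h1.not_p2p3 (hC.1.ne (by grind : i + 2 ≠ i + 4)) hxy ((hC.2 _ _).2 (by grind))
    ((hC.2 (i + 3) _).2 (by grind)) x2 x3 x4 y2 y3 y4 (mt (hC.2 _ _).1 (by grind))

/-- Let `v j` and `v k` be adjacent and both nonadjacent to `v i`. A vertex off the cycle whose
only neighbor among these three is `v k` sees every vertex whose only neighbor among them is
`v i`. -/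
theorem IsFreeOf.adj_of_adj_of_adj
    (h1 : IsFreeOf G graphP2P3) {x y : V} {i j k : Fin 5} (hx : x ∉ Set.range v)
    (ij : ¬ G.Adj (v i) (v j)) (ik : ¬ G.Adj (v i) (v k)) (jk : G.Adj (v j) (v k))
    (xi : ¬ G.Adj x (v i)) (xj : ¬ G.Adj x (v j)) (xk : G.Adj x (v k))
    (yi : G.Adj y (v i)) (yj : ¬ G.Adj y (v j)) (yk : ¬ G.Adj y (v k)) :
    G.Adj x y := by_contra fun hxy =>
  h1.not_p2p3 (fun h => hx ⟨j, h⟩) yi.symm jk xk.symm ij ik (mt G.adj_symm xi) yj yk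
    (mt G.adj_symm hxy) (mt G.adj_symm xj)

/-- Two vertices that see `v i` and miss both vertices opposite to `v i` are adjacent. -/
theorem IsInducedC5.adj_of_common_adj (hC : IsInducedC5 G v)
    (h1 : IsFreeOf G graphP2P3) {x y : V} (i : Fin 5) (hxy : x ≠ y)
    (x0 : G.Adj x (v i)) (x2 : ¬ G.Adj x (v (i + 2))) (x3 : ¬ G.Adj x (v (i + 3)))
    (y0 : G.Adj y (v i)) (y2 : ¬ G.Adj y (v (i + 2))) (y3 : ¬ G.Adj y (v (i + 3))) :
    G.Adj x y := by_contra fun h =>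
  h1.not_p2p3 (a := v (i + 2)) (b := v (i + 3)) (c := x) (d := v i) (e := y) hxy
    ((hC.2 _ _).2 (by grind)) x0 y0.symm (mt G.adj_symm x2) (mt (hC.2 _ _).1 (by grind))
    (mt G.adj_symm y2) (mt G.adj_symm x3) (mt (hC.2 _ _).1 (by grind)) (mt G.adj_symm y3) h

theorem IsInducedC5.setB_eq_empty_or (hC : IsInducedC5 G v) (h1 : IsFreeOf G graphP2P3)
    (h2 : IsFreeOf G graphGem) (i : Fin 5) : setB G v i = ∅ ∨ setB G v (i + 1) = ∅ := by
  simp only [Set.eq_empty_iff_forall_notMem]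
  by_contra! h
  obtain ⟨⟨x, hx, x'⟩, y, hy, y'⟩ := h
  have hyx : G.Adj y x := h1.adj_of_adj_of_adj (i := i) (j := i + 3) (k := i + 2) hy
    (by rw [hC.2]; grind) (by rw [hC.2]; grind) (by rw [hC.2]; grind)
    (by grind) (by grind) (by grind) (by grind) (by grind) (by grind)
  refine h2.not_gem (a := v i) (b := x) (c := y) (d := v (i + 2)) (e := v (i + 1)) ?_ hyx.symm
    ?_ ?_ ?_ ?_ ?_ ?_ ?_ ?_ <;> grind [G.adj_comm, hC.2]

theorem IsInducedC5.anticompleteTo (hC : IsInducedC5 G v) (h1 : IsFreeOf G graphP2P3)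
    (i : Fin 5) :
    AnticompleteTo G (setA G v (i+1) ∪ setA G v (i-1) ∪ setX G v i)
      (setA G v i ∪ setB G v i ∪ setB G v (i-1) ∪ setY G v i) := by
  rintro x ((⟨hx, x'⟩ | ⟨hx, x'⟩) | ⟨hx, x'⟩) y (((⟨-, y'⟩ | ⟨-, y'⟩) | ⟨-, y'⟩) | ⟨-, y'⟩) <;>
  exact hC.not_adj_of_adj_of_not_adj h1 i hx
    (by grind) (by grind) (by grind) (by grind) (by grind) (by grind)

theorem IsInducedC5.completeTo (hC : IsInducedC5 G v) (h1 : IsFreeOf G graphP2P3)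
    (i : Fin 5) :
    CompleteTo G (setA G v (i+2) ∪ setA G v (i-2))
      (setA G v i ∪ setB G v (i-1) ∪ setB G v i ∪ setY G v i) := by
  have h02 : ¬ G.Adj (v i) (v (i + 2)) := by rw [hC.2]; grind
  have h03 : ¬ G.Adj (v i) (v (i + 3)) := by rw [hC.2]; grind
  have h23 : G.Adj (v (i + 2)) (v (i + 3)) := by rw [hC.2]; grind
  rintro x (⟨hx, x'⟩ | ⟨hx, x'⟩) y (((⟨-, y'⟩ | ⟨-, y'⟩) | ⟨-, y'⟩) | ⟨-, y'⟩)
  iterate 4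
    exact h1.adj_of_adj_of_adj hx h03 h02 h23.symm
      (by grind) (by grind) (by grind) (by grind) (by grind) (by grind)
  iterate 4
    exact h1.adj_of_adj_of_adj hx h02 h03 h23
      (by grind) (by grind) (by grind) (by grind) (by grind) (by grind)

theorem IsInducedC5.isStableSet (hC : IsInducedC5 G v) (h1 : IsFreeOf G graphP2P3)
    (i : Fin 5) :
    IsStableSet G (setA G v i ∪ setA G v (i+1) ∪ setB G v i ∪ setT G v) := by
  have key : ∀ x ∈ setA G v i ∪ setA G v (i+1) ∪ setB G v i ∪ setT G v,
      ¬ G.Adj x (v (i + 2)) ∧ ¬ G.Adj x (v (i + 3)) ∧ ¬ G.Adj x (v (i + 4)) := by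
    rintro x (((⟨-, x'⟩ | ⟨-, x'⟩) | ⟨-, x'⟩) | ⟨-, x'⟩) <;> grind
  intro x hx y hy _
  obtain ⟨x2, x3, x4⟩ := key x hx
  obtain ⟨y2, y3, y4⟩ := key y hy
  exact hC.not_adj_of_not_adj h1 i x2 x3 x4 y2 y3 y4

/-- If `B i` is nonempty, then `A j` is empty unless `v j` is opposite to the edge
`v i v (i + 1)`. -/
theorem IsInducedC5.notMem_setA_of_mem_setB (hC : IsInducedC5 G v) (h1 : IsFreeOf G graphP2P3)
    {i j : Fin 5} (hj : j ≠ i - 2) {x y : V} (hx : x ∈ setB G v i) : y ∉ setA G v j := by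
  intro hy
  have x' := hx.2
  have y' := hy.2
  have hj : j = i ∨ j = i + 1 ∨ j = i + 2 ∨ j = i - 1 := by grind
  rcases hj with rfl | rfl | rfl | rfl
  · have hne : x ≠ y := by
      rintro rfl
      have := (y' (j + 1)).1 ((x' (j + 1)).2 (.inr rfl))
      grind
    exact hC.isStableSet h1 j (by simp [hx]) (by simp [hy]) hne
      (hC.adj_of_common_adj h1 j hne (by grind) (by grind) (by grind)
        (by grind) (by grind) (by grind))
  · have hne : x ≠ y := by
      rintro rfl
      have := (y' i).1 ((x' i).2 (.inl rfl))
      grind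
    exact hC.isStableSet h1 i (by simp [hx]) (by simp [hy]) hne
      (hC.adj_of_common_adj h1 (i + 1) hne (by grind) (by grind) (by grind)
        (by grind) (by grind) (by grind))
  · refine hC.anticompleteTo h1 (i + 1) y ?_ x ?_ (hC.completeTo h1 i y (by simp [hy]) x
      (by simp [hx]))
    · simp [add_assoc, hy]
    · simp [hx]
  · refine hC.anticompleteTo h1 i y (by simp [hy]) x (by simp [hx])
      (hC.completeTo h1 (i + 1) y ?_ x ?_)
    · rw [show i + 1 - 2 = i - 1 by grind]
      simp [hy]
    · simp [hx]

end InducedC5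

/-- Properties (O1)–(O4) of the partition of a (P2+P3, gem)-free graph with
respect to an induced 5-cycle. -/
theorem properties_O1_O4 {V : Type*} [Fintype V] (G : SimpleGraph V)
    (h1 : IsFreeOf G graphP2P3) (h2 : IsFreeOf G graphGem)
    (v : Fin 5 → V) (hC : IsInducedC5 G v) :
    ∀ i : Fin 5,
      AnticompleteTo G (setA G v (i+1) ∪ setA G v (i-1) ∪ setX G v i)
        (setA G v i ∪ setB G v i ∪ setB G v (i-1) ∪ setY G v i) ∧
      CompleteTo G (setA G v (i+2) ∪ setA G v (i-2))
        (setA G v i ∪ setB G v (i-1) ∪ setB G v i ∪ setY G v i) ∧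
      IsStableSet G (setA G v i ∪ setA G v (i+1) ∪ setB G v i ∪ setT G v) ∧
      (setB G v i = ∅ ∨
        ((⋃ j, setA G v j) \ setA G v (i-2)) ∪ setB G v (i+1) ∪ setB G v (i-1) = ∅) := by
  refine fun i => ⟨hC.anticompleteTo h1 i, hC.completeTo h1 i, hC.isStableSet h1 i, ?_⟩
  refine or_iff_not_imp_left.2 fun hB => ?_
  obtain ⟨x, hx⟩ := Set.nonempty_iff_ne_empty.2 hB
  have hsucc := (hC.setB_eq_empty_or h1 h2 i).resolve_left hB
  have hpred := (hC.setB_eq_empty_or h1 h2 (i - 1)).resolve_right (by rwa [sub_add_cancel])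
  rw [hsucc, hpred, Set.union_empty, Set.union_empty, Set.eq_empty_iff_forall_notMem]
  rintro y ⟨hy, hy'⟩
  obtain ⟨j, hy⟩ := Set.mem_iUnion.1 hy
  exact hC.notMem_setA_of_mem_setB h1 (by rintro rfl; exact hy' hy) hx hy
end

section
/- Let G be a (P2+P3, gem)-free graph containing an induced 5-cycle with vertex set C = {v1,…,v5} as in the setup, with the sets A_i, B_i, X_i, Y_i, Z_i, T defined accordingly. Then for each i ∈ {1,…,5} (indices mod 5): (M1) at least one of Y_i and B_{i+1} ∪ B_{i−2} ∪ X_{i+2} ∪ X_{i−2} is empty; (M2) at least one of Z_i and B_{i+1} ∪ B_{i−2} ∪ Y_{i+1} ∪ Y_{i−1} is empty; (M3) Y_i is a clique, and Y_i is complete to Y_{i+1} ∪ A_i ∪ B_i ∪ B_{i−1} ∪ Z_{i+2} ∪ Z_{i−2}; (M4) Y_i is anticomplete to Y_{i+2} ∪ Y_{i−2} ∪ T; (M5) if Y_i and Y_{i+1} are both nonempty, then A_{i−2} is empty. -/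
open SimpleGraph

section InducedPatterns

instance : DecidableRel graphGem.Adj := fun x y =>
  decidable_of_iff' _ (SimpleGraph.fromRel_adj _ x y)

instance : DecidableRel graphP2P3.Adj := fun x y =>
  decidable_of_iff' _ (SimpleGraph.fromRel_adj _ x y)

variable {V : Type*} {G : SimpleGraph V}

/-- A gem-free graph has no induced path `a b c d` with a vertex `e` complete to it. -/
theorem IsFreeOf.gem_false (hG : IsFreeOf G graphGem) (a b c d e : V)
    (h : (G.Adj a b ∧ G.Adj b c ∧ G.Adj c d) ∧
      (G.Adj e a ∧ G.Adj e b ∧ G.Adj e c ∧ G.Adj e d) ∧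
      ¬ G.Adj a c ∧ ¬ G.Adj a d ∧ ¬ G.Adj b d) : False := by
  have hadj : ∀ i j, G.Adj (![a, b, c, d, e] i) (![a, b, c, d, e] j) ↔ graphGem.Adj i j := by
    obtain ⟨⟨hab, hbc, hcd⟩, ⟨hea, heb, hec, hed⟩, hac, had, hbd⟩ := h
    intro i j
    fin_cases i <;> fin_cases j <;>
      simp [graphGem, hab, hbc, hcd, hea, heb, hec, hed, hac, had, hbd, hab.symm, hbc.symm,
        hcd.symm, hea.symm, heb.symm, hec.symm, hed.symm, G.adj_comm c a, G.adj_comm d a,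
        G.adj_comm d b]
  refine hG.false ⟨⟨![a, b, c, d, e], fun i j hij => ?_⟩, fun {i j} => hadj i j⟩
  have hrow : ∀ k, graphGem.Adj i k ↔ graphGem.Adj j k := fun k => by
    rw [← hadj, ← hadj, hij]
  clear hij
  revert i j
  decide

/-- A `P2 + P3`-free graph has no edge `a b` anticomplete to an induced path `c d e`. -/
theorem IsFreeOf.P2P3_false (hG : IsFreeOf G graphP2P3) (a b c d e : V)
    (h : (G.Adj a b ∧ G.Adj c d ∧ G.Adj d e ∧ c ≠ e ∧ ¬ G.Adj c e) ∧
      (¬ G.Adj a c ∧ ¬ G.Adj a d ∧ ¬ G.Adj a e) ∧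
      ¬ G.Adj b c ∧ ¬ G.Adj b d ∧ ¬ G.Adj b e) : False := by
  have hadj : ∀ i j, G.Adj (![a, b, c, d, e] i) (![a, b, c, d, e] j) ↔ graphP2P3.Adj i j := by
    obtain ⟨⟨hab, hcd, hde, -, hce⟩, ⟨hac, had, hae⟩, hbc, hbd, hbe⟩ := h
    intro i j
    fin_cases i <;> fin_cases j <;>
      simp [graphP2P3, hab, hcd, hde, hce, hac, had, hae, hbc, hbd, hbe, hab.symm, hcd.symm,
        hde.symm, G.adj_comm e c, G.adj_comm c a, G.adj_comm d a, G.adj_comm e a,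
        G.adj_comm c b, G.adj_comm d b, G.adj_comm e b]
  refine hG.false ⟨⟨![a, b, c, d, e], fun i j hij => ?_⟩, fun {i j} => hadj i j⟩
  have hrow : ∀ k, graphP2P3.Adj i k ↔ graphP2P3.Adj j k := fun k => by
    rw [← hadj, ← hadj, hij]
  have htwin : i = j ∨ (i = 2 ∧ j = 4) ∨ (i = 4 ∧ j = 2) := by
    clear hij
    revert i j
    decide
  rcases htwin with rfl | ⟨rfl, rfl⟩ | ⟨rfl, rfl⟩
  · rfl
  · exact absurd hij h.1.2.2.2.1
  · exact absurd hij.symm h.1.2.2.2.1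

end InducedPatterns

section AroundC5
variable {V : Type*} {G : SimpleGraph V} {v : Fin 5 → V} {i : Fin 5} {y w : V}

theorem false_of_mem_setY_of_mem_setB_or_setX
    (h1 : IsFreeOf G graphP2P3) (h2 : IsFreeOf G graphGem)
    (hC : IsInducedC5 G v) (hy : y ∈ setY G v i)
    (hw : w ∈ setB G v (i+1) ∪ setB G v (i-2) ∪ setX G v (i+2) ∪ setX G v (i-2)) : False := by
  obtain ⟨-, hy⟩ := hy
  by_cases h : G.Adj y w
  all_goals
    obtain ((⟨hwC, hw⟩ | ⟨hwC, hw⟩) | ⟨hwC, hw⟩) | ⟨hwC, hw⟩ := hw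
    all_goals have hne : ∀ j, w ≠ v j := fun j hj => hwC ⟨j, hj.symm⟩
  on_goal 1 => refine h2.gem_false (v (i-1)) (v i) (v (i+1)) w y ?_
  on_goal 2 => refine h2.gem_false (v (i+1)) (v i) (v (i-1)) w y ?_
  on_goal 3 => refine h2.gem_false (v (i-1)) (v i) (v (i+1)) w y ?_
  on_goal 4 => refine h2.gem_false (v (i+1)) (v i) (v (i-1)) w y ?_
  on_goal 5 => refine h1.P2P3_false y (v i) w (v (i+2)) (v (i-2)) ?_
  on_goal 6 => refine h1.P2P3_false y (v i) w (v (i-2)) (v (i+2)) ?_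
  on_goal 7 => refine h1.P2P3_false y (v i) w (v (i-2)) (v (i+2)) ?_
  on_goal 8 => refine h1.P2P3_false y (v i) w (v (i+2)) (v (i-2)) ?_
  all_goals
    simp only [G.adj_comm (v _) w, hy, hw, hC.2, hne, h, ne_eq]
    clear * -
    revert i
    decide

theorem false_of_mem_setZ_of_mem_setB_or_setY
    (h1 : IsFreeOf G graphP2P3) (h2 : IsFreeOf G graphGem)
    (hC : IsInducedC5 G v) (hy : y ∈ setZ G v i)
    (hw : w ∈ setB G v (i+1) ∪ setB G v (i-2) ∪ setY G v (i+1) ∪ setY G v (i-1)) : False := by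
  obtain ⟨hyC, hy⟩ := hy
  by_cases h : G.Adj w y
  all_goals
    obtain ((⟨-, hw⟩ | ⟨-, hw⟩) | ⟨-, hw⟩) | ⟨-, hw⟩ := hw
    all_goals have hne : ∀ j, y ≠ v j := fun j hj => hyC ⟨j, hj.symm⟩
  on_goal 1 => refine h2.gem_false (v (i+1)) w y (v (i-2)) (v (i+2)) ?_
  on_goal 2 => refine h2.gem_false (v (i-1)) w y (v (i+2)) (v (i-2)) ?_
  on_goal 3 => refine h2.gem_false (v (i+1)) w y (v (i-2)) (v (i+2)) ?_
  on_goal 4 => refine h2.gem_false (v (i-1)) w y (v (i+2)) (v (i-2)) ?_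
  on_goal 5 => refine h1.P2P3_false w (v (i+1)) y (v (i-2)) (v (i-1)) ?_
  on_goal 6 => refine h1.P2P3_false w (v (i-1)) y (v (i+2)) (v (i+1)) ?_
  on_goal 7 => refine h1.P2P3_false w (v (i+1)) y (v (i-2)) (v (i-1)) ?_
  on_goal 8 => refine h1.P2P3_false w (v (i-1)) y (v (i+2)) (v (i+1)) ?_
  all_goals
    simp only [G.adj_comm (v _) y, G.adj_comm (v _) w, hy, hw, hC.2, hne, h, ne_eq]
    clear * -
    revert i
    decide

theorem setY_adj_of_ne (h1 : IsFreeOf G graphP2P3) (hC : IsInducedC5 G v)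
    (hy : y ∈ setY G v i) (hne : y ≠ w)
    (hw : w ∈ setY G v i ∪ setA G v i ∪ setB G v i ∪ setB G v (i-1)) : G.Adj y w := by
  by_contra h
  obtain ⟨-, hy⟩ := hy
  refine h1.P2P3_false (v (i+2)) (v (i-2)) y (v i) w ?_
  obtain ((⟨-, hw⟩ | ⟨-, hw⟩) | ⟨-, hw⟩) | ⟨-, hw⟩ := hw
  all_goals
    simp only [G.adj_comm (v _) y, G.adj_comm (v _) w, hy, hw, hC.2, hne, h, ne_eq]
    clear * -
    revert i
    decide

theorem setY_adj (h2 : IsFreeOf G graphGem) (hC : IsInducedC5 G v) (hy : y ∈ setY G v i)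
    (hw : w ∈ setY G v (i+1) ∪ setZ G v (i+2) ∪ setZ G v (i-2)) : G.Adj y w := by
  by_contra h
  obtain ⟨-, hy⟩ := hy
  obtain (⟨-, hw⟩ | ⟨-, hw⟩) | ⟨-, hw⟩ := hw
  on_goal 1 => refine h2.gem_false (v (i-1)) y (v (i+1)) w (v i) ?_
  on_goal 2 => refine h2.gem_false (v (i+1)) y (v (i-1)) w (v i) ?_
  on_goal 3 => refine h2.gem_false (v (i-1)) y (v (i+1)) w (v i) ?_
  all_goals
    simp only [G.adj_comm (v _) y, G.adj_comm (v _) w, hy, hw, hC.2, h]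
    clear * -
    revert i
    decide

theorem setY_not_adj (h1 : IsFreeOf G graphP2P3) (h2 : IsFreeOf G graphGem)
    (hC : IsInducedC5 G v) (hy : y ∈ setY G v i)
    (hw : w ∈ setY G v (i+2) ∪ setY G v (i-2) ∪ setT G v) : ¬ G.Adj y w := by
  intro h
  have h' := h.symm
  obtain ⟨-, hy⟩ := hy
  obtain (⟨hwC, hw⟩ | ⟨hwC, hw⟩) | ⟨hwC, hw⟩ := hw
  all_goals have hne : ∀ j, w ≠ v j := fun j hj => hwC ⟨j, hj.symm⟩
  on_goal 1 => refine h2.gem_false (v (i-1)) (v i) (v (i+1)) w y ?_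
  on_goal 2 => refine h2.gem_false (v (i+1)) (v i) (v (i-1)) w y ?_
  on_goal 3 => refine h1.P2P3_false (v (i+2)) (v (i-2)) w y (v i) ?_
  all_goals
    simp only [G.adj_comm (v _) y, G.adj_comm (v _) w, hy, hw, hC.2, hne, h, h', ne_eq]
    clear * -
    revert i
    decide

theorem setA_eq_empty_of_mem_setY (h1 : IsFreeOf G graphP2P3) (h2 : IsFreeOf G graphGem)
    (hC : IsInducedC5 G v) {z : V} (hy : y ∈ setY G v i) (hz : z ∈ setY G v (i+1)) :
    setA G v (i-2) = ∅ := by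
  refine Set.eq_empty_of_forall_notMem fun w hw => ?_
  have hyz : G.Adj y z := setY_adj h2 hC hy (.inl (.inl hz))
  obtain ⟨hwC, hw⟩ := hw
  obtain ⟨-, hy⟩ := hy
  obtain ⟨-, hz⟩ := hz
  have hne : ∀ j, w ≠ v j := fun j hj => hwC ⟨j, hj.symm⟩
  have hwy : G.Adj w y := by
    by_contra h
    have h' : ¬ G.Adj y w := fun hyw => h hyw.symm
    refine h1.P2P3_false y (v i) w (v (i-2)) (v (i+2)) ?_
    simp only [G.adj_comm (v _) w, hy, hw, hC.2, hne, h', ne_eq]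
    clear * -
    revert i
    decide
  have hwz : G.Adj w z := by
    by_contra h
    have h' : ¬ G.Adj z w := fun hzw => h hzw.symm
    refine h1.P2P3_false z (v (i+1)) w (v (i-2)) (v (i-1)) ?_
    simp only [G.adj_comm (v _) w, hz, hw, hC.2, hne, h', ne_eq]
    clear * -
    revert i
    decide
  refine h2.gem_false (v (i-1)) (v i) z w y ?_
  simp only [G.adj_comm (v _) z, G.adj_comm (v _) w, hy, hz, hw, hC.2, hyz,
    hwy.symm, hwz.symm]
  clear * -
  revert i
  decide

end AroundC5

/-- Properties (M1)–(M5) of the partition of a (P2+P3, gem)-free graph with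
respect to an induced 5-cycle. -/
theorem properties_M1_M5 {V : Type*} [Fintype V] (G : SimpleGraph V)
    (h1 : IsFreeOf G graphP2P3) (h2 : IsFreeOf G graphGem)
    (v : Fin 5 → V) (hC : IsInducedC5 G v) :
    ∀ i : Fin 5,
      (setY G v i = ∅ ∨
        setB G v (i+1) ∪ setB G v (i-2) ∪ setX G v (i+2) ∪ setX G v (i-2) = ∅) ∧
      (setZ G v i = ∅ ∨
        setB G v (i+1) ∪ setB G v (i-2) ∪ setY G v (i+1) ∪ setY G v (i-1) = ∅) ∧
      (G.IsClique (setY G v i) ∧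
        CompleteTo G (setY G v i)
          (setY G v (i+1) ∪ setA G v i ∪ setB G v i ∪ setB G v (i-1) ∪
            setZ G v (i+2) ∪ setZ G v (i-2))) ∧
      AnticompleteTo G (setY G v i) (setY G v (i+2) ∪ setY G v (i-2) ∪ setT G v) ∧
      ((setY G v i).Nonempty → (setY G v (i+1)).Nonempty → setA G v (i-2) = ∅) := by
  intro i
  refine ⟨?_, ?_, ⟨fun y hy w hw hne => ?_, fun y hy w hw => ?_⟩, fun y hy w hw => ?_, ?_⟩
  · refine or_iff_not_imp_left.2 fun hY => Set.eq_empty_of_forall_notMem fun w hw => ?_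
    obtain ⟨y, hy⟩ := Set.nonempty_iff_ne_empty.2 hY
    exact false_of_mem_setY_of_mem_setB_or_setX h1 h2 hC hy hw
  · refine or_iff_not_imp_left.2 fun hZ => Set.eq_empty_of_forall_notMem fun w hw => ?_
    obtain ⟨y, hy⟩ := Set.nonempty_iff_ne_empty.2 hZ
    exact false_of_mem_setZ_of_mem_setB_or_setY h1 h2 hC hy hw
  · exact setY_adj_of_ne h1 hC hy hne (.inl (.inl (.inl hw)))
  · obtain ((((hw | hw) | hw) | hw) | hw) | hw := hw
    · exact setY_adj h2 hC hy (.inl (.inl hw))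
    · refine setY_adj_of_ne h1 hC hy ?_ (.inl (.inl (.inr hw)))
      rintro rfl
      exact absurd (fun j => (hy.2 j).symm.trans (hw.2 j)) (by clear * -; revert i; decide)
    · refine setY_adj_of_ne h1 hC hy ?_ (.inl (.inr hw))
      rintro rfl
      exact absurd (fun j => (hy.2 j).symm.trans (hw.2 j)) (by clear * -; revert i; decide)
    · refine setY_adj_of_ne h1 hC hy ?_ (.inr hw)
      rintro rfl
      exact absurd (fun j => (hy.2 j).symm.trans (hw.2 j)) (by clear * -; revert i; decide)
    · exact setY_adj h2 hC hy (.inl (.inr hw))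
    · exact setY_adj h2 hC hy (.inr hw)
  · exact setY_not_adj h1 h2 hC hy hw
  · rintro ⟨y, hy⟩ ⟨z, hz⟩
    exact setA_eq_empty_of_mem_setY h1 h2 hC hy hz
end
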